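/- Let λ, μ ∈ P^+ and set ν = λ + μ. Let π_λ⊗π_μ denote the concatenated path (π_λ⊗π_μ)(t) = 2tλ for t ∈ [0, 1/2] and = λ + (2t−1)μ for t ∈ [1/2, 1], and let π_ν(t) = tν. Then the highest weight crystals 𝓕(π_λ⊗π_μ) and 𝓕π_ν = ℙ_ν are isomorphic; concretely: (i) for every finite sequence i_1, …, i_k ∈ I, f_{i_1}⋯f_{i_k}(π_λ⊗π_μ) = 0 (computed inside the crystal generated by π_λ⊗π_μ in ℙ_λ⊗ℙ_μ) if and only if f_{i_1}⋯f_{i_k}π_ν = 0 (computed inside ℙ_ν); (ii) when both are nonzero they have the same endpoint (weight); and (iii) for two such monomials f, f' with fπ_ν, f'π_ν ≠ 0, one has f(π_λ⊗π_μ) = f'(π_λ⊗π_μ) if and only if fπ_ν = f'π_ν. Hence the map fπ_ν ↦ f(π_λ⊗π_μ) is a well-defined weight-preserving crystal isomorphism sending π_ν to π_λ⊗π_μ. -/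

import Mathlib

namespace GKM

variable {I V : Type*} [AddCommGroup V] [Module ℚ V]

/-- The simple "reflection" `r_i : x ↦ x - α_i^∨(x) • α_i` (an endomorphism of `h*`). -/
def srefl (α : I → V) (coroot : I → (V →ₗ[ℚ] ℚ)) (i : I) : Module.End ℚ V :=
  LinearMap.id - (coroot i).smulRight (α i)

/-- The dual map `h ↦ h - h(α_i) • α_i^∨` on linear functionals; for a real index `i`
this is `r_i^∨ : h ↦ h ∘ r_i⁻¹ = h ∘ r_i`. -/
def crefl (α : I → V) (coroot : I → (V →ₗ[ℚ] ℚ)) (i : I) :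
    Module.End ℚ (V →ₗ[ℚ] ℚ) :=
  LinearMap.id - (LinearMap.applyₗ (α i)).smulRight (coroot i)

/-- The monoid `T` generated by all the `r_i`, `i ∈ I`. -/
def Tmon (α : I → V) (coroot : I → (V →ₗ[ℚ] ℚ)) : Submonoid (Module.End ℚ V) :=
  Submonoid.closure (Set.range (srefl α coroot))

/-- The Weyl group `W` generated by the `r_i` with `i` real; since each generator is an
involution, the submonoid it generates coincides with the group it generates. -/
def Wmon (A : I → I → ℤ) (α : I → V) (coroot : I → (V →ₗ[ℚ] ℚ)) :
    Submonoid (Module.End ℚ V) :=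
  Submonoid.closure (srefl α coroot '' {i | A i i = 2})

/-- `Q^+`, the set of `ℕ`-linear combinations of simple roots. -/
def Qplus (α : I → V) : Set V :=
  {x | ∃ c : I →₀ ℕ, x = c.sum fun i n => (n : ℚ) • α i}

/-- The weight lattice `P`. -/
def Pint (coroot : I → (V →ₗ[ℚ] ℚ)) : Set V :=
  {x | ∀ i, ∃ n : ℤ, coroot i x = (n : ℚ)}

/-- The dominant integral weights `P^+`. -/
def Pplus (coroot : I → (V →ₗ[ℚ] ℚ)) : Set V :=
  {x | (∀ i, ∃ n : ℤ, coroot i x = (n : ℚ)) ∧ ∀ i, 0 ≤ coroot i x}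

/-- The orbit `Tλ`. -/
def Torbit (α : I → V) (coroot : I → (V →ₗ[ℚ] ℚ)) (lam : V) : Set V :=
  {x | ∃ τ, τ ∈ Tmon α coroot ∧ τ lam = x}

/-- The reduced length of `τ ∈ T` with respect to all generators `r_i`, `i ∈ I`. -/
noncomputable def lenT (α : I → V) (coroot : I → (V →ₗ[ℚ] ℚ))
    (τ : Module.End ℚ V) : ℕ :=
  sInf {n | ∃ l : List I, l.length = n ∧ (l.map (srefl α coroot)).prod = τ}

/-- The reduced length of `w ∈ W` with respect to the real generators. -/
noncomputable def lenW (A : I → I → ℤ) (α : I → V) (coroot : I → (V →ₗ[ℚ] ℚ))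
    (w : Module.End ℚ V) : ℕ :=
  sInf {n | ∃ l : List I, (∀ m ∈ l, A m m = 2) ∧ l.length = n ∧
    (l.map (srefl α coroot)).prod = w}

/-- The reflection `r_β : x ↦ x - β^∨(x) • β` attached to a root/coroot pair. -/
def reflRoot (β : V) (βv : V →ₗ[ℚ] ℚ) : Module.End ℚ V :=
  LinearMap.id - βv.smulRight β

/-- A presentation of `β = w α_k ∈ WΠ` together with its coroot `β^∨ = w^∨ α_k^∨`,
via a word `l` (with real entries) for `w`. -/
def IsWRootPres (A : I → I → ℤ) (α : I → V) (coroot : I → (V →ₗ[ℚ] ℚ))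
    (l : List I) (k : I) (β : V) (βv : V →ₗ[ℚ] ℚ) : Prop :=
  (∀ m ∈ l, A m m = 2) ∧
  β = (l.map (srefl α coroot)).prod (α k) ∧
  βv = (l.map (crefl α coroot)).prod (coroot k)

/-- `β ∈ WΠ` with coroot `β^∨`. -/
def IsWRootPair (A : I → I → ℤ) (α : I → V) (coroot : I → (V →ₗ[ℚ] ℚ))
    (β : V) (βv : V →ₗ[ℚ] ℚ) : Prop :=
  ∃ l k, IsWRootPres A α coroot l k β βv

/-- A chain `ν =: c s ← ⋯ ← c 0 := μ` of length `s` inside `Tλ`: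
`c k = r_{β k} (c (k+1))` with `β k ∈ WΠ ∩ Q^+` and `(β k)^∨(c (k+1)) > 0`. -/
def IsChain (A : I → I → ℤ) (α : I → V) (coroot : I → (V →ₗ[ℚ] ℚ))
    (lam μ ν : V) (s : ℕ) (c : ℕ → V) (β : ℕ → V)
    (βv : ℕ → (V →ₗ[ℚ] ℚ)) : Prop :=
  c 0 = μ ∧ c s = ν ∧ (∀ k ≤ s, c k ∈ Torbit α coroot lam) ∧
  ∀ k < s, IsWRootPair A α coroot (β k) (βv k) ∧ β k ∈ Qplus α ∧
    0 < βv k (c (k+1)) ∧ c k = c (k+1) - βv k (c (k+1)) • β k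

/-- `μ > ν` in `Tλ`. -/
def ChainGT (A : I → I → ℤ) (α : I → V) (coroot : I → (V →ₗ[ℚ] ℚ))
    (lam μ ν : V) : Prop :=
  ∃ s, 1 ≤ s ∧ ∃ c β βv, IsChain A α coroot lam μ ν s c β βv

/-- `dist(μ, ν) = n`: there is a chain of length `n` from `μ` to `ν` and every chain
has length at most `n`. -/
def distEq (A : I → I → ℤ) (α : I → V) (coroot : I → (V →ₗ[ℚ] ℚ))
    (lam μ ν : V) (n : ℕ) : Prop :=
  (∃ c β βv, IsChain A α coroot lam μ ν n c β βv) ∧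
  ∀ m c β βv, IsChain A α coroot lam μ ν m c β βv → m ≤ n

/-- An `a`-chain for `(μ, ν)`: a chain in which each step is a covering
(`dist = 1`), `a·β_k^∨(ν_k)` is a positive integer for steps along `WΠ_re`,
and `a·β_k^∨(ν_k) = 1` for steps along `WΠ_im`.  The index `ks k` records the simple
root of which `β k` is a `W`-translate. -/
def IsAChain (A : I → I → ℤ) (α : I → V) (coroot : I → (V →ₗ[ℚ] ℚ))
    (lam : V) (a : ℚ) (μ ν : V) (s : ℕ) (c : ℕ → V)
    (β : ℕ → V) (βv : ℕ → (V →ₗ[ℚ] ℚ)) (ks : ℕ → I) : Prop :=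
  1 ≤ s ∧ IsChain A α coroot lam μ ν s c β βv ∧
  ∀ k < s,
    (∃ l, IsWRootPres A α coroot l (ks k) (β k) (βv k)) ∧
    distEq A α coroot lam (c k) (c (k+1)) 1 ∧
    (A (ks k) (ks k) = 2 → ∃ n : ℕ, 0 < n ∧ a * βv k (c (k+1)) = (n : ℚ)) ∧
    (A (ks k) (ks k) ≠ 2 → a * βv k (c (k+1)) = 1)

/-- Existence of an `a`-chain for `(μ, ν)`. -/
def HasAChain (A : I → I → ℤ) (α : I → V) (coroot : I → (V →ₗ[ℚ] ℚ))
    (lam : V) (a : ℚ) (μ ν : V) : Prop :=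
  ∃ s c β βv ks, IsAChain A α coroot lam a μ ν s c β βv ks

/-- The piecewise-linear path attached to GLS data `(λ_1, …, λ_s ; a_0, …, a_s)`
(weights indexed `1, …, s`, breakpoints indexed `0, …, s`):
on `[a_{j-1}, a_j]` it equals `Σ_{k<j} (a_k - a_{k-1}) • λ_k + (t - a_{j-1}) • λ_j`. -/
def glsPath (lamseq : ℕ → V) (a : ℕ → ℚ) (s : ℕ) (t : ℚ) : V :=
  ∑ k ∈ Finset.range s, (max (min t (a (k+1)) - a k) 0) • lamseq (k+1)

/-- The data of a Generalized Lakshmibai–Seshadri path of shape `lam`. -/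
def IsGLS (A : I → I → ℤ) (α : I → V) (coroot : I → (V →ₗ[ℚ] ℚ))
    (lam : V) (s : ℕ) (lamseq : ℕ → V) (a : ℕ → ℚ) : Prop :=
  1 ≤ s ∧ a 0 = 0 ∧ a s = 1 ∧ (∀ k < s, a k < a (k+1)) ∧
  (∀ k, 1 ≤ k → k ≤ s → lamseq k ∈ Torbit α coroot lam) ∧
  (∀ k, 1 ≤ k → k < s →
    HasAChain A α coroot lam (a k) (lamseq k) (lamseq (k+1))) ∧
  (lamseq s = lam ∨ HasAChain A α coroot lam 1 (lamseq s) lam)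

/-- The set `ℙ_λ` of Generalized Lakshmibai–Seshadri paths of shape `lam`,
realized as functions `ℚ → V` via `glsPath`. -/
def GLSset (A : I → I → ℤ) (α : I → V) (coroot : I → (V →ₗ[ℚ] ℚ))
    (lam : V) : Set (ℚ → V) :=
  {π | ∃ s lamseq a, IsGLS A α coroot lam s lamseq a ∧ π = glsPath lamseq a s}

/-- `h_i^π(t) = α_i^∨(π(t))`. -/
def hFun (coroot : I → (V →ₗ[ℚ] ℚ)) (i : I) (π : ℚ → V) (t : ℚ) : ℚ :=
  coroot i (π t)

/-- `m_i^π`, the minimal integer value attained by `h_i^π` on `[0,1]`. -/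
noncomputable def mOf (coroot : I → (V →ₗ[ℚ] ℚ)) (i : I) (π : ℚ → V) : ℤ :=
  sInf {n : ℤ | ∃ t, 0 ≤ t ∧ t ≤ 1 ∧ hFun coroot i π t = (n : ℚ)}

/-- Two paths agree on `[0,1]`. -/
def pathEq (π π' : ℚ → V) : Prop := ∀ t, 0 ≤ t → t ≤ 1 → π t = π' t

/-- `tp = f_+^i(π)`: the largest point of `[0,1]` where `h_i^π` equals `m_i^π`. -/
def IsFPlus (coroot : I → (V →ₗ[ℚ] ℚ)) (i : I) (π : ℚ → V) (tp : ℚ) : Prop :=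
  0 ≤ tp ∧ tp ≤ 1 ∧ hFun coroot i π tp = (mOf coroot i π : ℚ) ∧
  ∀ t, 0 ≤ t → t ≤ 1 → hFun coroot i π t = (mOf coroot i π : ℚ) → t ≤ tp

/-- `tm = f_-^i(π)`: the smallest point of `[tp,1]` where `h_i^π` equals `m_i^π + 1`. -/
def IsFMinus (coroot : I → (V →ₗ[ℚ] ℚ)) (i : I) (π : ℚ → V) (tp tm : ℚ) : Prop :=
  tp ≤ tm ∧ tm ≤ 1 ∧ hFun coroot i π tm = (mOf coroot i π : ℚ) + 1 ∧
  ∀ t, tp ≤ t → t ≤ 1 → hFun coroot i π t = (mOf coroot i π : ℚ) + 1 → tm ≤ t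

/-- The path `f_i π` (for cutting data `tp = f_+^i(π)`, `tm = f_-^i(π)`). -/
def fPath (α : I → V) (coroot : I → (V →ₗ[ℚ] ℚ)) (i : I) (tp tm : ℚ)
    (π : ℚ → V) (t : ℚ) : V :=
  if t ≤ tp then π t
  else if t ≤ tm then π tp + srefl α coroot i (π t - π tp)
  else π t - α i

/-- `π' = f_i π ≠ 0` (equality of paths on `[0,1]`). -/
def FRel (α : I → V) (coroot : I → (V →ₗ[ℚ] ℚ)) (i : I) (π π' : ℚ → V) : Prop :=
  ∃ tp tm, IsFPlus coroot i π tp ∧ tp < 1 ∧ IsFMinus coroot i π tp tm ∧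
    pathEq π' (fPath α coroot i tp tm π)

/-- `tp = e_+^i(π)` (`i` real): smallest point of `[0,1]` where `h_i^π = m_i^π`. -/
def IsEPlusRe (coroot : I → (V →ₗ[ℚ] ℚ)) (i : I) (π : ℚ → V) (tp : ℚ) : Prop :=
  0 ≤ tp ∧ tp ≤ 1 ∧ hFun coroot i π tp = (mOf coroot i π : ℚ) ∧
  ∀ t, 0 ≤ t → t ≤ 1 → hFun coroot i π t = (mOf coroot i π : ℚ) → tp ≤ t

/-- `tm = e_-^i(π)` (`i` real): largest point of `[0,tp]` where `h_i^π = m_i^π + 1`. -/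
def IsEMinusRe (coroot : I → (V →ₗ[ℚ] ℚ)) (i : I) (π : ℚ → V) (tp tm : ℚ) : Prop :=
  0 ≤ tm ∧ tm ≤ tp ∧ hFun coroot i π tm = (mOf coroot i π : ℚ) + 1 ∧
  ∀ t, 0 ≤ t → t ≤ tp → hFun coroot i π t = (mOf coroot i π : ℚ) + 1 → t ≤ tm

/-- The path `e_i π` for `i` real. -/
def ePathRe (α : I → V) (coroot : I → (V →ₗ[ℚ] ℚ)) (i : I) (tm tp : ℚ)
    (π : ℚ → V) (t : ℚ) : V :=
  if t ≤ tm then π t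
  else if t ≤ tp then π tm + srefl α coroot i (π t - π tm)
  else π t + α i

/-- `π' = e_i π ≠ 0` for a real index `i`. -/
def ERelRe (α : I → V) (coroot : I → (V →ₗ[ℚ] ℚ)) (i : I) (π π' : ℚ → V) : Prop :=
  ∃ tp tm, IsEPlusRe coroot i π tp ∧ 0 < tp ∧ IsEMinusRe coroot i π tp tm ∧
    pathEq π' (ePathRe α coroot i tm tp π)

/-- The "inverse reflection" `r_i^{-1} : x ↦ x + (1/(1-a_{ii})) α_i^∨(x) α_i`
for an imaginary index `i`. -/
def rinv (A : I → I → ℤ) (α : I → V) (coroot : I → (V →ₗ[ℚ] ℚ)) (i : I) :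
    Module.End ℚ V :=
  LinearMap.id + (1 / (1 - (A i i : ℚ))) • (coroot i).smulRight (α i)

/-- `tp = e_+^i(π)` (`i` imaginary): smallest point of `[tm,1]` where
`h_i^π = m_i^π + 1 - a_{ii}` (here `tm = e_-^i(π) = f_+^i(π)`). -/
def IsEPlusIm (A : I → I → ℤ) (coroot : I → (V →ₗ[ℚ] ℚ)) (i : I) (π : ℚ → V)
    (tm tp : ℚ) : Prop :=
  tm ≤ tp ∧ tp ≤ 1 ∧
  hFun coroot i π tp = (mOf coroot i π : ℚ) + 1 - (A i i : ℚ) ∧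
  ∀ t, tm ≤ t → t ≤ 1 →
    hFun coroot i π t = (mOf coroot i π : ℚ) + 1 - (A i i : ℚ) → tp ≤ t

/-- The path `e_i π` for `i` imaginary. -/
def ePathIm (A : I → I → ℤ) (α : I → V) (coroot : I → (V →ₗ[ℚ] ℚ)) (i : I)
    (tm tp : ℚ) (π : ℚ → V) (t : ℚ) : V :=
  if t ≤ tm then π t
  else if t ≤ tp then π tm + rinv A α coroot i (π t - π tm)
  else π t + α i

/-- `π' = e_i π ≠ 0` for an imaginary index `i`:  `e_-^i(π) = f_+^i(π) < 1`, the point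
`e_+^i(π)` exists, and `h_i^π` never drops to `m_i^π - a_{ii}` on `[e_+^i(π), 1]`. -/
def ERelIm (A : I → I → ℤ) (α : I → V) (coroot : I → (V →ₗ[ℚ] ℚ)) (i : I)
    (π π' : ℚ → V) : Prop :=
  ∃ tm tp, IsFPlus coroot i π tm ∧ tm < 1 ∧ IsEPlusIm A coroot i π tm tp ∧
    (∀ t, tp ≤ t → t ≤ 1 →
      (mOf coroot i π : ℚ) - (A i i : ℚ) < hFun coroot i π t) ∧
    pathEq π' (ePathIm A α coroot i tm tp π)

/-- `π' = e_i π ≠ 0`. -/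
def ERel (A : I → I → ℤ) (α : I → V) (coroot : I → (V →ₗ[ℚ] ℚ)) (i : I)
    (π π' : ℚ → V) : Prop :=
  (A i i = 2 ∧ ERelRe α coroot i π π') ∨ (A i i ≠ 2 ∧ ERelIm A α coroot i π π')

/-- `π' = f_{i_1} ⋯ f_{i_k} π ≠ 0` for a list `[i_1, …, i_k]` (rightmost acts first). -/
def FMonRel (α : I → V) (coroot : I → (V →ₗ[ℚ] ℚ)) :
    List I → (ℚ → V) → (ℚ → V) → Prop
  | [], π, π' => pathEq π π'
  | i :: l, π, π' => ∃ πm, FMonRel α coroot l π πm ∧ FRel α coroot i πm π'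

/-- A generalized crystal for the Borcherds–Cartan datum `(A, α, coroot)`. -/
structure GenCrystal (A : I → I → ℤ) (α : I → V)
    (coroot : I → (V →ₗ[ℚ] ℚ)) where
  B : Type*
  wt : B → V
  wt_int : ∀ (i : I) (b : B), ∃ n : ℤ, coroot i (wt b) = (n : ℚ)
  eps : I → B → WithBot ℤ
  phi : I → B → WithBot ℤ
  e : I → B → Option B
  f : I → B → Option B
  phi_eq : ∀ (i : I) (b : B) (n : ℤ), (n : ℚ) = coroot i (wt b) →
    phi i b = eps i b + (n : WithBot ℤ)
  wt_e : ∀ (i : I) (b b' : B), e i b = some b' → wt b' = wt b + α i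
  eps_e_re : ∀ (i : I) (b b' : B), A i i = 2 → e i b = some b' →
    eps i b' = eps i b + ((-1 : ℤ) : WithBot ℤ)
  eps_e_im : ∀ (i : I) (b b' : B), A i i ≠ 2 → e i b = some b' →
    eps i b' = eps i b
  e_iff_f : ∀ (i : I) (b b' : B), e i b = some b' ↔ f i b' = some b
  phi_bot : ∀ (i : I) (b : B), phi i b = ⊥ → e i b = none ∧ f i b = none
  eps_im : ∀ (i : I) (b : B), A i i ≠ 2 → eps i b ≤ 0
  phi_im : ∀ (i : I) (b : B), A i i ≠ 2 → phi i b = ⊥ ∨ 0 ≤ phi i b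

/-- Finite "orthogonal" subsets of the imaginary simple roots, encoded by their
index sets: `F ∈ 𝒫(Π_im)`. -/
def PImSet (A : I → I → ℤ) (F : Finset I) : Prop :=
  (∀ i ∈ F, A i i ≠ 2) ∧ ∀ i ∈ F, ∀ j ∈ F, i ≠ j → A i j = 0

end GKM

set_option linter.unusedSectionVars false

namespace LSPath

/-- A generalized Cartan matrix, all of whose indices are real. -/
class IsGCM {ι : Type*} (A : ι → ι → ℤ) : Prop where
  diag : ∀ i, A i i = 2
  off : ∀ i j, i ≠ j → A i j ≤ 0
  zero : ∀ i j, A i j = 0 → A j i = 0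

/-- The Coxeter exponent attached to the product `a_{ij} a_{ji}`. -/
def coxExp (c : ℤ) : ℕ :=
  if c = 0 then 2 else if c = 1 then 3 else if c = 2 then 4 else if c = 3 then 6 else 0

/-- The Coxeter matrix of the Weyl group of `A`. -/
def coxM {ι : Type*} [DecidableEq ι] (A : ι → ι → ℤ) : CoxeterMatrix ι where
  M := fun i j => if i = j then 1 else coxExp (A i j * A j i)
  isSymm := by
    ext i j
    show (if j = i then 1 else coxExp (A j i * A i j)) = if i = j then 1 else coxExp (A i j * A j i)
    simp only [mul_comm (A i j), eq_comm (a := i)]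
  diagonal i := by simp
  off_diagonal i j h := by
    rw [if_neg h]; unfold coxExp; split_ifs <;> simp

theorem IsGCM.transpose {ι : Type*} {A : ι → ι → ℤ} (hA : IsGCM A) :
    IsGCM (fun i j => A j i) :=
  ⟨hA.diag, fun i j h => hA.off j i h.symm, fun i j h => hA.zero j i h⟩

section Coxeter

variable {ι : Type*} [DecidableEq ι] {A : ι → ι → ℤ}

/-- The Weyl group. -/
def W (A : ι → ι → ℤ) := (coxM A).Group

instance : Group (W A) := inferInstanceAs (Group (coxM A).Group)

/-- Its Coxeter system. -/
def cs (A : ι → ι → ℤ) : CoxeterSystem (coxM A) (W A) := (coxM A).toCoxeterSystem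

/-- The simple reflections. -/
def sg (A : ι → ι → ℤ) (i : ι) : W A := (cs A).simple i

/-- Length function. -/
noncomputable def len (w : W A) : ℕ := (cs A).length w

theorem len_mul_sg (w : W A) (i : ι) :
    len (w * sg A i) = len w + 1 ∨ len (w * sg A i) + 1 = len w := (cs A).length_mul_simple w i

theorem len_sg_mul (w : W A) (i : ι) :
    len (sg A i * w) = len w + 1 ∨ len (sg A i * w) + 1 = len w := (cs A).length_simple_mul w i

theorem len_mul_le (v w : W A) : len (v * w) ≤ len v + len w := (cs A).length_mul_le v w

theorem len_inv (w : W A) : len w⁻¹ = len w := (cs A).length_inv w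

@[simp] theorem len_one : len (1 : W A) = 0 := (cs A).length_one

@[simp] theorem sg_mul_self (i : ι) : sg A i * sg A i = 1 := (cs A).simple_mul_simple_self i

@[simp] theorem sg_mul_cancel (i : ι) (w : W A) : sg A i * (sg A i * w) = w := by
  rw [← mul_assoc, sg_mul_self, one_mul]

@[simp] theorem mul_sg_cancel (i : ι) (w : W A) : w * sg A i * sg A i = w := by
  rw [mul_assoc, sg_mul_self, mul_one]

@[simp] theorem sg_inv (i : ι) : (sg A i)⁻¹ = sg A i := (cs A).inv_simple i

theorem exists_right_descent {w : W A} (h : w ≠ 1) : ∃ i, len (w * sg A i) < len w :=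
  (cs A).exists_rightDescent_of_ne_one h

theorem len_eq_zero {w : W A} : len w = 0 ↔ w = 1 := (cs A).length_eq_zero_iff

/-- Alternating products of two simple reflections. -/
def altP (A : ι → ι → ℤ) (i j : ι) (k : ℕ) : W A :=
  (cs A).wordProd (CoxeterSystem.alternatingWord i j k)

@[simp] theorem altP_zero (i j : ι) : altP A i j 0 = 1 := by
  simp [altP, CoxeterSystem.alternatingWord]

theorem altP_succ (i j : ι) (k : ℕ) : altP A i j (k + 1) = altP A j i k * sg A j := by
  rw [altP, CoxeterSystem.alternatingWord_succ, CoxeterSystem.wordProd_concat]; rfl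

theorem altP_succ' (i j : ι) (k : ℕ) :
    altP A i j (k + 1) = sg A (if Even k then j else i) * altP A i j k := by
  rw [altP, CoxeterSystem.alternatingWord_succ', CoxeterSystem.wordProd_cons]; rfl

theorem len_altP_le (i j : ι) (k : ℕ) : len (altP A i j k) ≤ k := by
  have := (cs A).length_wordProd_le (CoxeterSystem.alternatingWord i j k)
  rwa [CoxeterSystem.length_alternatingWord] at this

theorem len_altP_lt (i j : ι) (k : ℕ) (h0 : coxM A i j ≠ 0) (h : coxM A i j < k) :
    len (altP A i j k) < k := by
  have h2 := (cs A).not_isReduced_alternatingWord i j h0 h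
  rw [CoxeterSystem.IsReduced, CoxeterSystem.length_alternatingWord] at h2
  exact lt_of_le_of_ne (len_altP_le i j k) h2

theorem coxM_apply_ne {i j : ι} (h : i ≠ j) : coxM A i j = coxExp (A i j * A j i) := by
  show (if i = j then 1 else _) = _
  rw [if_neg h]

variable {M : Type*} [AddCommGroup M]

/-- `ρ` acts on the family `a` through the formula `s_i a_j = a_j - b_{ij} a_i`. -/
def ActsBy (b : ι → ι → ℤ) (ρ : W A →* AddMonoid.End M) (a : ι → M) : Prop :=
  ∀ i j, ρ (sg A i) (a j) = a j - b i j • a i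

/-- coefficients of `alt_k α_i`, in the order (letter `i`, letter `j`), with `p = -b_ij, q = -b_ji`.
Letters applied in the order `j, i, j, …`. -/
def altCoef (p q : ℤ) : ℕ → ℤ × ℤ
  | 0 => (1, 0)
  | k + 1 => if Even k then ((altCoef p q k).1, q * (altCoef p q k).1 - (altCoef p q k).2)
      else (p * (altCoef p q k).2 - (altCoef p q k).1, (altCoef p q k).2)

theorem rho_alt {b : ι → ι → ℤ} {ρ : W A →* AddMonoid.End M} {a : ι → M}
    (hρ : ActsBy b ρ a) (hb : ∀ i, b i i = 2) (i j : ι) (k : ℕ) :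
    ρ (altP A i j k) (a i) =
      (altCoef (-b i j) (-b j i) k).1 • a i + (altCoef (-b i j) (-b j i) k).2 • a j := by
  induction k with
  | zero => simp [altCoef]
  | succ k ih =>
    rw [altP_succ', map_mul,
      AddMonoid.End.coe_mul, Function.comp_apply, ih, altCoef, map_add, map_zsmul, map_zsmul]
    split_ifs with h
    · rw [hρ, hρ, hb]; simp only []; module
    · rw [hρ, hρ, hb]; simp only []; module

theorem altCoef_nonneg {p q : ℤ} (hp : 0 ≤ p) (hq : 0 ≤ q) (hz : p = 0 ↔ q = 0) (k : ℕ)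
    (hk : coxExp (p * q) = 0 ∨ k < coxExp (p * q)) :
    0 ≤ (altCoef p q k).1 ∧ 0 ≤ (altCoef p q k).2 := by
  by_cases h4 : 4 ≤ p * q
  · have key : 0 ≤ (altCoef p q k).1 ∧ 0 ≤ (altCoef p q k).2 ∧
        (if Even k then p * (altCoef p q k).2 ≤ 2 * (altCoef p q k).1
          else q * (altCoef p q k).1 ≤ 2 * (altCoef p q k).2) := by
      clear hk
      have hp' : 0 < p := by
        rcases hp.lt_or_eq with h | h
        · exact h
        · rw [← h] at h4; simp at h4
      have hq' : 0 < q := by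
        rcases hq.lt_or_eq with h | h
        · exact h
        · rw [← h] at h4; simp at h4
      induction k with
      | zero => simp [altCoef]
      | succ k ih =>
        obtain ⟨h1, h2, h3⟩ := ih
        generalize hP : (altCoef p q k).1 = P at *
        generalize hQ : (altCoef p q k).2 = Q at *
        by_cases hk : Even k
        · have hk' : ¬ Even (k + 1) := by simpa [Nat.even_add_one] using hk
          simp only [altCoef, if_pos hk, if_neg hk', hP, hQ] at h3 ⊢
          have : 2 * Q ≤ q * P := by nlinarith
          exact ⟨h1, by linarith, by linarith⟩
        · have hk' : Even (k + 1) := by simpa [Nat.even_add_one] using hk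
          simp only [altCoef, if_neg hk, if_pos hk', hP, hQ] at h3 ⊢
          have : 2 * P ≤ p * Q := by nlinarith
          exact ⟨by linarith, h2, by linarith⟩
    exact ⟨key.1, key.2.1⟩
  · push Not at h4
    have h0 : 0 ≤ p * q := mul_nonneg hp hq
    have hcases : (p = 0 ∧ q = 0) ∨ (p = 1 ∧ q = 1) ∨ (p = 1 ∧ q = 2) ∨ (p = 2 ∧ q = 1) ∨
        (p = 1 ∧ q = 3) ∨ (p = 3 ∧ q = 1) := by
      by_cases h : p = 0
      · exact Or.inl ⟨h, hz.1 h⟩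
      · have h' : q ≠ 0 := fun h'' => h (hz.2 h'')
        have : 1 ≤ p := by omega
        have : 1 ≤ q := by omega
        have : p ≤ 3 := by nlinarith
        have : q ≤ 3 := by nlinarith
        interval_cases p <;> interval_cases q <;> simp_all
    rcases hcases with ⟨rfl, rfl⟩ | ⟨rfl, rfl⟩ | ⟨rfl, rfl⟩ | ⟨rfl, rfl⟩ | ⟨rfl, rfl⟩ | ⟨rfl, rfl⟩ <;>
    · simp [coxExp] at hk
      interval_cases k <;> decide

end Coxeter

section NN

variable {ι : Type*} {M : Type*} [AddCommGroup M]

/-- `x` is a nonnegative integral combination of the family `a`. -/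
def NN (a : ι → M) (x : M) : Prop := x ∈ AddSubmonoid.closure (Set.range a)

theorem NN.smul {a : ι → M} {x : M} (h : NN a x) {n : ℤ} (hn : 0 ≤ n) : NN a (n • x) := by
  lift n to ℕ using hn
  rw [natCast_zsmul]
  exact AddSubmonoid.nsmul_mem _ h n

theorem NN.add {a : ι → M} {x y : M} (h : NN a x) (h' : NN a y) : NN a (x + y) :=
  AddSubmonoid.add_mem _ h h'

theorem NN.basic (a : ι → M) (i : ι) : NN a (a i) :=
  AddSubmonoid.subset_closure (Set.mem_range_self i)

end NN

section Coxeter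

variable {ι : Type*} [DecidableEq ι] {A : ι → ι → ℤ} {M : Type*} [AddCommGroup M]

/-- Simple roots stay positive when the length grows. -/
theorem nn_of_length_lt {b : ι → ι → ℤ} (hb : IsGCM b)
    (hbA : ∀ i j, b i j * b j i = A i j * A j i) {ρ : W A →* AddMonoid.End M} {a : ι → M}
    (hρ : ActsBy b ρ a) (w : W A) (i : ι) (h : len w < len (w * sg A i)) :
    NN a (ρ w (a i)) := by
  obtain ⟨n, hn⟩ : ∃ n, len w = n := ⟨_, rfl⟩
  induction n using Nat.strong_induction_on generalizing w i with
  | _ n ih =>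
  by_cases hw : w = 1
  · subst hw
    simpa using NN.basic a i
  obtain ⟨j, hj⟩ := exists_right_descent hw
  have hij : i ≠ j := by
    rintro rfl
    exact absurd hj (not_lt.2 h.le)
  let P : ℕ → Prop := fun k => k ≤ len w ∧ len (w * (altP A i j k)⁻¹) + k = len w
  have hP1 : P 1 := by
    have := len_mul_sg w j
    refine ⟨by omega, ?_⟩
    rw [altP_succ, altP_zero, one_mul, sg_inv]
    omega
  obtain ⟨k, hk1, hkP, hkmax⟩ : ∃ k, 1 ≤ k ∧ P k ∧ ¬ P (k + 1) := by
    by_contra hcon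
    push Not at hcon
    have : ∀ k, 1 ≤ k → P k := fun k hk => by
      induction k, hk using Nat.le_induction with
      | base => exact hP1
      | succ k hk ih => exact hcon k hk ih
    have := (this (len w + 1) (by omega)).1
    omega
  obtain ⟨w', hw'⟩ : ∃ w', w' = w * (altP A i j k)⁻¹ := ⟨_, rfl⟩
  have hww : w = w' * altP A i j k := by
    rw [hw', inv_mul_cancel_right]
  obtain ⟨hk2, hk3⟩ := hkP
  rw [← hw'] at hk3
  have hnext : len w' < len (w' * sg A (if Even k then j else i)) := by
    by_contra hcon
    apply hkmax
    have hlt := len_mul_sg w' (if Even k then j else i)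
    have heq : w * (altP A i j (k + 1))⁻¹ = w' * sg A (if Even k then j else i) := by
      rw [altP_succ', mul_inv_rev, sg_inv, hw', mul_assoc]
    refine ⟨by omega, ?_⟩
    rw [heq]; omega
  have hprev : len w' < len (w' * sg A (if Even k then i else j)) := by
    obtain ⟨k', rfl⟩ : ∃ k', k = k' + 1 := ⟨k - 1, by omega⟩
    have h1 : w = (w' * sg A (if Even k' then j else i)) * altP A i j k' := by
      conv_lhs => rw [hww, altP_succ', ← mul_assoc]
    have h2 := len_mul_le (w' * sg A (if Even k' then j else i)) (altP A i j k')
    rw [← h1] at h2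
    have h3 := len_altP_le (A := A) i j k'
    have h4 : (if Even (k' + 1) then i else j) = if Even k' then j else i := by
      by_cases h : Even k' <;> simp [h, Nat.even_add_one]
    rw [h4]
    have h5 := len_mul_sg w' (if Even k' then j else i)
    omega
  have hi : len w' < len (w' * sg A i) := by
    by_cases h : Even k
    · simpa [h] using hprev
    · simpa [h] using hnext
  have hj' : len w' < len (w' * sg A j) := by
    by_cases h : Even k
    · simpa [h] using hnext
    · simpa [h] using hprev
  have hmi := ih (len w') (by omega) w' i hi rfl
  have hmj := ih (len w') (by omega) w' j hj' rfl
  have hexp : coxExp (-b i j * -b j i) = coxM A i j := by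
    rw [coxM_apply_ne hij, neg_mul_neg, hbA]
  have hklt : coxExp (-b i j * -b j i) = 0 ∨ k < coxExp (-b i j * -b j i) := by
    rw [hexp]
    by_contra hcon
    push Not at hcon
    have h1 : w * sg A i = w' * altP A j i (k + 1) := by
      rw [altP_succ, ← mul_assoc, ← hww]
    have h2 := len_altP_lt (A := A) j i (k + 1)
      (by rw [(coxM A).symmetric]; exact hcon.1) (by rw [(coxM A).symmetric]; omega)
    have h4 := len_mul_le w' (altP A j i (k + 1))
    rw [← h1] at h4
    omega
  have hnn := altCoef_nonneg (p := -b i j) (q := -b j i) (by have := hb.off i j hij; omega)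
    (by have := hb.off j i hij.symm; omega)
    ⟨fun h => by have := hb.zero i j; omega, fun h => by have := hb.zero j i; omega⟩ k hklt
  rw [hww, map_mul, AddMonoid.End.coe_mul, Function.comp_apply, rho_alt hρ hb.diag, map_add,
    map_zsmul, map_zsmul]
  exact (hmi.smul hnn.1).add (hmj.smul hnn.2)

end Coxeter

/-- The space spanned by fundamental weights (first factor) and simple roots (second factor). -/
def VV (ι : Type*) := (ι → ℝ) × (ι → ℝ)

noncomputable instance (ι : Type*) : AddCommGroup (VV ι) :=
  inferInstanceAs (AddCommGroup ((ι → ℝ) × (ι → ℝ)))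

noncomputable instance (ι : Type*) : Module ℝ (VV ι) :=
  inferInstanceAs (Module ℝ ((ι → ℝ) × (ι → ℝ)))

section Space

variable {ι : Type*}

/-- The vector with weight coordinates `x` and root coordinates `K`. -/
def mkV (x K : ι → ℝ) : VV ι := (x, K)

@[simp] theorem mkV_fst (x K : ι → ℝ) : (mkV x K).1 = x := rfl
@[simp] theorem mkV_snd (x K : ι → ℝ) : (mkV x K).2 = K := rfl

theorem VV.ext {u v : VV ι} (h1 : ∀ i, u.1 i = v.1 i) (h2 : ∀ i, u.2 i = v.2 i) : u = v :=
  Prod.ext (funext h1) (funext h2)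

@[simp] theorem VV.add_fst (u v : VV ι) (i : ι) : (u + v).1 i = u.1 i + v.1 i := rfl
@[simp] theorem VV.add_snd (u v : VV ι) (i : ι) : (u + v).2 i = u.2 i + v.2 i := rfl
@[simp] theorem VV.sub_fst (u v : VV ι) (i : ι) : (u - v).1 i = u.1 i - v.1 i := rfl
@[simp] theorem VV.sub_snd (u v : VV ι) (i : ι) : (u - v).2 i = u.2 i - v.2 i := rfl
@[simp] theorem VV.neg_fst (u : VV ι) (i : ι) : (-u).1 i = -u.1 i := rfl
@[simp] theorem VV.neg_snd (u : VV ι) (i : ι) : (-u).2 i = -u.2 i := rfl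
@[simp] theorem VV.zero_fst (i : ι) : (0 : VV ι).1 i = 0 := rfl
@[simp] theorem VV.zero_snd (i : ι) : (0 : VV ι).2 i = 0 := rfl
@[simp] theorem VV.smul_fst (c : ℝ) (v : VV ι) (i : ι) : (c • v).1 i = c * v.1 i := rfl
@[simp] theorem VV.smul_snd (c : ℝ) (v : VV ι) (i : ι) : (c • v).2 i = c * v.2 i := rfl

variable [Fintype ι] [DecidableEq ι] (A : ι → ι → ℤ)

/-- Simple roots. -/
noncomputable def rt (i : ι) : VV ι := mkV 0 (Pi.single i 1)

/-- Simple coroots. -/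
noncomputable def ht (i : ι) : VV ι →ₗ[ℝ] ℝ where
  toFun v := v.1 i + ∑ j, (A i j : ℝ) * v.2 j
  map_add' u v := by
    simp only [VV.add_fst, VV.add_snd, mul_add, Finset.sum_add_distrib]; ring
  map_smul' c v := by
    simp only [VV.smul_fst, VV.smul_snd, RingHom.id_apply, smul_eq_mul, mul_add, Finset.mul_sum]
    congr 1
    exact Finset.sum_congr rfl fun j _ => by ring

omit [DecidableEq ι] in
theorem ht_apply (i : ι) (v : VV ι) : ht A i v = v.1 i + ∑ j, (A i j : ℝ) * v.2 j := rfl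

omit [Fintype ι] in
@[simp] theorem rt_fst (i j : ι) : (rt i : VV ι).1 j = 0 := rfl

omit [Fintype ι] in
theorem rt_snd (i j : ι) : (rt i : VV ι).2 j = if j = i then 1 else 0 := by
  simp [rt, Pi.single_apply]

@[simp] theorem ht_rt (i j : ι) : ht A i (rt j) = A i j := by
  simp [ht_apply, rt_snd]

/-- The simple reflection as an endomorphism. -/
noncomputable def sEnd (i : ι) : Module.End ℝ (VV ι) :=
  LinearMap.id - (ht A i).smulRight (rt i)

theorem sEnd_apply (i : ι) (v : VV ι) : sEnd A i v = v - ht A i v • rt i := rfl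

variable {A}

theorem sEnd_sq (hA : IsGCM A) (i : ι) : sEnd A i * sEnd A i = 1 := by
  ext1 v
  simp only [Module.End.mul_apply, sEnd_apply, Module.End.one_apply, map_sub, map_smul, ht_rt,
    hA.diag]
  push_cast
  module

/-- Coefficients of `(s_i s_j)^n v - v`. -/
def dihCoef (a b p q : ℝ) : ℕ → ℝ × ℝ
  | 0 => (0, 0)
  | n + 1 =>
    let P := (dihCoef a b p q n).1
    let Q := (dihCoef a b p q n).2
    (-P - p - a * (-Q - q - b * P), -Q - q - b * P)

theorem pow_sEnd (hA : IsGCM A) (i j : ι) (v : VV ι) (n : ℕ) :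
    ((sEnd A i * sEnd A j) ^ n) v = v + (dihCoef (A i j) (A j i) (ht A i v) (ht A j v) n).1 • rt i
      + (dihCoef (A i j) (A j i) (ht A i v) (ht A j v) n).2 • rt j := by
  induction n with
  | zero => simp [dihCoef]
  | succ n ih =>
    rw [pow_succ', Module.End.mul_apply, ih, dihCoef]
    simp only [Module.End.mul_apply, sEnd_apply, map_sub, map_add, map_smul, ht_rt,
      hA.diag]
    push_cast
    module

theorem sEnd_liftable (hA : IsGCM A) : (coxM A).IsLiftable (sEnd A) := by
  intro i j
  by_cases hij : i = j
  · subst hij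
    simp [sEnd_sq hA]
  rw [coxM_apply_ne hij]
  have h1 := hA.off i j hij
  have h2 := hA.off j i (Ne.symm hij)
  have hz1 := hA.zero i j
  have hz2 := hA.zero j i
  by_cases h4 : 4 ≤ A i j * A j i
  · have : coxExp (A i j * A j i) = 0 := by
      unfold coxExp; split_ifs <;> omega
    rw [this, pow_zero]
  have hcases : (A i j = 0 ∧ A j i = 0) ∨ (A i j = -1 ∧ A j i = -1) ∨ (A i j = -1 ∧ A j i = -2) ∨
      (A i j = -2 ∧ A j i = -1) ∨ (A i j = -1 ∧ A j i = -3) ∨ (A i j = -3 ∧ A j i = -1) := by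
    generalize A i j = p at *
    generalize A j i = q at *
    by_cases h : p = 0
    · exact Or.inl ⟨h, hz1 h⟩
    · have h' : q ≠ 0 := fun h'' => h (hz2 h'')
      have : p ≤ -1 := by omega
      have : q ≤ -1 := by omega
      have : -3 ≤ p := by nlinarith
      have : -3 ≤ q := by nlinarith
      interval_cases p <;> interval_cases q <;> simp_all
  ext1 v
  rw [pow_sEnd hA, Module.End.one_apply]
  have key : dihCoef (A i j) (A j i) (ht A i v) (ht A j v) (coxExp (A i j * A j i)) = (0, 0) := by
    rcases hcases with ⟨h, h'⟩ | ⟨h, h'⟩ | ⟨h, h'⟩ | ⟨h, h'⟩ | ⟨h, h'⟩ | ⟨h, h'⟩ <;>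
    · rw [h, h']
      norm_num [coxExp, dihCoef]
      try constructor <;> ring
  rw [key]; simp

/-- The reflection representation. -/
noncomputable def refRep (A : ι → ι → ℤ) [hA : IsGCM A] : W A →* Module.End ℝ (VV ι) :=
  (cs A).lift ⟨sEnd A, sEnd_liftable hA⟩

variable [hA : IsGCM A]

theorem refRep_sg (i : ι) : refRep A (sg A i) = sEnd A i :=
  (cs A).lift_apply_simple (sEnd_liftable hA) i

noncomputable instance : DistribMulAction (W A) (VV ι) where
  smul w v := refRep A w v
  one_smul v := by show refRep A 1 v = v; simp
  mul_smul w w' v := by show refRep A (w * w') v = refRep A w (refRep A w' v); simp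
  smul_zero w := map_zero (refRep A w)
  smul_add w := map_add (refRep A w)

instance : SMulCommClass (W A) ℝ (VV ι) := ⟨fun w c v => map_smul (refRep A w) c v⟩

theorem sg_smul (i : ι) (v : VV ι) : sg A i • v = v - ht A i v • rt i := by
  show refRep A (sg A i) v = _
  rw [refRep_sg, sEnd_apply]

theorem ht_sg_smul (i j : ι) (v : VV ι) : ht A j (sg A i • v) = ht A j v - A j i * ht A i v := by
  rw [sg_smul]; simp [mul_comm]

theorem ht_sg_smul_self (i : ι) (v : VV ι) : ht A i (sg A i • v) = - ht A i v := by
  rw [ht_sg_smul, hA.diag]; push_cast; ring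

/-- The root lattice. -/
def Lat (ι : Type*) : AddSubgroup (VV ι) where
  carrier := {v | (∀ i, v.1 i = 0) ∧ ∀ i, ∃ n : ℤ, v.2 i = n}
  zero_mem' := ⟨fun _ => rfl, fun _ => ⟨0, by simp⟩⟩
  add_mem' := by
    rintro u v ⟨hu, hu'⟩ ⟨hv, hv'⟩
    refine ⟨fun i => by simp [hu, hv], fun i => ?_⟩
    obtain ⟨m, hm⟩ := hu' i
    obtain ⟨n, hn⟩ := hv' i
    exact ⟨m + n, by simp [hm, hn]⟩
  neg_mem' := by
    rintro u ⟨hu, hu'⟩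
    refine ⟨fun i => by simp [hu], fun i => ?_⟩
    obtain ⟨m, hm⟩ := hu' i
    exact ⟨-m, by simp [hm]⟩

theorem rt_mem_Lat (i : ι) : rt i ∈ Lat ι :=
  ⟨fun _ => rfl, fun j => ⟨if j = i then 1 else 0, by rw [rt_snd]; split_ifs <;> simp⟩⟩

theorem smul_rt_mem_Lat {c : ℝ} (hc : ∃ n : ℤ, c = n) {v : VV ι} (hv : v ∈ Lat ι) :
    c • v ∈ Lat ι := by
  obtain ⟨n, rfl⟩ := hc
  refine ⟨fun i => by simp [hv.1], fun i => ?_⟩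
  obtain ⟨m, hm⟩ := hv.2 i
  exact ⟨n * m, by simp [hm]⟩

theorem ht_Lat {v : VV ι} (hv : v ∈ Lat ι) (i : ι) : ∃ n : ℤ, ht A i v = n := by
  choose n hn using hv.2
  exact ⟨∑ j, A i j * n j, by simp [ht_apply, hv.1, hn]⟩

theorem W_induction {P : W A → Prop} (h1 : P 1) (hs : ∀ i w, P w → P (sg A i * w)) (w : W A) :
    P w := (cs A).simple_induction_left w h1 fun w i h => hs i w h

theorem smul_mem_Lat {v : VV ι} (hv : v ∈ Lat ι) (w : W A) : w • v ∈ Lat ι := by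
  induction w using W_induction with
  | h1 => simpa
  | hs i w ih =>
    rw [mul_smul, sg_smul]
    exact sub_mem ih (smul_rt_mem_Lat (ht_Lat ih i) (rt_mem_Lat i))

theorem smul_fst (w : W A) (v : VV ι) : (w • v).1 = v.1 := by
  induction w using W_induction with
  | h1 => simp
  | hs i w ih => funext j; rw [mul_smul, sg_smul]; simp [ih]

/-- The action on the space, as additive endomorphisms. -/
noncomputable def actHom (A : ι → ι → ℤ) [IsGCM A] : W A →* AddMonoid.End (VV ι) :=
  DistribMulAction.toAddMonoidEnd (W A) (VV ι)

theorem actHom_actsBy : ActsBy A (actHom A) (rt : ι → VV ι) := by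
  intro i j
  show sg A i • rt j = _
  rw [sg_smul, ht_rt, Int.cast_smul_eq_zsmul]

/-- The action on linear functionals. -/
noncomputable def dualHom (A : ι → ι → ℤ) [IsGCM A] :
    W A →* AddMonoid.End (VV ι →ₗ[ℝ] ℝ) where
  toFun w :=
    { toFun := fun φ => φ ∘ₗ refRep A w⁻¹
      map_zero' := by simp
      map_add' := fun φ ψ => LinearMap.add_comp _ _ _ }
  map_one' := by ext φ : 1; show φ ∘ₗ refRep A 1⁻¹ = φ; simp; rfl
  map_mul' w w' := by
    ext φ : 1
    show φ ∘ₗ refRep A (w * w')⁻¹ = (φ ∘ₗ refRep A w'⁻¹) ∘ₗ refRep A w⁻¹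
    rw [mul_inv_rev, map_mul]; rfl

theorem dualHom_apply (w : W A) (φ : VV ι →ₗ[ℝ] ℝ) (v : VV ι) :
    dualHom A w φ v = φ (w⁻¹ • v) := rfl

theorem dualHom_actsBy : ActsBy (fun i j => A j i) (dualHom A) (ht A) := by
  intro i j
  ext v
  rw [dualHom_apply, sg_inv, ht_sg_smul]
  simp

theorem NN.rt_nonneg {v : VV ι} (h : NN rt v) (i : ι) : 0 ≤ v.2 i := by
  induction h using AddSubmonoid.closure_induction with
  | mem x hx => obtain ⟨j, rfl⟩ := hx; rw [rt_snd]; split_ifs <;> simp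
  | zero => simp
  | add x y _ _ hx hy => simpa using add_nonneg hx hy

theorem root_nonneg {w : W A} {i : ι} (h : len w < len (w * sg A i)) (j : ι) :
    0 ≤ (w • (rt i : VV ι)).2 j :=
  (nn_of_length_lt hA (fun _ _ => rfl) actHom_actsBy w i h).rt_nonneg j

theorem smul_rt_neg (w : W A) (i : ι) : (w * sg A i) • (rt i : VV ι) = - (w • rt i) := by
  rw [mul_smul, sg_smul, ht_rt, hA.diag, ← smul_neg]
  congr 1
  push_cast
  module

theorem root_nonpos {w : W A} {i : ι} (h : len (w * sg A i) < len w) (j : ι) :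
    (w • (rt i : VV ι)).2 j ≤ 0 := by
  have := root_nonneg (w := w * sg A i) (i := i) (by simpa using h) j
  rw [smul_rt_neg] at this
  simpa using this

theorem len_lt_or (w : W A) (i : ι) : len w < len (w * sg A i) ∨ len (w * sg A i) < len w := by
  have := len_mul_sg w i; omega

theorem root_ne_zero (w : W A) (i : ι) : w • (rt i : VV ι) ≠ 0 := by
  intro h
  have : (rt i : VV ι) = 0 := by simpa using congrArg (w⁻¹ • ·) h
  have := congrArg (fun v : VV ι => v.2 i) this
  simp [rt_snd] at this

theorem exists_root_ne (w : W A) (i : ι) : ∃ j, (w • (rt i : VV ι)).2 j ≠ 0 := by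
  by_contra hcon
  push Not at hcon
  exact root_ne_zero w i (VV.ext (fun j => by rw [smul_fst]; rfl) hcon)

theorem len_lt_of_root_pos {w : W A} {i j : ι} (h : 0 < (w • (rt i : VV ι)).2 j) :
    len w < len (w * sg A i) :=
  (len_lt_or w i).resolve_right fun h' => absurd (root_nonpos h' j) (not_le.2 h)

theorem eq_one_of_fix {w : W A} (h : ∀ i, w • (rt i : VV ι) = rt i) : w = 1 := by
  by_contra hw
  obtain ⟨i, hi⟩ := exists_right_descent hw
  refine absurd (len_lt_of_root_pos (w := w) (i := i) (j := i) ?_) (not_lt.2 hi.le)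
  rw [h, rt_snd]; simp

/-- Values of simple coroots on translates of dominant vectors. -/
theorem ht_NN {y : W A} {i : ι} (h : len y < len (sg A i * y)) :
    ∃ c : ι → ℕ, ∀ v : VV ι, ht A i (y • v) = ∑ j, (c j : ℝ) * ht A j v := by
  have h1 : NN (ht A) (dualHom A y⁻¹ (ht A i)) := by
    refine nn_of_length_lt hA.transpose (fun i j => mul_comm _ _) dualHom_actsBy y⁻¹ i ?_
    rw [← len_inv (y⁻¹ * sg A i), mul_inv_rev, sg_inv, inv_inv, len_inv]; exact h
  have h2 : ∀ φ : VV ι →ₗ[ℝ] ℝ, NN (ht A) φ → ∃ c : ι → ℕ, ∀ v, φ v = ∑ j, (c j : ℝ) * ht A j v := by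
    intro φ hφ
    induction hφ using AddSubmonoid.closure_induction with
    | mem x hx =>
      obtain ⟨k, rfl⟩ := hx
      exact ⟨Pi.single k 1, fun v => by simp [Pi.single_apply]⟩
    | zero => exact ⟨0, by simp⟩
    | add x y _ _ hx hy =>
      obtain ⟨c, hc⟩ := hx
      obtain ⟨d, hd⟩ := hy
      exact ⟨c + d, fun v => by simp [hc, hd, add_mul, Finset.sum_add_distrib]⟩
  obtain ⟨c, hc⟩ := h2 _ h1
  exact ⟨c, fun v => by rw [← hc, dualHom_apply, inv_inv]⟩

end Space

section CoxFacts

variable {ι : Type*} [Fintype ι] [DecidableEq ι] {A : ι → ι → ℤ} [hA : IsGCM A]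

/-- `s_i w` is longer than `w`. -/
def Pl (i : ι) (w : W A) : Prop := len w < len (sg A i * w)

theorem not_Pl {i : ι} {w : W A} : ¬ Pl i w ↔ len (sg A i * w) < len w := by
  have := len_sg_mul w i
  unfold Pl; omega

theorem Pl_sg {i : ι} {w : W A} : Pl i (sg A i * w) ↔ ¬ Pl i w := by
  rw [not_Pl]; unfold Pl; rw [sg_mul_cancel]

theorem len_inv_sg_lt {i : ι} {w : W A} : len w⁻¹ < len (w⁻¹ * sg A i) ↔ Pl i w := by
  rw [← len_inv (w⁻¹ * sg A i), mul_inv_rev, sg_inv, inv_inv, len_inv]; rfl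

theorem Pl_len {i : ι} {w : W A} (h : Pl i w) : len (sg A i * w) = len w + 1 := by
  have := len_sg_mul w i
  unfold Pl at h; omega

theorem not_Pl_len {i : ι} {w : W A} (h : ¬ Pl i w) : len (sg A i * w) + 1 = len w := by
  have := len_sg_mul w i
  unfold Pl at h; omega

/-- A nonnegative root supported on a simple root is that simple root. -/
theorem root_eq_simple {x : W A} {i k : ι} (h0 : ∀ j, 0 ≤ (x • (rt i : VV ι)).2 j)
    (h : ∀ j, j ≠ k → (x • (rt i : VV ι)).2 j = 0) : x • (rt i : VV ι) = rt k := by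
  obtain ⟨n, hn⟩ := (smul_mem_Lat (rt_mem_Lat i) x).2 k
  have hx : x • (rt i : VV ι) = (n : ℝ) • rt k := by
    refine VV.ext (fun j => by rw [smul_fst]; simp) fun j => ?_
    rw [VV.smul_snd, rt_snd]
    split_ifs with hj
    · rw [hj, hn]; simp
    · rw [h j hj]; simp
  obtain ⟨m, hm⟩ := (smul_mem_Lat (rt_mem_Lat k) x⁻¹).2 i
  have h1 : (rt i : VV ι) = (n : ℝ) • (x⁻¹ • rt k) := by
    rw [← smul_comm, ← hx, inv_smul_smul]
  have h2 := congrArg (fun v : VV ι => v.2 i) h1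
  simp only [rt_snd, VV.smul_snd, hm, if_true] at h2
  have h3 : n * m = 1 := by exact_mod_cast h2.symm
  have h4 := h0 k
  rw [hn] at h4
  have h5 : 0 ≤ n := by exact_mod_cast h4
  have h6 : n = 1 := Int.eq_one_of_mul_eq_one_right h5 h3
  rw [hx, h6]; simp

theorem mul_sg_of_root_eq {x : W A} {i k : ι} (h : x • (rt i : VV ι) = rt k) :
    x * sg A i = sg A k * x := by
  obtain ⟨T, hT⟩ : ∃ T, T = x * sg A i * x⁻¹ * sg A k := ⟨_, rfl⟩
  have hx : x⁻¹ • (rt k : VV ι) = rt i := by rw [← h, inv_smul_smul]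
  have hact : ∀ v : VV ι, ∃ c : ℝ, T • v = v + c • rt k := fun v => by
    refine ⟨-ht A k v - ht A i (x⁻¹ • sg A k • v), ?_⟩
    rw [hT, mul_smul, mul_smul, mul_smul, sg_smul i, smul_sub, smul_inv_smul, smul_comm, h,
      sg_smul k]
    module
  have hk : T • (rt k : VV ι) = rt k := by
    rw [hT, mul_smul, mul_smul, mul_smul, sg_smul k, ht_rt, hA.diag]
    have : (rt k : VV ι) - ((2 : ℤ) : ℝ) • rt k = - rt k := by push_cast; module
    rw [this, smul_neg, hx, smul_neg, smul_neg, sg_smul i, ht_rt, hA.diag]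
    have : (rt i : VV ι) - ((2 : ℤ) : ℝ) • rt i = - rt i := by push_cast; module
    rw [this, smul_neg, h, neg_neg]
  have hT1 : T = 1 := by
    refine eq_one_of_fix fun j => ?_
    by_cases hjk : j = k
    · rw [hjk, hk]
    obtain ⟨c, hc⟩ := hact (rt j)
    have hpow : ∀ n : ℕ, T ^ n • (rt j : VV ι) = rt j + (n * c) • rt k := fun n => by
      induction n with
      | zero => simp
      | succ n ih =>
        rw [pow_succ', mul_smul, ih, smul_add, smul_comm, hk, hc]; push_cast; module
    have hpow' : ∀ n : ℕ, (T ^ n)⁻¹ • (rt j : VV ι) = rt j - (n * c) • rt k := fun n => by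
      have h1 : (T ^ n)⁻¹ • (rt k : VV ι) = rt k := by
        rw [inv_smul_eq_iff]
        induction n with
        | zero => simp
        | succ n ih => rw [pow_succ', mul_smul, ← ih, hk]
      rw [inv_smul_eq_iff, smul_sub, hpow, smul_comm, inv_smul_eq_iff.1 h1 |>.symm]
      module
    have hcoef : ∀ (w : W A) (d : ℝ), w • (rt j : VV ι) = rt j + d • rt k → 0 ≤ d := by
      intro w d hw
      have h1 : len w < len (w * sg A j) := by
        refine len_lt_of_root_pos (j := j) ?_
        rw [hw]; simp [rt_snd, hjk]
      have := root_nonneg h1 k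
      rw [hw] at this
      simpa [rt_snd, Ne.symm hjk] using this
    have hc0 : c = 0 := by
      apply le_antisymm
      · have := hcoef ((T ^ 1)⁻¹) (-c) (by rw [hpow']; simp; module)
        linarith
      · have := hcoef (T ^ 1) c (by rw [hpow]; simp)
        linarith
    rw [hc, hc0]; simp
  rw [hT] at hT1
  have := congrArg (· * sg A k * x) hT1
  simpa using this

theorem ht_of_root_eq {x : W A} {i k : ι} (h : x • (rt i : VV ι) = rt k) (v : VV ι) :
    ht A k (x • v) = ht A i v := by
  have h1 : (x * sg A i) • v = (sg A k * x) • v := by rw [mul_sg_of_root_eq h]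
  rw [mul_smul, mul_smul, sg_smul, sg_smul, smul_sub, smul_comm, h] at h1
  have h2 := congrArg (fun v : VV ι => v.2 k) h1
  simp [rt_snd] at h2
  exact h2.symm

theorem root_eq_of_flip {x : W A} {i k : ι} (h1 : len x < len (x * sg A i))
    (h2 : len (sg A k * x * sg A i) < len (sg A k * x)) : x • (rt i : VV ι) = rt k := by
  have hpos := root_nonneg h1
  refine root_eq_simple hpos fun j hj => ?_
  have := root_nonpos h2 j
  rw [mul_smul, sg_smul] at this
  simp [rt_snd, hj] at this
  exact le_antisymm this (hpos j)

/-- Right multiplication by a reflection sending a positive root to a negative one shortens. -/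
theorem len_mul_refl_lt (v y : W A) (i : ι) (hy : Pl i y)
    (hneg : ∃ j, ((v * y⁻¹) • (rt i : VV ι)).2 j < 0) :
    len (v * (y⁻¹ * sg A i * y)) < len v := by
  obtain ⟨n, hn⟩ : ∃ n, len v = n := ⟨_, rfl⟩
  induction n generalizing v y with
  | zero =>
    rw [len_eq_zero] at hn
    subst hn
    obtain ⟨j, hj⟩ := hneg
    have := root_nonneg (len_inv_sg_lt.2 hy) j
    rw [one_mul] at hj
    linarith
  | succ n ih =>
    have hv : v ≠ 1 := by rintro rfl; simp at hn
    obtain ⟨j, hj⟩ := exists_right_descent hv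
    have hlj := len_mul_sg v j
    by_cases hs : Pl i (y * sg A j)
    · have h := ih (v * sg A j) (y * sg A j) hs (by simpa [mul_assoc] using hneg) (by omega)
      have h2 := len_mul_sg (v * sg A j * ((y * sg A j)⁻¹ * sg A i * (y * sg A j))) j
      have h3 : v * sg A j * ((y * sg A j)⁻¹ * sg A i * (y * sg A j)) * sg A j =
          v * (y⁻¹ * sg A i * y) := by simp [mul_assoc]
      rw [h3] at h2
      omega
    · have h1 : len (sg A j * y⁻¹ * sg A i) < len (sg A j * y⁻¹) := by
        have := not_Pl.1 hs
        rw [← len_inv, ← len_inv (y * sg A j)] at this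
        simpa [mul_assoc] using this
      have h2 := mul_sg_of_root_eq (root_eq_of_flip (len_inv_sg_lt.2 hy) h1)
      rw [h2]; simpa using hj

theorem len_insert {x y : W A} {i : ι} (hy : Pl i y) (hx : len x < len (x * sg A i)) :
    len (x * y) < len (x * sg A i * y) := by
  obtain ⟨j, hj⟩ := exists_root_ne x i
  have hj' := lt_of_le_of_ne (root_nonneg hx j) (Ne.symm hj)
  have := len_mul_refl_lt (x * sg A i * y) y i hy ⟨j, by
    rw [mul_inv_cancel_right, smul_rt_neg]; simpa using hj'⟩
  simpa [mul_assoc] using this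

/-- An integral covering relation at the point `p`. -/
def IEdge (p : VV ι) (u v : W A) : Prop :=
  ∃ x i y, v = x * y ∧ u = x * sg A i * y ∧ len u = len v + 1 ∧ Pl i y ∧
    ∃ n : ℤ, ht A i (y • p) = n

theorem IEdge.sub_mem {p : VV ι} {u v : W A} (h : IEdge p u v) : v • p - u • p ∈ Lat ι := by
  obtain ⟨x, i, y, rfl, rfl, -, -, hn⟩ := h
  have : (x * y) • p - (x * sg A i * y) • p = ht A i (y • p) • x • rt i := by
    rw [mul_smul, mul_smul, mul_smul, sg_smul, smul_sub, smul_comm x (ht A i (y • p)), sub_sub_cancel]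
  rw [this]
  exact smul_rt_mem_Lat hn (smul_mem_Lat (rt_mem_Lat i) x)

/-- Integrality of the pairing with the `k`-th coroot. -/
def IsI (A : ι → ι → ℤ) (k : ι) (v : VV ι) : Prop := ∃ n : ℤ, ht A k v = n

theorem IsI.add_Lat {k : ι} {u v : VV ι} (h : IsI A k u) (hv : v ∈ Lat ι) : IsI A k (u + v) := by
  obtain ⟨m, hm⟩ := h
  obtain ⟨n, hn⟩ := ht_Lat (A := A) hv k
  exact ⟨m + n, by rw [map_add, hm, hn]; push_cast; rfl⟩

theorem IsI.congr {k : ι} {u v : VV ι} (hv : v - u ∈ Lat ι) (h : IsI A k u) : IsI A k v := by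
  simpa using h.add_Lat hv

theorem isI_congr {k : ι} {u v : VV ι} (hv : v - u ∈ Lat ι) : IsI A k u ↔ IsI A k v :=
  ⟨IsI.congr hv, IsI.congr (by rw [← neg_mem_iff]; simpa using hv)⟩

theorem IEdge.flip {p : VV ι} {u v : W A} (h : IEdge p u v) {k : ι} (hu : ¬ Pl k u)
    (hv : Pl k v) : u = sg A k * v ∧ IsI A k (v • p) := by
  obtain ⟨x, i, y, rfl, rfl, hl, hy, hn⟩ := h
  have h1 : len x < len (x * sg A i) := by
    refine (len_lt_or x i).resolve_right fun h => ?_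
    have := len_insert (x := x * sg A i) hy (by simpa using h)
    rw [mul_sg_cancel] at this
    omega
  have h2 : len (sg A k * x * sg A i) < len (sg A k * x) := by
    refine (len_lt_or _ i).resolve_left fun h => ?_
    have h3 := len_insert hy h
    have h4 := not_Pl_len hu
    have h5 := Pl_len hv
    simp only [mul_assoc] at h3 h4 h5 hl
    omega
  have h3 := root_eq_of_flip h1 h2
  refine ⟨by rw [mul_sg_of_root_eq h3, mul_assoc], ?_⟩
  rw [IsI, mul_smul, ht_of_root_eq h3]; exact hn

theorem IEdge.sg_mul {p : VV ι} {u v : W A} (h : IEdge p u v) {k : ι} (huv : Pl k u ↔ Pl k v) :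
    IEdge p (sg A k * u) (sg A k * v) := by
  have hl : len (sg A k * u) = len (sg A k * v) + 1 := by
    obtain ⟨x, i, y, -, -, hl, -⟩ := h
    by_cases hu : Pl k u
    · rw [Pl_len hu, Pl_len (huv.1 hu)]; omega
    · have h1 := not_Pl_len hu
      have h2 := not_Pl_len (mt huv.2 hu)
      omega
  obtain ⟨x, i, y, hv, hu, -, hy, hn⟩ := h
  exact ⟨sg A k * x, i, y, by rw [hv, mul_assoc], by rw [hu]; simp only [mul_assoc], hl, hy, hn⟩

theorem IEdge.of_Pl {p : VV ι} {v : W A} {k : ι} (h : Pl k v) (hi : IsI A k (v • p)) :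
    IEdge p (sg A k * v) v :=
  ⟨1, k, v, by simp, by simp, Pl_len h, h, hi⟩

/-- Chains of integral covering relations at the point `p`. -/
def IChain (p : VV ι) : W A → W A → Prop := Relation.ReflTransGen (IEdge p)

theorem IChain.refl (p : VV ι) (u : W A) : IChain p u u := Relation.ReflTransGen.refl

theorem IChain.trans {p : VV ι} {u v w : W A} (h : IChain p u v) (h' : IChain p v w) :
    IChain p u w := Relation.ReflTransGen.trans h h'

theorem IEdge.chain {p : VV ι} {u v : W A} (h : IEdge p u v) : IChain p u v :=
  Relation.ReflTransGen.single h

theorem IChain.sub_mem {p : VV ι} {u v : W A} (h : IChain p u v) : v • p - u • p ∈ Lat ι := by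
  induction h with
  | refl => simp
  | tail _ h ih => simpa using add_mem h.sub_mem ih

/-- The longer of `v`, `s_k v`. -/
noncomputable def upW (k : ι) (v : W A) : W A := open Classical in if Pl k v then sg A k * v else v

/-- The shorter of `v`, `s_k v`. -/
noncomputable def loW (k : ι) (v : W A) : W A := open Classical in if Pl k v then v else sg A k * v

theorem upW_pos {k : ι} {v : W A} (h : Pl k v) : upW k v = sg A k * v := if_pos h
theorem upW_neg {k : ι} {v : W A} (h : ¬ Pl k v) : upW k v = v := if_neg h
theorem loW_pos {k : ι} {v : W A} (h : Pl k v) : loW k v = v := if_pos h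
theorem loW_neg {k : ι} {v : W A} (h : ¬ Pl k v) : loW k v = sg A k * v := if_neg h

theorem IChain.of_Pl {p : VV ι} {v : W A} {k : ι} (h : Pl k v) (hi : IsI A k (v • p)) :
    IChain p (sg A k * v) v := (IEdge.of_Pl h hi).chain

theorem isI_sg {p : VV ι} {v : W A} {k : ι} : IsI A k ((sg A k * v) • p) ↔ IsI A k (v • p) := by
  unfold IsI
  rw [mul_smul, ht_sg_smul_self]
  constructor <;> rintro ⟨n, hn⟩ <;> exact ⟨-n, by push_cast; linarith⟩

theorem IChain.of_not_Pl {p : VV ι} {v : W A} {k : ι} (h : ¬ Pl k v) (hi : IsI A k (v • p)) :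
    IChain p v (sg A k * v) := by
  have := IChain.of_Pl (Pl_sg.2 h) (isI_sg.2 hi)
  rwa [sg_mul_cancel] at this

theorem IChain.isI {p : VV ι} {u v : W A} (h : IChain p u v) {k : ι} :
    IsI A k (u • p) ↔ IsI A k (v • p) := isI_congr h.sub_mem

theorem IChain.upW {p : VV ι} {u v : W A} (h : IChain p u v) {k : ι} (hi : IsI A k (v • p)) :
    IChain p (upW k u) (upW k v) := by
  induction h with
  | refl => exact IChain.refl _ _
  | @tail b c h' h ih =>
    have hb := (h.chain.isI (k := k)).2 hi
    refine (ih hb).trans ?_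
    by_cases hPb : Pl k b <;> by_cases hPc : Pl k c
    · rw [upW_pos hPb, upW_pos hPc]; exact (h.sg_mul (by tauto)).chain
    · rw [upW_pos hPb, upW_neg hPc]; exact (IChain.of_Pl hPb hb).trans h.chain
    · rw [upW_neg hPb, upW_pos hPc, (h.flip hPb hPc).1]; exact IChain.refl _ _
    · rw [upW_neg hPb, upW_neg hPc]; exact h.chain

theorem IChain.loW {p : VV ι} {u v : W A} (h : IChain p u v) {k : ι} (hi : IsI A k (v • p)) :
    IChain p (loW k u) (loW k v) := by
  induction h with
  | refl => exact IChain.refl _ _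
  | @tail b c h' h ih =>
    have hb := (h.chain.isI (k := k)).2 hi
    refine (ih hb).trans ?_
    by_cases hPb : Pl k b <;> by_cases hPc : Pl k c
    · rw [loW_pos hPb, loW_pos hPc]; exact h.chain
    · rw [loW_pos hPb, loW_neg hPc]; exact h.chain.trans (IChain.of_not_Pl hPc hi)
    · rw [loW_neg hPb, loW_pos hPc, (h.flip hPb hPc).1, sg_mul_cancel]; exact IChain.refl _ _
    · rw [loW_neg hPb, loW_neg hPc]; exact (h.sg_mul (by tauto)).chain

/-- A chain can pass from a left descent to a non-descent only at integral points. -/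
theorem IChain.isI_of_flip {p : VV ι} {u v : W A} (h : IChain p u v) {k : ι} (hu : ¬ Pl k u)
    (hv : Pl k v) : IsI A k (v • p) := by
  induction h with
  | refl => exact absurd hv hu
  | @tail b c h' h ih =>
    by_cases hb : Pl k b
    · exact h.chain.isI.1 (ih hb)
    · exact (h.flip hb hv).2

theorem IChain.sg_mul_of_Pl {p : VV ι} {u v : W A} (h : IChain p u v) {k : ι} (hu : Pl k u)
    (hv : Pl k v) : IChain p (sg A k * u) (sg A k * v) := by
  by_cases hi : IsI A k (v • p)
  · have := h.upW hi
    rwa [upW_pos hu, upW_pos hv] at this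
  · induction h with
    | refl => exact IChain.refl _ _
    | @tail b c h' h ih =>
      by_cases hb : Pl k b
      · exact (ih hb (mt h.chain.isI.1 hi)).trans (h.sg_mul (by tauto)).chain
      · exact absurd (h.flip hb hv).2 hi

theorem IChain.sg_mul_of_not_Pl {p : VV ι} {u v : W A} (h : IChain p u v) {k : ι}
    (hu : ¬ Pl k u) (hv : ¬ Pl k v) : IChain p (sg A k * u) (sg A k * v) := by
  by_cases hi : IsI A k (v • p)
  · have := h.loW hi
    rwa [loW_neg hu, loW_neg hv] at this
  · induction h using Relation.ReflTransGen.head_induction_on with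
    | refl => exact IChain.refl _ _
    | @head b c h h' ih =>
      by_cases hc : Pl k c
      · exact absurd (IChain.isI h' |>.1 (h.flip hu hc).2) hi
      · exact (h.sg_mul (by tauto)).chain.trans (ih hc)

end CoxFacts

open Set Filter Topology

section Amount

/-- Clamping to the unit interval. -/
noncomputable def cl (t : ℝ) : ℝ := max 0 (min t 1)

theorem cl_mem (t : ℝ) : cl t ∈ Icc (0 : ℝ) 1 :=
  ⟨le_max_left _ _, max_le zero_le_one (min_le_right _ _)⟩

theorem cl_of_mem {t : ℝ} (h : t ∈ Icc (0 : ℝ) 1) : cl t = t := by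
  rw [cl, min_eq_left h.2, max_eq_right h.1]

theorem continuous_cl : Continuous cl := by unfold cl; fun_prop

/-- Infimum of `f` over `[t, 1]`. -/
noncomputable def lo (f : ℝ → ℝ) (t : ℝ) : ℝ := sInf (f '' Icc t 1)

/-- Infimum of `f` over `[0, t]`. -/
noncomputable def pre (f : ℝ → ℝ) (t : ℝ) : ℝ := sInf (f '' Icc 0 t)

theorem lo_eq {f : ℝ → ℝ} {t u c : ℝ} (hu : u ∈ Icc t 1) (hfu : f u = c)
    (h : ∀ s ∈ Icc t 1, c ≤ f s) : lo f t = c :=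
  IsLeast.csInf_eq ⟨⟨u, hu, hfu⟩, by rintro _ ⟨s, hs, rfl⟩; exact h s hs⟩

theorem pre_eq {f : ℝ → ℝ} {t u c : ℝ} (hu : u ∈ Icc 0 t) (hfu : f u = c)
    (h : ∀ s ∈ Icc 0 t, c ≤ f s) : pre f t = c :=
  IsLeast.csInf_eq ⟨⟨u, hu, hfu⟩, by rintro _ ⟨s, hs, rfl⟩; exact h s hs⟩

theorem exists_lo {f : ℝ → ℝ} (hf : Continuous f) {t : ℝ} (ht : t ≤ 1) :
    ∃ u ∈ Icc t 1, f u = lo f t ∧ ∀ s ∈ Icc t 1, lo f t ≤ f s := by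
  obtain ⟨u, hu, h⟩ := isCompact_Icc.exists_isMinOn (nonempty_Icc.2 ht) hf.continuousOn
  have := lo_eq hu rfl fun s hs => h hs
  exact ⟨u, hu, this.symm, fun s hs => by rw [this]; exact h hs⟩

theorem lo_le {f : ℝ → ℝ} (hf : Continuous f) {t s : ℝ} (hs : s ∈ Icc t 1) : lo f t ≤ f s := by
  obtain ⟨-, -, -, h⟩ := exists_lo hf (hs.1.trans hs.2)
  exact h s hs

theorem le_lo {f : ℝ → ℝ} {t c : ℝ} (ht : t ≤ 1) (h : ∀ s ∈ Icc t 1, c ≤ f s) : c ≤ lo f t :=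
  le_csInf ((nonempty_Icc.2 ht).image f) (by rintro _ ⟨s, hs, rfl⟩; exact h s hs)

theorem lo_mono {f : ℝ → ℝ} (hf : Continuous f) {t s : ℝ} (h : t ≤ s) (hs : s ≤ 1) :
    lo f t ≤ lo f s :=
  le_lo hs fun _ hu => lo_le hf ⟨h.trans hu.1, hu.2⟩

theorem lo_one (f : ℝ → ℝ) : lo f 1 = f 1 := by simp [lo]

/-- The amount by which `f` is reflected at time `t` by the lowering operator. -/
noncomputable def amt (f : ℝ → ℝ) (t : ℝ) : ℝ := min 1 (lo f (cl t) - lo f 0)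

theorem amt_cl (f : ℝ → ℝ) (t : ℝ) : amt f (cl t) = amt f t := by
  rw [amt, amt, cl_of_mem (cl_mem t)]

theorem amt_nonneg {f : ℝ → ℝ} (hf : Continuous f) (t : ℝ) : 0 ≤ amt f t :=
  le_min zero_le_one (sub_nonneg.2 (lo_mono hf (cl_mem t).1 (cl_mem t).2))

theorem amt_le_one (f : ℝ → ℝ) (t : ℝ) : amt f t ≤ 1 := min_le_left _ _

theorem amt_mono {f : ℝ → ℝ} (hf : Continuous f) : Monotone (amt f) := fun s t h => by
  refine min_le_min le_rfl (sub_le_sub_right (lo_mono hf ?_ (cl_mem t).2) _)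
  unfold cl; gcongr

theorem continuous_lo {X : Type*} [TopologicalSpace X] {f : X → ℝ → ℝ}
    (hf : Continuous fun p : X × ℝ => f p.1 p.2) :
    Continuous fun p : X × ℝ => lo (f p.1) (cl p.2) := by
  have h1 : ∀ p : X × ℝ, lo (f p.1) (cl p.2) =
      sInf ((fun u => f p.1 (cl p.2 + u * (1 - cl p.2))) '' Icc (0 : ℝ) 1) := fun p => by
    unfold lo; congr 1
    obtain ⟨h0, h1⟩ := cl_mem p.2
    ext y
    constructor
    · rintro ⟨s, hs, rfl⟩
      rcases h1.lt_or_eq with h | h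
      · refine ⟨(s - cl p.2) / (1 - cl p.2), ⟨div_nonneg (by linarith [hs.1]) (by linarith),
          (div_le_one (by linarith)).2 (by linarith [hs.2])⟩, ?_⟩
        simp only []
        congr 1
        field_simp [show (1 - cl p.2) ≠ 0 by linarith]
        ring
      · refine ⟨0, by simp, ?_⟩
        simp only []
        congr 1
        have := hs.1; have := hs.2; linarith
    · rintro ⟨u, hu, rfl⟩
      exact ⟨_, ⟨by nlinarith [hu.1], by nlinarith [hu.2]⟩, rfl⟩
  simp only [h1]
  refine isCompact_Icc.continuous_sInf (f := fun (p : X × ℝ) u => f p.1 (cl p.2 + u * (1 - cl p.2))) ?_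
  have := continuous_cl
  show Continuous fun q : (X × ℝ) × ℝ => f q.1.1 (cl q.1.2 + q.2 * (1 - cl q.1.2))
  have h1 : Continuous fun q : (X × ℝ) × ℝ => (q.1.1, cl q.1.2 + q.2 * (1 - cl q.1.2)) := by
    fun_prop
  exact hf.comp h1

theorem continuous_amt_family {X : Type*} [TopologicalSpace X] {f : X → ℝ → ℝ}
    (hf : Continuous fun p : X × ℝ => f p.1 p.2) :
    Continuous fun p : X × ℝ => amt (f p.1) p.2 := by
  refine continuous_const.min ((continuous_lo hf).sub ?_)
  have := (continuous_lo hf).comp (Continuous.prodMk continuous_fst (continuous_const (y := (0:ℝ))) :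
    Continuous fun p : X × ℝ => (p.1, (0:ℝ)))
  simpa [Function.comp_def, cl_of_mem (show (0 : ℝ) ∈ Icc (0 : ℝ) 1 by simp)] using this

theorem continuous_lo_zero {X : Type*} [TopologicalSpace X] {f : X → ℝ → ℝ}
    (hf : Continuous fun p : X × ℝ => f p.1 p.2) : Continuous fun x : X => lo (f x) 0 := by
  have := (continuous_lo hf).comp (Continuous.prodMk continuous_id (continuous_const (y := (0:ℝ))) :
    Continuous fun p : X => (p, (0:ℝ)))
  simpa [Function.comp_def, cl_of_mem (show (0 : ℝ) ∈ Icc (0 : ℝ) 1 by simp)] using this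

/-- The shape of a function near the place where the lowering operator acts. -/
structure Form (f : ℝ → ℝ) (m p q : ℝ) : Prop where
  p_nonneg : 0 ≤ p
  lt : p < q
  q_le : q ≤ 1
  before : ∀ t ∈ Icc 0 p, m ≤ f t
  at_p : f p = m
  mono : MonotoneOn f (Icc p q)
  at_q : f q = m + 1
  after : ∀ t ∈ Icc q 1, m + 1 ≤ f t

namespace Form

variable {f : ℝ → ℝ} {m p q : ℝ} (h : Form f m p q)

include h

theorem ge_mid {t : ℝ} (ht : t ∈ Icc p q) : m ≤ f t := by
  rw [← h.at_p]; exact h.mono ⟨le_rfl, h.lt.le⟩ ht ht.1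

theorem le_mid {t : ℝ} (ht : t ∈ Icc p q) : f t ≤ m + 1 := by
  rw [← h.at_q]; exact h.mono ht ⟨h.lt.le, le_rfl⟩ ht.2

theorem ge {t : ℝ} (ht : t ∈ Icc (0 : ℝ) 1) : m ≤ f t := by
  rcases le_total t p with h1 | h1
  · exact h.before t ⟨ht.1, h1⟩
  rcases le_total t q with h2 | h2
  · exact h.ge_mid ⟨h1, h2⟩
  · linarith [h.after t ⟨h2, ht.2⟩]

theorem lo_before {t : ℝ} (h0 : 0 ≤ t) (ht : t ≤ p) : lo f t = m :=
  lo_eq ⟨ht, h.lt.le.trans h.q_le⟩ h.at_p fun _ hs => h.ge ⟨h0.trans hs.1, hs.2⟩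

theorem lo_mid {t : ℝ} (ht : t ∈ Icc p q) : lo f t = f t := by
  refine lo_eq ⟨le_rfl, ht.2.trans h.q_le⟩ rfl fun s hs => ?_
  rcases le_total s q with h2 | h2
  · exact h.mono ht ⟨ht.1.trans hs.1, h2⟩ hs.1
  · exact (h.le_mid ht).trans (h.after s ⟨h2, hs.2⟩)

theorem amt_before {t : ℝ} (h0 : 0 ≤ t) (ht : t ≤ p) : amt f t = 0 := by
  rw [amt, cl_of_mem ⟨h0, ht.trans (h.lt.le.trans h.q_le)⟩, h.lo_before h0 ht,
    h.lo_before le_rfl h.p_nonneg]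
  simp

theorem amt_mid {t : ℝ} (ht : t ∈ Icc p q) : amt f t = f t - m := by
  rw [amt, cl_of_mem ⟨h.p_nonneg.trans ht.1, ht.2.trans h.q_le⟩, h.lo_mid ht,
    h.lo_before le_rfl h.p_nonneg, min_eq_right]
  linarith [h.le_mid ht]

theorem amt_after {t : ℝ} (ht : t ∈ Icc q 1) : amt f t = 1 := by
  rw [amt, cl_of_mem ⟨h.p_nonneg.trans (h.lt.le.trans ht.1), ht.2⟩,
    h.lo_before le_rfl h.p_nonneg, min_eq_left]
  have : m + 1 ≤ lo f t := le_lo ht.2 fun s hs => h.after s ⟨ht.1.trans hs.1, hs.2⟩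
  linarith

/-- The minimum of the lowered function. -/
theorem lo_lower : lo (fun t => f t - 2 * amt f t) 0 = m - 1 := by
  refine lo_eq (u := q) ⟨h.p_nonneg.trans h.lt.le, h.q_le⟩ ?_ fun s hs => ?_
  · rw [h.amt_after ⟨le_rfl, h.q_le⟩, h.at_q]; ring
  · rcases le_total s p with h1 | h1
    · rw [h.amt_before hs.1 h1]; linarith [h.before s ⟨hs.1, h1⟩]
    rcases le_total s q with h2 | h2
    · rw [h.amt_mid ⟨h1, h2⟩]; linarith [h.le_mid ⟨h1, h2⟩]
    · rw [h.amt_after ⟨h2, hs.2⟩]; linarith [h.after s ⟨h2, hs.2⟩]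

/-- The amount can be recovered from the lowered function. -/
theorem amt_eq_pre (t : ℝ) : amt f t =
    max 0 (lo (fun t => f t - 2 * amt f t) 0 + 1 - pre (fun t => f t - 2 * amt f t) (cl t)) := by
  rw [h.lo_lower, ← amt_cl]
  obtain ⟨h0, h1⟩ := cl_mem t
  generalize cl t = t at *
  have hp : ∀ s, 0 ≤ s → s ≤ p → m ≤ f s - 2 * amt f s := fun s hs hsp => by
    rw [h.amt_before hs hsp]; linarith [h.before s ⟨hs, hsp⟩]
  rcases le_total t p with ht | ht
  · rw [h.amt_before h0 ht, eq_comm, max_eq_left]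
    have : m ≤ pre (fun t => f t - 2 * amt f t) t :=
      le_csInf ((nonempty_Icc.2 h0).image _) (by
        rintro _ ⟨s, hs, rfl⟩; exact hp s hs.1 (hs.2.trans ht))
    linarith
  rcases le_total t q with ht' | ht'
  · have : pre (fun t => f t - 2 * amt f t) t = 2 * m - f t := by
      refine pre_eq ⟨h0, le_rfl⟩ ?_ fun s hs => ?_
      · rw [h.amt_mid ⟨ht, ht'⟩]; ring
      · rcases le_total s p with h2 | h2
        · linarith [hp s hs.1 h2, h.ge_mid ⟨ht, ht'⟩]
        · rw [h.amt_mid ⟨h2, hs.2.trans ht'⟩]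
          linarith [h.mono ⟨h2, hs.2.trans ht'⟩ ⟨ht, ht'⟩ hs.2]
    rw [this, h.amt_mid ⟨ht, ht'⟩, max_eq_right] <;> linarith [h.ge_mid ⟨ht, ht'⟩]
  · have : pre (fun t => f t - 2 * amt f t) t = m - 1 := by
      refine pre_eq (u := q) ⟨h.p_nonneg.trans h.lt.le, ht'⟩ ?_ fun s hs => ?_
      · rw [h.amt_after ⟨le_rfl, h.q_le⟩, h.at_q]; ring
      · rcases le_total s p with h2 | h2
        · linarith [hp s hs.1 h2]
        rcases le_total s q with h3 | h3
        · rw [h.amt_mid ⟨h2, h3⟩]; linarith [h.le_mid ⟨h2, h3⟩]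
        · rw [h.amt_after ⟨h3, hs.2.trans h1⟩]; linarith [h.after s ⟨h3, hs.2.trans h1⟩]
    rw [this, h.amt_after ⟨ht', h1⟩]; norm_num

end Form

end Amount

theorem le_of_local_le {f : ℝ → ℝ} (hf : Continuous f) {a b : ℝ} (hab : a ≤ b)
    (h : ∀ τ ∈ Ico a b, ∀ᶠ s in 𝓝[>] τ, f τ ≤ f s) : f a ≤ f b := by
  have hcl : IsClosed ({t | f a ≤ f t} ∩ Icc a b) :=
    (isClosed_le continuous_const hf).inter isClosed_Icc
  refine hcl.Icc_subset_of_forall_exists_gt (a := a) (b := b) (by simp) ?_ (right_mem_Icc.2 hab)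
  intro τ hτ y hy
  obtain ⟨s, hs, hs'⟩ := ((h τ hτ.2).and (Ioc_mem_nhdsGT hy)).exists
  exact ⟨s, le_trans hτ.1 hs, hs'⟩

theorem monotoneOn_of_local_le {f : ℝ → ℝ} (hf : Continuous f) {a b : ℝ}
    (h : ∀ τ ∈ Ico a b, ∀ᶠ s in 𝓝[>] τ, f τ ≤ f s) : MonotoneOn f (Icc a b) := fun _ hs _ ht hst =>
  le_of_local_le hf hst fun τ hτ => h τ ⟨hs.1.trans hτ.1, hτ.2.trans_le ht.2⟩

section LS

variable {ι : Type*} [Fintype ι] [DecidableEq ι] {A : ι → ι → ℤ} [hA : IsGCM A]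

/-- Dominant base curves. -/
structure Base (x : ℝ → ι → ℝ) : Prop where
  cont : ∀ i, Continuous fun t => x t i
  mono : ∀ i, Monotone fun t => x t i
  zero : x 0 = 0
  one : ∀ i, ∃ n : ℤ, x 1 i = n
  clamp : ∀ t, x (cl t) = x t

/-- The base curve as a curve in `VV`. -/
def bs (x : ℝ → ι → ℝ) (t : ℝ) : VV ι := mkV (x t) 0

theorem ht_bs (x : ℝ → ι → ℝ) (t : ℝ) (i : ι) : ht A i (bs x t) = x t i := by
  simp [ht_apply, bs]

theorem ht_bs_sub {x : ℝ → ι → ℝ} (hx : Base x) {s t : ℝ} (h : s ≤ t) (i : ι) :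
    0 ≤ ht A i (bs x t - bs x s) := by
  rw [map_sub, ht_bs, ht_bs]; exact sub_nonneg.2 (hx.mono i h)

theorem ht_smul_nonneg {w : W A} {i : ι} (hw : Pl i w) {v : VV ι} (hv : ∀ j, 0 ≤ ht A j v) :
    0 ≤ ht A i (w • v) := by
  obtain ⟨c, hc⟩ := ht_NN hw
  rw [hc]; exact Finset.sum_nonneg fun j _ => mul_nonneg (by positivity) (hv j)

theorem ht_smul_nonpos {w : W A} {i : ι} (hw : ¬ Pl i w) {v : VV ι} (hv : ∀ j, 0 ≤ ht A j v) :
    ht A i (w • v) ≤ 0 := by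
  have := ht_smul_nonneg (Pl_sg.2 hw) hv
  rw [mul_smul, ht_sg_smul_self] at this
  linarith

theorem exists_not_Pl {w : W A} (hw : w ≠ 1) : ∃ i, ¬ Pl i w := by
  obtain ⟨i, hi⟩ := exists_right_descent (inv_ne_one.2 hw)
  refine ⟨i, not_Pl.2 ?_⟩
  rw [← len_inv, ← len_inv w]
  simpa using hi

theorem smul_snd_nonpos (w : W A) {v : VV ι} (hv : ∀ j, 0 ≤ ht A j v) (j : ι) :
    (w • v).2 j ≤ v.2 j := by
  obtain ⟨n, hn⟩ : ∃ n, len w = n := ⟨_, rfl⟩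
  induction n generalizing w with
  | zero => rw [len_eq_zero] at hn; subst hn; simp
  | succ n ih =>
    obtain ⟨i, hi⟩ := exists_not_Pl (w := w) (by rintro rfl; simp at hn)
    have h1 := not_Pl_len hi
    have h2 := ih (sg A i * w) (by omega)
    have h3 := ht_smul_nonneg (Pl_sg.2 hi) hv
    have h4 : w • v = sg A i • ((sg A i * w) • v) := by rw [← mul_smul, sg_mul_cancel]
    rw [h4, sg_smul, VV.sub_snd, VV.smul_snd, rt_snd]
    split_ifs <;> linarith

theorem smul_sub_mem_Lat {v : VV ι} (hv : ∀ j, ∃ n : ℤ, ht A j v = n) (w : W A) :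
    w • v - v ∈ Lat ι := by
  induction w using W_induction with
  | h1 => simp [(Lat ι).zero_mem]
  | hs i w ih =>
    have h1 : ∃ n : ℤ, ht A i (w • v) = n := by
      obtain ⟨n, hn⟩ := ht_Lat (A := A) ih i
      obtain ⟨m, hm⟩ := hv i
      rw [map_sub, hm] at hn
      exact ⟨n + m, by push_cast; linarith⟩
    rw [mul_smul, sg_smul, sub_right_comm]
    exact (Lat ι).sub_mem ih (smul_rt_mem_Lat h1 (rt_mem_Lat i))

/-- Lakshmibai–Seshadri paths over a base curve, with their left and right directions. -/
structure LSd (x : ℝ → ι → ℝ) (η : ℝ → VV ι) (wl wr : ℝ → W A) : Prop where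
  zero : η 0 = 0
  clamp : ∀ t, η (cl t) = η t
  cont : ∀ j, Continuous fun t => (η t).2 j
  left : ∀ τ ∈ Ioc (0 : ℝ) 1, ∀ᶠ s in 𝓝[<] τ, wl s = wl τ ∧ wr s = wl τ ∧
    η τ - η s = wl τ • (bs x τ - bs x s)
  right : ∀ τ ∈ Ico (0 : ℝ) 1, ∀ᶠ s in 𝓝[>] τ, wl s = wr τ ∧ wr s = wr τ ∧
    η s - η τ = wr τ • (bs x s - bs x τ)
  chain : ∀ τ ∈ Ioo (0 : ℝ) 1, IChain (bs x τ) (wl τ) (wr τ)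
  lat : ∀ τ ∈ Ioc (0 : ℝ) 1, η τ - wl τ • bs x τ ∈ Lat ι

theorem bs_zero {x : ℝ → ι → ℝ} (hx : Base x) : bs x 0 = 0 := by
  rw [bs, hx.zero]; rfl

theorem LSd.base {x : ℝ → ι → ℝ} (hx : Base x) : LSd (A := A) x (bs x) 1 1 where
  zero := bs_zero hx
  clamp t := by rw [bs, bs, hx.clamp]
  cont j := by simp only [bs, mkV_snd]; exact continuous_const
  left τ _ := by simp
  right τ _ := by simp
  chain τ _ := IChain.refl _ _
  lat τ _ := by simp [(Lat ι).zero_mem]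

namespace LSd

variable {x : ℝ → ι → ℝ} {η : ℝ → VV ι} {wl wr : ℝ → W A}

section

variable (h : LSd x η wl wr)

include h

theorem fst {t : ℝ} (hx : Base x) (i : ι) : (η t).1 i = x t i := by
  rw [← h.clamp, ← hx.clamp]
  obtain ⟨h0, h1⟩ := cl_mem t
  rcases h0.eq_or_lt with h2 | h2
  · rw [← h2, h.zero, hx.zero]; rfl
  · have := (h.lat _ ⟨h2, h1⟩).1 i
    rw [VV.sub_fst, LSPath.smul_fst] at this
    simp only [bs, mkV_fst] at this
    linarith

theorem continuous_ht (hx : Base x) (i : ι) : Continuous fun t => ht A i (η t) := by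
  simp only [ht_apply, h.fst hx]
  refine (hx.cont i).add (continuous_finsetSum _ fun j _ => continuous_const.mul (h.cont j))

theorem run_left {Q : W A → Prop} {b : ℝ} (hb : b ∈ Ioc (0 : ℝ) 1) (hQ : Q (wl b)) :
    ∃ a ∈ Ico 0 b, Q (wr a) ∧ (∀ τ ∈ Ioo a b, Q (wl τ) ∧ Q (wr τ)) ∧ (a = 0 ∨ ¬ Q (wl a)) := by
  set S : Set ℝ := {a | a ∈ Ico 0 b ∧ Q (wr a) ∧ ∀ τ ∈ Ioo a b, Q (wl τ) ∧ Q (wr τ)} with hS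
  have key : ∀ τ ∈ Ioc (0 : ℝ) 1, Q (wl τ) → ∃ s ∈ Ico 0 τ, ∀ u ∈ Ico s τ, Q (wl u) ∧ Q (wr u) := by
    intro τ hτ hq
    obtain ⟨l, hl, hl'⟩ := (mem_nhdsLT_iff_exists_Ioo_subset' hτ.1).1 (h.left τ hτ)
    refine ⟨(max l 0 + τ) / 2, ⟨?_, ?_⟩, fun u hu => ?_⟩
    · have := le_max_right l 0; linarith [hτ.1]
    · have := max_lt hl hτ.1; linarith
    · have h1 : l < u := by
        have := max_lt hl hτ.1; have := le_max_left l 0; linarith [hu.1]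
      obtain ⟨h2, h3, -⟩ := hl' ⟨h1, hu.2⟩
      rw [h2, h3]; exact ⟨hq, hq⟩
  have hne : S.Nonempty := by
    obtain ⟨s, hs, hs'⟩ := key b hb hQ
    exact ⟨s, hs, (hs' s ⟨le_rfl, hs.2⟩).2, fun τ hτ => hs' τ ⟨hτ.1.le, hτ.2⟩⟩
  have hbd : BddBelow S := ⟨0, fun a ha => ha.1.1⟩
  set a := sInf S with ha
  have ha0 : 0 ≤ a := le_csInf hne fun a ha => ha.1.1
  have hab : a < b := by
    obtain ⟨s, hs⟩ := hne
    exact (csInf_le hbd hs).trans_lt hs.1.2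
  have haS : a ∈ S := by
    by_contra hcon
    obtain ⟨u, hu, hu'⟩ := (mem_nhdsGT_iff_exists_Ioo_subset' hab).1
      (h.right a ⟨ha0, hab.trans_le hb.2⟩)
    obtain ⟨s, hs, hsu⟩ := exists_lt_of_csInf_lt hne (show sInf S < u from hu)
    have has : a < s := lt_of_le_of_ne (csInf_le hbd hs) (by rintro h; rw [h] at hcon; exact hcon hs)
    obtain ⟨h1, h2, -⟩ := hu' ⟨has, hsu⟩
    have hq : Q (wr a) := h2 ▸ hs.2.1
    refine hcon ⟨⟨ha0, hab⟩, hq, fun τ hτ => ?_⟩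
    rcases lt_or_ge s τ with h3 | h3
    · exact hs.2.2 τ ⟨h3, hτ.2⟩
    · obtain ⟨h4, h5, -⟩ := hu' ⟨hτ.1, h3.trans_lt hsu⟩
      rw [h4, h5]; exact ⟨hq, hq⟩
  refine ⟨a, haS.1, haS.2.1, haS.2.2, ?_⟩
  by_contra! hcon
  obtain ⟨h0, h1⟩ := hcon
  obtain ⟨s, hs, hs'⟩ := key a ⟨lt_of_le_of_ne ha0 (Ne.symm h0), hab.le.trans hb.2⟩ h1
  have : s ∈ S := by
    refine ⟨⟨hs.1, hs.2.trans hab⟩, (hs' s ⟨le_rfl, hs.2⟩).2, fun τ hτ => ?_⟩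
    rcases lt_trichotomy τ a with h3 | h3 | h3
    · exact hs' τ ⟨hτ.1.le, h3⟩
    · rw [h3]; exact ⟨h1, haS.2.1⟩
    · exact haS.2.2 τ ⟨h3, hτ.2⟩
  exact absurd (csInf_le hbd this) (not_le.2 hs.2)

theorem run_right {Q : W A → Prop} {a : ℝ} (ha : a ∈ Ico (0 : ℝ) 1) (hQ : Q (wr a)) :
    ∃ b ∈ Ioc a 1, Q (wl b) ∧ (∀ τ ∈ Ioo a b, Q (wl τ) ∧ Q (wr τ)) ∧ (b = 1 ∨ ¬ Q (wr b)) := by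
  set S : Set ℝ := {b | b ∈ Ioc a 1 ∧ Q (wl b) ∧ ∀ τ ∈ Ioo a b, Q (wl τ) ∧ Q (wr τ)} with hS
  have key : ∀ τ ∈ Ico (0 : ℝ) 1, Q (wr τ) → ∃ s ∈ Ioc τ 1, ∀ u ∈ Ioc τ s, Q (wl u) ∧ Q (wr u) := by
    intro τ hτ hq
    obtain ⟨l, hl, hl'⟩ := (mem_nhdsGT_iff_exists_Ioo_subset' hτ.2).1 (h.right τ hτ)
    have h4 := lt_min hl hτ.2
    refine ⟨(min l 1 + τ) / 2, ⟨?_, ?_⟩, fun u hu => ?_⟩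
    · linarith
    · have := min_le_right l 1; linarith [hτ.2]
    · have h1 : u < l := by
        have := min_le_left l 1; linarith [hu.2]
      obtain ⟨h2, h3, -⟩ := hl' ⟨hu.1, h1⟩
      rw [h2, h3]; exact ⟨hq, hq⟩
  have hne : S.Nonempty := by
    obtain ⟨s, hs, hs'⟩ := key a ha hQ
    exact ⟨s, hs, (hs' s ⟨hs.1, le_rfl⟩).1, fun τ hτ => hs' τ ⟨hτ.1, hτ.2.le⟩⟩
  have hbd : BddAbove S := ⟨1, fun a ha => ha.1.2⟩
  set b := sSup S with hb
  have hb1 : b ≤ 1 := csSup_le hne fun a ha => ha.1.2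
  have hab : a < b := by
    obtain ⟨s, hs⟩ := hne
    exact hs.1.1.trans_le (le_csSup hbd hs)
  have hbS : b ∈ S := by
    by_contra hcon
    obtain ⟨u, hu, hu'⟩ := (mem_nhdsLT_iff_exists_Ioo_subset' hab).1
      (h.left b ⟨ha.1.trans_lt hab, hb1⟩)
    obtain ⟨s, hs, hsu⟩ := exists_lt_of_lt_csSup hne (show u < sSup S from hu)
    have has : s < b := lt_of_le_of_ne (le_csSup hbd hs) (by rintro h; rw [← h] at hcon; exact hcon hs)
    obtain ⟨h1, h2, -⟩ := hu' ⟨hsu, has⟩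
    have hq : Q (wl b) := h1 ▸ hs.2.1
    refine hcon ⟨⟨hab, hb1⟩, hq, fun τ hτ => ?_⟩
    rcases lt_or_ge τ s with h3 | h3
    · exact hs.2.2 τ ⟨hτ.1, h3⟩
    · obtain ⟨h4, h5, -⟩ := hu' ⟨hsu.trans_le h3, hτ.2⟩
      rw [h4, h5]; exact ⟨hq, hq⟩
  refine ⟨b, hbS.1, hbS.2.1, hbS.2.2, ?_⟩
  by_contra! hcon
  obtain ⟨h0, h1⟩ := hcon
  obtain ⟨s, hs, hs'⟩ := key b ⟨ha.1.trans hab.le, lt_of_le_of_ne hb1 h0⟩ h1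
  have : s ∈ S := by
    refine ⟨⟨hab.trans hs.1, hs.2⟩, (hs' s ⟨hs.1, le_rfl⟩).1, fun τ hτ => ?_⟩
    rcases lt_trichotomy τ b with h3 | h3 | h3
    · exact hbS.2.2 τ ⟨hτ.1, h3⟩
    · rw [h3]; exact ⟨hbS.2.1, h1⟩
    · exact hs' τ ⟨h3, hτ.2.le⟩
  exact absurd (le_csSup hbd this) (not_le.2 hs.1)

theorem monotoneOn_ht (hx : Base x) {i : ι} {a b : ℝ} (ha : 0 ≤ a) (hb : b ≤ 1)
    (hP : ∀ τ ∈ Ico a b, Pl i (wr τ)) : MonotoneOn (fun t => ht A i (η t)) (Icc a b) := by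
  refine monotoneOn_of_local_le (h.continuous_ht hx i) fun τ hτ => ?_
  filter_upwards [h.right τ ⟨ha.trans hτ.1, hτ.2.trans_le hb⟩, self_mem_nhdsWithin] with s hs hs'
  rw [← sub_nonneg, ← map_sub, hs.2.2]
  exact ht_smul_nonneg (hP τ hτ) fun j => ht_bs_sub hx (le_of_lt hs') j

theorem antitoneOn_ht (hx : Base x) {i : ι} {a b : ℝ} (ha : 0 ≤ a) (hb : b ≤ 1)
    (hP : ∀ τ ∈ Ico a b, ¬ Pl i (wr τ)) : AntitoneOn (fun t => ht A i (η t)) (Icc a b) := by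
  have := monotoneOn_of_local_le (a := a) (b := b) (h.continuous_ht hx i).neg fun τ hτ => ?_
  · intro s hs t ht hst
    simpa using this hs ht hst
  filter_upwards [h.right τ ⟨ha.trans hτ.1, hτ.2.trans_le hb⟩, self_mem_nhdsWithin] with s hs hs'
  rw [Pi.neg_apply, Pi.neg_apply, neg_le_neg_iff, ← sub_nonpos, ← map_sub, hs.2.2]
  exact ht_smul_nonpos (hP τ hτ) fun j => ht_bs_sub hx (le_of_lt hs') j

theorem isI_wl {τ : ℝ} (hτ : τ ∈ Ioc (0 : ℝ) 1) (i : ι) :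
    IsI A i (wl τ • bs x τ) ↔ IsI A i (η τ) := isI_congr (h.lat τ hτ)

theorem isI_wr {τ : ℝ} (hτ : τ ∈ Ioo (0 : ℝ) 1) (i : ι) :
    IsI A i (wr τ • bs x τ) ↔ IsI A i (η τ) := by
  rw [← (h.chain τ hτ).isI, h.isI_wl ⟨hτ.1, hτ.2.le⟩]

theorem isI_of_flip {τ : ℝ} (hτ : τ ∈ Ioo (0 : ℝ) 1) {i : ι} (hl : ¬ Pl i (wl τ))
    (hr : Pl i (wr τ)) : IsI A i (η τ) :=
  (h.isI_wr hτ i).1 ((h.chain τ hτ).isI_of_flip hl hr)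

theorem end_sub_mem (hx : Base x) : η 1 - bs x 1 ∈ Lat ι := by
  have h1 := h.lat 1 ⟨one_pos, le_rfl⟩
  have h2 := smul_sub_mem_Lat (A := A) (v := bs x 1) (fun j => by rw [ht_bs]; exact hx.one j) (wl 1)
  simpa using (Lat ι).add_mem h1 h2

theorem isI_one (hx : Base x) (i : ι) : IsI A i (η 1) :=
  (isI_congr (h.end_sub_mem hx)).1 (by rw [IsI, ht_bs]; exact hx.one i)

theorem isI_zero (i : ι) : IsI A i (η 0) := ⟨0, by simp [h.zero]⟩

/-- Local minima of the height functions are integral. -/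
theorem isI_of_min (hx : Base x) {i : ι} {q b t : ℝ} (hq : 0 ≤ q) (hb : b ≤ 1) (htm : t ∈ Icc q b)
    (hmin : ∀ s ∈ Icc q b, ht A i (η t) ≤ ht A i (η s)) :
    ht A i (η t) = ht A i (η q) ∨ ht A i (η t) = ht A i (η b) ∨ IsI A i (η t) := by
  rcases htm.1.eq_or_lt with rfl | hqt
  · exact Or.inl rfl
  rcases htm.2.eq_or_lt with rfl | htb
  · exact Or.inr (Or.inl rfl)
  by_cases hl : Pl i (wl t)
  · obtain ⟨a, ha, h1, h2, h3⟩ := h.run_left ⟨hq.trans_lt hqt, htb.le.trans hb⟩ hl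
    have hm := h.monotoneOn_ht hx ha.1 (htb.le.trans hb) (i := i) (fun τ hτ => by
      rcases hτ.1.eq_or_lt with rfl | h4
      · exact h1
      · exact (h2 τ ⟨h4, hτ.2⟩).2)
    rcases le_or_gt a q with h5 | h5
    · left
      exact le_antisymm (hmin q ⟨le_rfl, hqt.le.trans htb.le⟩)
        (hm ⟨h5, hqt.le⟩ ⟨ha.2.le, le_rfl⟩ hqt.le)
    · have h6 : ht A i (η t) = ht A i (η a) :=
        le_antisymm (hmin a ⟨h5.le, ha.2.le.trans htb.le⟩)
        (hm ⟨le_rfl, ha.2.le⟩ ⟨ha.2.le, le_rfl⟩ ha.2.le)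
      have h7 := h.isI_of_flip ⟨hq.trans_lt h5, ha.2.trans (htb.trans_le hb)⟩
        (h3.resolve_left (hq.trans_lt h5).ne') h1
      right; right
      rw [IsI, h6]; exact h7
  · by_cases hr : Pl i (wr t)
    · exact Or.inr (Or.inr (h.isI_of_flip ⟨hq.trans_lt hqt, htb.trans_le hb⟩ hl hr))
    obtain ⟨c, hc, h1, h2, h3⟩ := h.run_right (Q := fun w => ¬ Pl i w)
      ⟨hq.trans hqt.le, htb.trans_le hb⟩ hr
    have hm := h.antitoneOn_ht hx (hq.trans hqt.le) hc.2 (i := i) (fun τ hτ => by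
      rcases hτ.1.eq_or_lt with rfl | h4
      · exact hr
      · exact (h2 τ ⟨h4, hτ.2⟩).2)
    rcases le_or_gt b c with h5 | h5
    · right; left
      exact le_antisymm (hmin b ⟨htm.1.trans htm.2, le_rfl⟩)
        (hm ⟨le_rfl, hc.1.le⟩ ⟨htb.le, h5⟩ htb.le)
    · have h6 : ht A i (η t) = ht A i (η c) :=
        le_antisymm (hmin c ⟨htm.1.trans hc.1.le, h5.le⟩)
        (hm ⟨le_rfl, hc.1.le⟩ ⟨hc.1.le, le_rfl⟩ hc.1.le)
      have h7 := h.isI_of_flip ⟨hq.trans_lt (hqt.trans hc.1), h5.trans_le hb⟩ h1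
        (not_not.1 (h3.resolve_left (h5.trans_le hb).ne))
      right; right
      rw [IsI, h6]; exact h7

end

end LSd

end LS

section LS

variable {ι : Type*} [Fintype ι] [DecidableEq ι] {A : ι → ι → ℤ} [hA : IsGCM A]

/-- The lowering operator. -/
noncomputable def F (A : ι → ι → ℤ) (i : ι) (η : ℝ → VV ι) (t : ℝ) : VV ι :=
  η t - amt (fun s => ht A i (η s)) t • rt i

/-- The lowering operator does not kill `η`. -/
def Dn (A : ι → ι → ℤ) (i : ι) (η : ℝ → VV ι) : Prop :=
  lo (fun s => ht A i (η s)) 0 + 1 ≤ ht A i (η 1)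

theorem ht_rt_self (i : ι) : ht A i (rt i) = 2 := by
  rw [ht_rt, hA.diag]; norm_num

theorem ht_F (i : ι) (η : ℝ → VV ι) (t : ℝ) :
    ht A i (F A i η t) = ht A i (η t) - 2 * amt (fun s => ht A i (η s)) t := by
  rw [F, map_sub, map_smul, ht_rt_self, smul_eq_mul, mul_comm]

theorem reflect_sub (i : ι) (u v : VV ι) (c : ℝ) :
    (u - (ht A i u - c) • rt i) - (v - (ht A i v - c) • rt i) = sg A i • (u - v) := by
  rw [sg_smul, map_sub]; module

theorem clip_cl {a b : ℝ} (ha : 0 ≤ a) (hab : a ≤ b) (hb : b ≤ 1) (t : ℝ) :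
    max a (min (cl t) b) = max a (min t b) := by
  unfold cl
  rcases le_total t 0 with h | h
  · rw [min_eq_left (h.trans zero_le_one), max_eq_left h, min_eq_left (ha.trans hab),
      min_eq_left (h.trans (ha.trans hab)), max_eq_left ha, max_eq_left (h.trans ha)]
  · rcases le_total t 1 with h1 | h1
    · rw [min_eq_left h1, max_eq_right h]
    · rw [min_eq_right h1, max_eq_right zero_le_one, min_eq_right hb, min_eq_right (hb.trans h1)]

theorem clip_before {a b t : ℝ} (h : t ≤ a) : max a (min t b) = a :=
  max_eq_left ((min_le_left _ _).trans h)

theorem clip_mid {a b t : ℝ} (h : a ≤ t) (h' : t ≤ b) : max a (min t b) = t := by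
  rw [min_eq_left h', max_eq_right h]

theorem clip_after {a b t : ℝ} (hab : a ≤ b) (h' : b ≤ t) : max a (min t b) = b := by
  rw [min_eq_right h', max_eq_right hab]

namespace LSd

variable {x : ℝ → ι → ℝ} {η : ℝ → VV ι} {wl wr : ℝ → W A}

theorem modify (h : LSd x η wl wr) (hx : Base x) {i : ι} {a b : ℝ} (ha : 0 ≤ a) (hab : a < b)
    (hb : b ≤ 1)
    (hia : IsI A i (η a)) (hib : IsI A i (η b))
    (hin : ∀ τ ∈ Ioo a b, IChain (bs x τ) (sg A i * wl τ) (sg A i * wr τ))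
    (hl : 0 < a → IChain (bs x a) (wl a) (sg A i * wr a))
    (hr : b < 1 → IChain (bs x b) (sg A i * wl b) (wr b)) :
    LSd x (fun t => η t - (ht A i (η (max a (min t b))) - ht A i (η a)) • rt i)
      (fun t => if a < t ∧ t ≤ b then sg A i * wl t else wl t)
      (fun t => if a ≤ t ∧ t < b then sg A i * wr t else wr t) where
  zero := by simp [h.zero, clip_before ha]
  clamp t := by simp only [h.clamp, clip_cl ha hab.le hb]
  cont j := by
    simp only [VV.sub_snd, VV.smul_snd]
    have := (h.continuous_ht hx i).comp
      (show Continuous fun t : ℝ => max a (min t b) by fun_prop)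
    exact (h.cont j).sub ((this.sub continuous_const).mul continuous_const)
  left τ hτ := by
    have h1 := h.left τ hτ
    rcases le_or_gt τ a with h2 | h2
    · filter_upwards [h1, self_mem_nhdsWithin] with s hs hs'
      have hs' : s < τ := hs'
      rw [if_neg (by rintro ⟨_, _⟩; linarith), if_neg (by rintro ⟨_, _⟩; linarith),
        if_neg (by rintro ⟨_, _⟩; linarith), clip_before h2, clip_before (hs'.le.trans h2)]
      simpa using hs
    rcases le_or_gt τ b with h3 | h3
    · filter_upwards [h1, Ioo_mem_nhdsLT h2] with s hs hs'
      rw [if_pos ⟨hs'.1, hs'.2.le.trans h3⟩, if_pos ⟨h2, h3⟩,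
        if_pos ⟨hs'.1.le, hs'.2.trans_le h3⟩, clip_mid h2.le h3, clip_mid hs'.1.le (hs'.2.le.trans h3), reflect_sub,
        hs.1, hs.2.1, hs.2.2, mul_smul]
      exact ⟨rfl, rfl, rfl⟩
    · filter_upwards [h1, Ioo_mem_nhdsLT h3] with s hs hs'
      rw [if_neg (by rintro ⟨_, _⟩; linarith [hs'.1]), if_neg (by rintro ⟨_, _⟩; linarith [hs'.1]),
        if_neg (by rintro ⟨_, _⟩; linarith [hs'.1]), clip_after hab.le h3.le,
        clip_after hab.le hs'.1.le]
      simpa using hs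
  right τ hτ := by
    have h1 := h.right τ hτ
    rcases lt_or_ge τ a with h2 | h2
    · filter_upwards [h1, Ioo_mem_nhdsGT h2] with s hs hs'
      rw [if_neg (by rintro ⟨_, _⟩; linarith [hs'.2]), if_neg (by rintro ⟨_, _⟩; linarith [hs'.2]),
        if_neg (by rintro ⟨_, _⟩; linarith [hs'.2]), clip_before h2.le, clip_before hs'.2.le]
      simpa using hs
    rcases lt_or_ge τ b with h3 | h3
    · filter_upwards [h1, Ioo_mem_nhdsGT h3] with s hs hs'
      rw [if_pos ⟨h2.trans_lt hs'.1, hs'.2.le⟩, if_pos ⟨h2, h3⟩,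
        if_pos ⟨h2.trans hs'.1.le, hs'.2⟩, clip_mid h2 h3.le, clip_mid (h2.trans hs'.1.le) hs'.2.le, reflect_sub,
        hs.1, hs.2.1, hs.2.2, mul_smul]
      exact ⟨rfl, rfl, rfl⟩
    · filter_upwards [h1, self_mem_nhdsWithin] with s hs hs'
      have hs' : τ < s := hs'
      rw [if_neg (by rintro ⟨_, _⟩; linarith), if_neg (by rintro ⟨_, _⟩; linarith),
        if_neg (by rintro ⟨_, _⟩; linarith), clip_after hab.le h3,
        clip_after hab.le (h3.trans hs'.le)]
      simpa using hs
  chain τ hτ := by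
    rcases lt_trichotomy τ a with h2 | rfl | h2
    · rw [if_neg (by rintro ⟨_, _⟩; linarith), if_neg (by rintro ⟨_, _⟩; linarith)]
      exact h.chain τ hτ
    · rw [if_neg (by rintro ⟨_, _⟩; linarith), if_pos ⟨le_rfl, hab⟩]
      exact hl hτ.1
    rcases lt_trichotomy τ b with h3 | rfl | h3
    · rw [if_pos ⟨h2, h3.le⟩, if_pos ⟨h2.le, h3⟩]
      exact hin τ ⟨h2, h3⟩
    · rw [if_pos ⟨h2, le_rfl⟩, if_neg (by rintro ⟨_, _⟩; linarith)]
      exact hr hτ.2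
    · rw [if_neg (by rintro ⟨_, _⟩; linarith), if_neg (by rintro ⟨_, _⟩; linarith)]
      exact h.chain τ hτ
  lat τ hτ := by
    obtain ⟨m, hm⟩ := hia
    obtain ⟨n, hn⟩ := hib
    rcases le_or_gt τ a with h2 | h2
    · rw [if_neg (by rintro ⟨_, _⟩; linarith), clip_before h2]
      simpa using h.lat τ hτ
    rcases le_or_gt τ b with h3 | h3
    · rw [if_pos ⟨h2, h3⟩, clip_mid h2.le h3, mul_smul]
      have h4 : η τ - (ht A i (η τ) - ht A i (η a)) • rt i - sg A i • (wl τ • bs x τ) =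
          sg A i • (η τ - wl τ • bs x τ) + ht A i (η a) • rt i := by
        rw [smul_sub, sg_smul i (η τ), sub_smul]; abel
      rw [h4]
      exact (Lat ι).add_mem (smul_mem_Lat (h.lat τ hτ) _) (smul_rt_mem_Lat ⟨m, hm⟩ (rt_mem_Lat i))
    · rw [if_neg (by rintro ⟨_, _⟩; linarith), clip_after hab.le h3.le, sub_right_comm]
      exact (Lat ι).sub_mem (h.lat τ hτ)
        (smul_rt_mem_Lat ⟨n - m, by rw [hm, hn]; push_cast; ring⟩ (rt_mem_Lat i))

theorem exists_min (h : LSd x η wl wr) (hx : Base x) (i : ι) : ∃ m : ℤ,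
    lo (fun s => ht A i (η s)) 0 = m ∧ m ≤ 0 ∧ (∃ t ∈ Icc (0 : ℝ) 1, ht A i (η t) = m) ∧
    ∀ t ∈ Icc (0 : ℝ) 1, (m : ℝ) ≤ ht A i (η t) := by
  obtain ⟨t, htm, h1, h2⟩ := exists_lo (h.continuous_ht hx i) zero_le_one
  have h3 : IsI A i (η t) := by
    rcases h.isI_of_min hx le_rfl le_rfl htm (fun s hs => by rw [h1]; exact h2 s hs) with
      h3 | h3 | h3
    · rw [IsI, h3]; exact h.isI_zero i
    · rw [IsI, h3]; exact h.isI_one hx i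
    · exact h3
  obtain ⟨m, hm⟩ := h3
  have h4 : lo (fun s => ht A i (η s)) 0 = m := by rw [← h1, hm]
  refine ⟨m, h4, ?_, ⟨t, htm, hm⟩, fun s hs => h4 ▸ h2 s hs⟩
  have := h2 0 ⟨le_rfl, zero_le_one⟩
  rw [h4, h.zero, map_zero] at this
  exact_mod_cast this

/-- A continuous function attaining a value has a last time at which it does so. -/
theorem exists_last {f : ℝ → ℝ} (hf : Continuous f) {a b c t : ℝ} (ht : t ∈ Icc a b)
    (h : f t = c) : ∃ p ∈ Icc a b, f p = c ∧ ∀ s ∈ Icc a b, f s = c → s ≤ p := by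
  have hc : IsCompact (Icc a b ∩ {t | f t = c}) :=
    isCompact_Icc.inter_right (isClosed_eq hf continuous_const)
  obtain ⟨p, hp, hp'⟩ := hc.exists_isGreatest ⟨t, ht, h⟩
  exact ⟨p, hp.1, hp.2, fun s hs hs' => hp' ⟨hs, hs'⟩⟩

theorem exists_first {f : ℝ → ℝ} (hf : Continuous f) {a b c t : ℝ} (ht : t ∈ Icc a b)
    (h : f t = c) : ∃ p ∈ Icc a b, f p = c ∧ ∀ s ∈ Icc a b, f s = c → p ≤ s := by
  have hc : IsCompact (Icc a b ∩ {t | f t = c}) :=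
    isCompact_Icc.inter_right (isClosed_eq hf continuous_const)
  obtain ⟨p, hp, hp'⟩ := hc.exists_isLeast ⟨t, ht, h⟩
  exact ⟨p, hp.1, hp.2, fun s hs hs' => hp' ⟨hs, hs'⟩⟩

theorem not_isI_of_Ioo {i : ι} {v : VV ι} {m : ℤ} (h1 : m < ht A i v) (h2 : ht A i v < m + 1) :
    ¬ IsI A i v := by
  rintro ⟨n, hn⟩
  rw [hn] at h1 h2
  have h3 : m < n := by exact_mod_cast h1
  have h4 : n < m + 1 := by exact_mod_cast h2
  omega

theorem form_F_eq {f : ℝ → ℝ} {m p q : ℝ} (h : Form f m p q) (t : ℝ) :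
    amt f t = f (max p (min t q)) - f p := by
  have hq := h.q_le
  have hpq := h.lt
  rw [← amt_cl, ← clip_cl h.p_nonneg hpq.le hq]
  obtain ⟨h0, h1⟩ := cl_mem t
  generalize cl t = t at *
  rcases le_total t p with h2 | h2
  · rw [h.amt_before h0 h2, clip_before h2, sub_self]
  rcases le_total t q with h3 | h3
  · rw [h.amt_mid ⟨h2, h3⟩, clip_mid h2 h3, h.at_p]
  · rw [h.amt_after ⟨h3, h1⟩, clip_after hpq.le h3, h.at_p, h.at_q]; ring

theorem lower (h : LSd x η wl wr) (hx : Base x) {i : ι} (hD : Dn A i η) :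
    ∃ wl' wr' m p q, Form (fun s => ht A i (η s)) m p q ∧
      LSd x (F A i η) (wl' : ℝ → W A) wr' := by
  obtain ⟨m, hlo, hm0, ⟨t0, ht0, hmt⟩, hmin⟩ := h.exists_min hx i
  have hcont := h.continuous_ht hx i
  rw [Dn, hlo] at hD
  obtain ⟨p, hp, hpm, hplast⟩ := exists_last hcont ht0 hmt
  have hiv : ∃ u ∈ Icc p 1, ht A i (η u) = m + 1 :=
    intermediate_value_Icc hp.2 hcont.continuousOn ⟨by simp only [hpm]; linarith, hD⟩
  obtain ⟨u, hu, hum⟩ := hiv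
  obtain ⟨q, hq, hqm, hqfirst⟩ := exists_first hcont hu hum
  have hpq : p < q := lt_of_le_of_ne hq.1 (by rintro rfl; linarith)
  have hmid1 : ∀ s ∈ Ioo p q, (m : ℝ) < ht A i (η s) := fun s hs =>
    lt_of_le_of_ne (hmin s ⟨hp.1.trans hs.1.le, hs.2.le.trans hq.2⟩) fun h1 =>
      absurd (hplast s ⟨hp.1.trans hs.1.le, hs.2.le.trans hq.2⟩ h1.symm) (not_le.2 hs.1)
  have hmid2 : ∀ s ∈ Ioo p q, ht A i (η s) < m + 1 := fun s hs => by
    by_contra! hc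
    obtain ⟨v, hv, hvm⟩ := intermediate_value_Icc hs.1.le hcont.continuousOn
      (show (m : ℝ) + 1 ∈ Icc _ _ from ⟨by simp only [hpm]; linarith, hc⟩)
    exact absurd (hqfirst v ⟨hv.1, hv.2.trans (hs.2.le.trans hq.2)⟩ hvm)
      (not_le.2 (hv.2.trans_lt hs.2))
  have hni : ∀ s ∈ Ioo p q, ¬ IsI A i (η s) := fun s hs => not_isI_of_Ioo (hmid1 s hs) (hmid2 s hs)
  have hq0 : q ∈ Ioc (0 : ℝ) 1 := ⟨hp.1.trans_lt hpq, hq.2⟩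
  have hPq : Pl i (wl q) := by
    by_contra hcon
    obtain ⟨a, ha, h1, h2, h3⟩ := h.run_left (Q := fun w => ¬ Pl i w) hq0 hcon
    have hm := h.antitoneOn_ht hx ha.1 hq.2 (i := i) (fun τ hτ => by
      rcases hτ.1.eq_or_lt with rfl | h4
      · exact h1
      · exact (h2 τ ⟨h4, hτ.2⟩).2)
    have h4 : max a p < q := max_lt ha.2 hpq
    have h5 : max a p < (max a p + q) / 2 := by linarith
    have h6 : (max a p + q) / 2 < q := by linarith
    have h7 := hm ⟨(le_max_left a p).trans h5.le, h6.le⟩ ⟨ha.2.le, le_rfl⟩ h6.le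
    have h8 := hmid2 _ ⟨(le_max_right a p).trans_lt h5, h6⟩
    simp only [hqm] at h7
    linarith
  obtain ⟨a, ha, h1, h2, h3⟩ := h.run_left hq0 hPq
  have hall : ∀ τ ∈ Ico a q, Pl i (wr τ) := fun τ hτ => by
    rcases hτ.1.eq_or_lt with rfl | h4
    · exact h1
    · exact (h2 τ ⟨h4, hτ.2⟩).2
  have hmono := h.monotoneOn_ht hx ha.1 hq.2 hall
  have hap : a ≤ p := by
    by_contra! hcon
    refine hni a ⟨hcon, ha.2⟩ ?_
    exact h.isI_of_flip ⟨hp.1.trans_lt hcon, ha.2.trans_le hq.2⟩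
      (h3.resolve_left (hp.1.trans_lt hcon).ne') h1
  have ham : ht A i (η a) = m := le_antisymm
    ((hmono ⟨le_rfl, ha.2.le⟩ ⟨hap, hpq.le⟩ hap).trans hpm.le) (hmin a ⟨ha.1, ha.2.le.trans hq.2⟩)
  have hform : Form (fun s => ht A i (η s)) m a q := by
    refine ⟨ha.1, ha.2, hq.2, fun t htt => hmin t ⟨htt.1, htt.2.trans (ha.2.le.trans hq.2)⟩, ham,
      hmono, hqm, fun t htt => ?_⟩
    obtain ⟨v, hv, hv1, hv2⟩ := exists_lo hcont hq.2
    have h5 : (m : ℝ) + 1 ≤ ht A i (η v) := by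
      have h_int : IsI A i (η v) := by
        rcases h.isI_of_min hx (hp.1.trans hq.1) le_rfl hv (fun s hs => by rw [hv1]; exact hv2 s hs)
          with h6 | h6 | h6
        · rw [IsI, h6, hqm]; exact ⟨m + 1, by push_cast; ring⟩
        · rw [IsI, h6]; exact h.isI_one hx i
        · exact h6
      by_contra! hcon
      refine not_isI_of_Ioo (lt_of_le_of_ne (hmin v ⟨hq0.1.le.trans hv.1, hv.2⟩) fun h6 => ?_)
        hcon h_int
      exact absurd (hplast v ⟨hq0.1.le.trans hv.1, hv.2⟩ h6.symm) (not_le.2 (hpq.trans_le hv.1))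
    exact h5.trans (hv1.le.trans (hv2 t htt))
  have hF : F A i η = fun t => η t - (ht A i (η (max a (min t q))) - ht A i (η a)) • rt i := by
    funext t
    rw [F, form_F_eq hform]
  have hmod := h.modify hx ha.1 ha.2 hq.2 ⟨m, ham⟩ ⟨m + 1, by rw [hqm]; push_cast; ring⟩
    (fun τ hτ => (h.chain τ ⟨ha.1.trans_lt hτ.1, hτ.2.trans_le hq.2⟩).sg_mul_of_Pl
      (h2 τ hτ).1 (h2 τ hτ).2) (fun h0 => by
      have h4 : a ∈ Ioo (0 : ℝ) 1 := ⟨h0, ha.2.trans_le hq.2⟩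
      have := (h.chain a h4).upW (k := i) ((h.isI_wr h4 i).2 ⟨m, ham⟩)
      rwa [upW_neg (h3.resolve_left h0.ne'), upW_pos h1] at this) (fun h0 => by
      refine (IChain.of_Pl hPq ((h.isI_wl hq0 i).2 ?_)).trans (h.chain q ⟨hq0.1, h0⟩)
      exact ⟨m + 1, by rw [hqm]; push_cast; ring⟩)
  exact ⟨_, _, m, a, q, hform, hF ▸ hmod⟩

theorem lift (h : LSd x η wl wr) (hx : Base x) {i : ι} (hD : lo (fun s => ht A i (η s)) 0 < 0) :
    ∃ η' wl' wr', LSd x η' (wl' : ℝ → W A) wr' ∧ Dn A i η' ∧ F A i η' = η ∧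
      η' 1 = η 1 + rt i := by
  obtain ⟨m, hlo, hm0, ⟨t0, ht0, hmt⟩, hmin⟩ := h.exists_min hx i
  have hcont := h.continuous_ht hx i
  rw [hlo] at hD
  have hm1 : m + 1 ≤ 0 := by
    have : m < 0 := by exact_mod_cast hD
    omega
  have hm1' : (m : ℝ) + 1 ≤ 0 := by exact_mod_cast hm1
  have hz : ht A i (η 0) = 0 := by rw [h.zero, map_zero]
  obtain ⟨b, hb, hbm, hbfirst⟩ := exists_first hcont ht0 hmt
  obtain ⟨u, hu, hum⟩ : ∃ u ∈ Icc 0 b, ht A i (η u) = m + 1 :=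
    intermediate_value_Icc' hb.1 hcont.continuousOn ⟨by simp only [hbm]; linarith,
      by simp only [hz]; linarith⟩
  obtain ⟨a, ha, ham, halast⟩ := exists_last hcont hu hum
  have hab : a < b := lt_of_le_of_ne ha.2 (by rintro rfl; linarith)
  have hlt : ∀ s ∈ Ico 0 b, (m : ℝ) < ht A i (η s) := fun s hs =>
    lt_of_le_of_ne (hmin s ⟨hs.1, hs.2.le.trans hb.2⟩) fun h1 =>
      absurd (hbfirst s ⟨hs.1, hs.2.le.trans hb.2⟩ h1.symm) (not_le.2 hs.2)
  have hmid2 : ∀ s ∈ Ioo a b, ht A i (η s) < m + 1 := fun s hs => by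
    by_contra! hc
    obtain ⟨v, hv, hvm⟩ := intermediate_value_Icc' hs.2.le hcont.continuousOn
      (show (m : ℝ) + 1 ∈ Icc _ _ from ⟨by simp only [hbm]; linarith, hc⟩)
    exact absurd (halast v ⟨ha.1.trans (hs.1.le.trans hv.1), hv.2⟩ hvm)
      (not_le.2 (hs.1.trans_le hv.1))
  have hni : ∀ s ∈ Ioo a b, ¬ IsI A i (η s) := fun s hs =>
    not_isI_of_Ioo (hlt s ⟨ha.1.trans hs.1.le, hs.2⟩) (hmid2 s hs)
  have ha0 : a ∈ Ico (0 : ℝ) 1 := ⟨ha.1, hab.trans_le hb.2⟩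
  have hPa : ¬ Pl i (wr a) := by
    intro hcon
    obtain ⟨c, hc, h1, h2, h3⟩ := h.run_right ha0 hcon
    have hm := h.monotoneOn_ht hx ha.1 hc.2 (i := i) (fun τ hτ => by
      rcases hτ.1.eq_or_lt with rfl | h4
      · exact hcon
      · exact (h2 τ ⟨h4, hτ.2⟩).2)
    have h4 : a < min c b := lt_min hc.1 hab
    have h5 : a < (a + min c b) / 2 := by linarith
    have h6 : (a + min c b) / 2 < min c b := by linarith
    have h7 := hm ⟨le_rfl, hc.1.le⟩ ⟨h5.le, h6.le.trans (min_le_left _ _)⟩ h5.le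
    have h8 := hmid2 _ ⟨h5, h6.trans_le (min_le_right _ _)⟩
    simp only [ham] at h7
    linarith
  obtain ⟨c, hc, h1, h2, h3⟩ := h.run_right (Q := fun w => ¬ Pl i w) ha0 hPa
  have hall : ∀ τ ∈ Ico a c, ¬ Pl i (wr τ) := fun τ hτ => by
    rcases hτ.1.eq_or_lt with rfl | h4
    · exact hPa
    · exact (h2 τ ⟨h4, hτ.2⟩).2
  have hanti := h.antitoneOn_ht hx ha.1 hc.2 hall
  have hbc : b ≤ c := by
    by_contra! hcon
    refine hni c ⟨hc.1, hcon⟩ ?_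
    exact h.isI_of_flip ⟨ha.1.trans_lt hc.1, hcon.trans_le hb.2⟩ h1
      (not_not.1 (h3.resolve_left (hcon.trans_le hb.2).ne))
  have hcm : ht A i (η c) = m := le_antisymm
    ((hanti ⟨hab.le, hbc⟩ ⟨hc.1.le, le_rfl⟩ hbc).trans hbm.le)
    (hmin c ⟨ha.1.trans hc.1.le, hc.2⟩)
  have hc0 : c ∈ Ioc (0 : ℝ) 1 := ⟨ha.1.trans_lt hc.1, hc.2⟩
  have hmod := h.modify hx (i := i) ha.1 hc.1 hc.2 ⟨m + 1, by rw [ham]; push_cast; ring⟩ ⟨m, hcm⟩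
    (fun τ hτ => (h.chain τ ⟨ha.1.trans_lt hτ.1, hτ.2.trans_le hc.2⟩).sg_mul_of_not_Pl
      (h2 τ hτ).1 (h2 τ hτ).2) (fun h0 => by
      have h4 : a ∈ Ioo (0 : ℝ) 1 := ⟨h0, ha0.2⟩
      refine (h.chain a h4).trans (IChain.of_not_Pl hPa ((h.isI_wr h4 i).2 ?_))
      exact ⟨m + 1, by rw [ham]; push_cast; ring⟩) (fun h0 => by
      have h4 : c ∈ Ioo (0 : ℝ) 1 := ⟨hc0.1, h0⟩
      have := (h.chain c h4).loW (k := i) ((h.isI_wr h4 i).2 ⟨m, hcm⟩)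
      rwa [loW_neg h1, loW_pos (not_not.1 (h3.resolve_left h0.ne))] at this)
  set η' : ℝ → VV ι := fun t => η t - (ht A i (η (max a (min t c))) - ht A i (η a)) • rt i with hη'
  have hη'h : ∀ t, ht A i (η' t) =
      ht A i (η t) - 2 * (ht A i (η (max a (min t c))) - ht A i (η a)) := fun t => by
    simp only [hη', map_sub, map_smul, ht_rt_self, smul_eq_mul, mul_comm]
  have hform : Form (fun s => ht A i (η' s)) (m + 1) a c := by
    refine ⟨ha.1, hc.1, hc.2, fun t htt => ?_, ?_, fun s hs t htt hst => ?_, ?_, fun t htt => ?_⟩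
    · simp only [hη'h, clip_before htt.2]
      obtain ⟨v, hv, hvmin⟩ := isCompact_Icc.exists_isMinOn (nonempty_Icc.2 ha.1)
        hcont.continuousOn (s := Icc 0 a)
      have hvt : ht A i (η v) ≤ ht A i (η t) := hvmin htt
      have h_int : IsI A i (η v) := by
        rcases h.isI_of_min hx le_rfl ha0.2.le hv (fun s hs => hvmin hs) with h6 | h6 | h6
        · rw [IsI, h6]; exact h.isI_zero i
        · rw [IsI, h6, ham]; exact ⟨m + 1, by push_cast; ring⟩
        · exact h6
      have : (m : ℝ) + 1 ≤ ht A i (η v) := by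
        by_contra! hcon
        exact not_isI_of_Ioo (hlt v ⟨hv.1, hv.2.trans_lt hab⟩) hcon h_int
      linarith
    · simp only [hη'h, clip_before le_rfl, ham]; ring
    · have := hanti hs htt hst
      simp only [hη'h, clip_mid hs.1 hs.2, clip_mid htt.1 htt.2, ham] at this ⊢
      linarith
    · simp only [hη'h, clip_after hc.1.le le_rfl, ham, hcm]; ring
    · simp only [hη'h, clip_after hc.1.le htt.1, ham, hcm]
      linarith [hmin t ⟨hc0.1.le.trans htt.1, htt.2⟩]
  refine ⟨η', _, _, hmod, ?_, ?_, ?_⟩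
  · rw [Dn, hform.lo_before le_rfl hform.p_nonneg]
    exact hform.after 1 ⟨hc.2, le_rfl⟩
  · funext t
    have h4 := form_F_eq hform t
    have h5 : max a (min (max a (min t c)) c) = max a (min t c) :=
      clip_mid (le_max_left _ _) (max_le hc.1.le (min_le_right _ _))
    rw [F, h4, hη'h, hη'h, h5, clip_before le_rfl]
    simp only [hη']
    module
  · simp only [hη', clip_after hc.1.le hc.2, ham, hcm]
    module

end LSd

end LS

section LS

variable {ι : Type*} [Fintype ι] [DecidableEq ι] {A : ι → ι → ℤ} [hA : IsGCM A]

namespace LSd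

variable {x : ℝ → ι → ℝ} {η : ℝ → VV ι} {wl wr : ℝ → W A}

theorem antitoneOn_snd (h : LSd x η wl wr) (hx : Base x) (j : ι) :
    AntitoneOn (fun t => (η t).2 j) (Icc 0 1) := by
  have := monotoneOn_of_local_le (a := 0) (b := 1) (h.cont j).neg fun τ hτ => ?_
  · intro s hs t ht hst
    simpa using this hs ht hst
  filter_upwards [h.right τ hτ, self_mem_nhdsWithin] with s hs hs'
  have h1 := smul_snd_nonpos (A := A) (wr τ) (fun j => ht_bs_sub hx (le_of_lt hs') j) j
  rw [← hs.2.2] at h1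
  simp only [bs, VV.sub_snd, mkV_snd, Pi.zero_apply, sub_zero] at h1
  simpa using h1

theorem snd_nonpos (h : LSd x η wl wr) (hx : Base x) (j : ι) {t : ℝ} (ht : t ∈ Icc (0 : ℝ) 1) :
    (η t).2 j ≤ 0 := by
  have := h.antitoneOn_snd hx j ⟨le_rfl, zero_le_one⟩ ht ht.1
  simpa [h.zero] using this

theorem eq_base_of_wr (h : LSd x η wl wr) (hx : Base x) (h1 : wr 0 = 1) : η = bs x := by
  obtain ⟨b, hb, h2, h3, h4⟩ := h.run_right (Q := fun w => w = 1) ⟨le_rfl, one_pos⟩ h1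
  have hchain : ∀ {p : VV ι} {v : W A}, IChain p 1 v → v = 1 := by
    intro p v hv
    induction hv with
    | refl => rfl
    | tail _ he ih =>
      obtain ⟨-, -, -, -, -, h5, -⟩ := he
      rw [ih, len_one] at h5; omega
  have hb1 : b = 1 := by
    by_contra hcon
    refine h4.resolve_left hcon (hchain (p := bs x b) ?_)
    rw [← h2]; exact h.chain b ⟨hb.1, lt_of_le_of_ne hb.2 hcon⟩
  subst hb1
  have hall : ∀ τ ∈ Ico (0 : ℝ) 1, wr τ = 1 := fun τ hτ => by
    rcases hτ.1.eq_or_lt with rfl | h5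
    · exact h1
    · exact (h3 τ ⟨h5, hτ.2⟩).2
  have hzero : ∀ t ∈ Icc (0 : ℝ) 1, ∀ j, (η t).2 j = 0 := fun t ht j => by
    refine le_antisymm (h.snd_nonpos hx j ht) ?_
    have := le_of_local_le (h.cont j) ht.1 fun τ hτ => ?_
    · simpa [h.zero] using this
    have hτ' : τ ∈ Ico (0 : ℝ) 1 := ⟨hτ.1, hτ.2.trans_le ht.2⟩
    filter_upwards [h.right τ hτ'] with s hs
    have h6 := congrArg (fun v : VV ι => v.2 j) hs.2.2
    rw [hall τ hτ', one_smul] at h6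
    simp only [bs, VV.sub_snd, mkV_snd, Pi.zero_apply, sub_zero] at h6
    linarith
  funext t
  refine VV.ext (fun i => by rw [h.fst hx]; rfl) fun j => ?_
  rw [← h.clamp, hzero _ (cl_mem t)]; rfl

theorem eq_base (h : LSd x η wl wr) (hx : Base x)
    (hpos : ∀ i, ∀ t ∈ Icc (0 : ℝ) 1, 0 ≤ ht A i (η t)) : η = bs x := by
  obtain ⟨n, hn⟩ : ∃ n, len (wr 0) = n := ⟨_, rfl⟩
  induction n generalizing wl wr with
  | zero => exact h.eq_base_of_wr hx (len_eq_zero.1 hn)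
  | succ n ih =>
    obtain ⟨i, hi⟩ := exists_not_Pl (w := wr 0) (by intro h; rw [h, len_one] at hn; simp at hn)
    obtain ⟨c, hc, h1, h2, h3⟩ := h.run_right (Q := fun w => ¬ Pl i w) ⟨le_rfl, one_pos⟩ hi
    have hanti := h.antitoneOn_ht hx le_rfl hc.2 (i := i) (fun τ hτ => by
      rcases hτ.1.eq_or_lt with rfl | h4
      · exact hi
      · exact (h2 τ ⟨h4, hτ.2⟩).2)
    have hflat : ∀ t ∈ Icc 0 c, ht A i (η t) = 0 := fun t ht => by
      refine le_antisymm ?_ (hpos i t ⟨ht.1, ht.2.trans hc.2⟩)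
      have := hanti ⟨le_rfl, hc.1.le⟩ ht ht.1
      simpa [h.zero] using this
    have hc0 := hflat c ⟨hc.1.le, le_rfl⟩
    have hmod := h.modify hx (i := i) le_rfl hc.1 hc.2 (h.isI_zero i) ⟨0, by simp [hc0]⟩
      (fun τ hτ => (h.chain τ ⟨hτ.1, hτ.2.trans_le hc.2⟩).sg_mul_of_not_Pl
        (h2 τ hτ).1 (h2 τ hτ).2) (fun h0 => absurd h0 (lt_irrefl _)) (fun h0 => by
        have h4 : c ∈ Ioo (0 : ℝ) 1 := ⟨hc.1, h0⟩
        have := (h.chain c h4).loW (k := i) ((h.isI_wr h4 i).2 ⟨0, by simp [hc0]⟩)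
        rwa [loW_neg h1, loW_pos (not_not.1 (h3.resolve_left h0.ne))] at this)
    have heq : (fun t => η t - (ht A i (η (max 0 (min t c))) - ht A i (η 0)) • rt i) = η := by
      funext t
      rw [hflat _ ⟨le_max_left _ _, max_le hc.1.le (min_le_right _ _)⟩, h.zero]
      simp
    rw [heq] at hmod
    refine ih hmod ?_
    rw [if_pos ⟨le_rfl, hc.1⟩]
    have := not_Pl_len hi
    omega

end LSd

/-- Apply a word of lowering operators (the last letter acts first). -/
noncomputable def Fw (A : ι → ι → ℤ) : List ι → (ℝ → VV ι) → ℝ → VV ι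
  | [], π => π
  | i :: l, π => F A i (Fw A l π)

/-- No letter of the word kills. -/
def Dw (A : ι → ι → ℤ) : List ι → (ℝ → VV ι) → Prop
  | [], _ => True
  | i :: l, π => Dw A l π ∧ Dn A i (Fw A l π)

theorem Fw_LSd {x : ℝ → ι → ℝ} (hx : Base x) {l : List ι} (hl : Dw A l (bs x)) :
    ∃ wl wr : ℝ → W A, LSd x (Fw A l (bs x)) wl wr := by
  induction l with
  | nil => exact ⟨_, _, LSd.base hx⟩
  | cons i l ih =>
    obtain ⟨wl, wr, h⟩ := ih hl.1
    obtain ⟨wl', wr', -, -, -, -, h'⟩ := h.lower hx hl.2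
    exact ⟨wl', wr', h'⟩

theorem cl_one : cl 1 = 1 := cl_of_mem (by simp)

theorem amt_one {i : ι} {η : ℝ → VV ι} (h : Dn A i η) : amt (fun s => ht A i (η s)) 1 = 1 := by
  rw [amt, cl_one, lo_one, min_eq_left]
  rw [Dn] at h; linarith

theorem Fw_one {π : ℝ → VV ι} {l : List ι} (hl : Dw A l π) (j : ι) :
    (Fw A l π 1).2 j = (π 1).2 j - l.count j := by
  induction l with
  | nil => simp [Fw]
  | cons i l ih =>
    rw [Fw, F, amt_one hl.2, one_smul, VV.sub_snd, ih hl.1, rt_snd, List.count_cons]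
    by_cases h : i = j
    · simp [h]; ring
    · simp [h, Ne.symm h]

theorem sum_count (l : List ι) : ∑ j, l.count j = l.length := by
  have := Multiset.sum_count_eq_card (s := Finset.univ) (m := (l : Multiset ι)) (by simp)
  simpa using this

theorem LSd.exists_word {x : ℝ → ι → ℝ} (hx : Base x) {η : ℝ → VV ι} {wl wr : ℝ → W A}
    (h : LSd x η wl wr) : ∃ l, Dw A l (bs x) ∧ Fw A l (bs x) = η := by
  have h_int : ∃ n : ℤ, -∑ j, (η 1).2 j = n := by
    have h1 := (h.end_sub_mem hx).2
    choose n hn using h1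
    refine ⟨-∑ j, n j, ?_⟩
    push_cast
    exact congrArg _ (Finset.sum_congr rfl fun j _ => by have := hn j; simpa [bs] using this)
  have hpos : 0 ≤ -∑ j, (η 1).2 j := by
    rw [← Finset.sum_neg_distrib]
    exact Finset.sum_nonneg fun j _ =>
      neg_nonneg.2 (h.snd_nonpos hx j (by simp))
  obtain ⟨n, hn⟩ := h_int
  obtain ⟨k, rfl⟩ : ∃ k : ℕ, n = k := Int.eq_ofNat_of_zero_le (by rw [hn] at hpos; exact_mod_cast hpos)
  clear hpos
  induction k generalizing η wl wr with
  | zero =>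
    refine ⟨[], trivial, (h.eq_base hx fun i t ht => ?_).symm⟩
    by_contra hcon
    have hlo : lo (fun s => LSPath.ht A i (η s)) 0 < 0 :=
      (lo_le (h.continuous_ht hx i) ht).trans_lt (not_le.1 hcon)
    obtain ⟨η', wl', wr', h', -, -, h1⟩ := h.lift hx hlo
    have h2 : ∑ j, (η' 1).2 j = ∑ j, (η 1).2 j + 1 := by
      rw [h1]; simp [rt_snd, Finset.sum_add_distrib]
    have h3 : ∑ j, (η' 1).2 j ≤ 0 := Finset.sum_nonpos fun j _ => h'.snd_nonpos hx j (by simp)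
    push_cast at hn
    linarith
  | succ k ih =>
    by_cases hcon : ∀ i, ∀ t ∈ Icc (0 : ℝ) 1, 0 ≤ ht A i (η t)
    · exact ⟨[], trivial, (h.eq_base hx hcon).symm⟩
    push Not at hcon
    obtain ⟨i, t, ht, h0⟩ := hcon
    have hlo : lo (fun s => LSPath.ht A i (η s)) 0 < 0 :=
      (lo_le (h.continuous_ht hx i) ht).trans_lt h0
    obtain ⟨η', wl', wr', h', h4, h5, h1⟩ := h.lift hx hlo
    have h2 : ∑ j, (η' 1).2 j = ∑ j, (η 1).2 j + 1 := by
      rw [h1]; simp [rt_snd, Finset.sum_add_distrib]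
    obtain ⟨l, hl, hl'⟩ := ih h' (by rw [h2]; push_cast at hn ⊢; linarith)
    exact ⟨i :: l, ⟨hl, hl' ▸ h4⟩, by rw [Fw, hl', h5]⟩

theorem LSd.F_injective {x x' : ℝ → ι → ℝ} (hx : Base x) (hx' : Base x') {η η' : ℝ → VV ι}
    {wl wr wl' wr' : ℝ → W A} (h : LSd x η wl wr) (h' : LSd x' η' wl' wr') {i : ι}
    (hD : Dn A i η) (hD' : Dn A i η') (heq : F A i η = F A i η') : η = η' := by
  obtain ⟨-, -, m, p, q, hf, -⟩ := h.lower hx hD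
  obtain ⟨-, -, m', p', q', hf', -⟩ := h'.lower hx' hD'
  funext t
  have h1 := hf.amt_eq_pre t
  have h2 := hf'.amt_eq_pre t
  simp only [← ht_F] at h1 h2
  rw [heq] at h1
  have h3 := congrFun heq t
  rw [F, F, h1.trans h2.symm] at h3
  exact sub_left_inj.1 h3

theorem LSd.lo_F {x : ℝ → ι → ℝ} (hx : Base x) {η : ℝ → VV ι}
    {wl wr : ℝ → W A} (h : LSd x η wl wr) {i : ι} (hD : Dn A i η) :
    lo (fun s => ht A i (F A i η s)) 0 < 0 := by
  obtain ⟨-, -, m, p, q, hf, -⟩ := h.lower hx hD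
  simp only [ht_F]
  rw [hf.lo_lower]
  have : m ≤ ht A i (η 0) := hf.before 0 ⟨le_rfl, hf.p_nonneg⟩
  rw [h.zero, map_zero] at this
  linarith

/-- The linear interpolation of two base curves. -/
noncomputable def fam (x x' : ℝ → ι → ℝ) (s t : ℝ) (i : ι) : ℝ :=
  (1 - cl s) * x t i + cl s * x' t i

theorem fam_base {x x' : ℝ → ι → ℝ} (hx : Base x) (hx' : Base x') (h1 : x 1 = x' 1) (s : ℝ) :
    Base (fam x x' s) where
  cont i := (continuous_const.mul (hx.cont i)).add (continuous_const.mul (hx'.cont i))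
  mono i a b hab := by
    have h2 := hx.mono i hab
    have h3 := hx'.mono i hab
    have h4 := cl_mem s
    simp only [fam] at h2 h3 ⊢
    nlinarith [mul_le_mul_of_nonneg_left h2 (sub_nonneg.2 h4.2), mul_le_mul_of_nonneg_left h3 h4.1]
  zero := by funext i; simp [fam, hx.zero, hx'.zero]
  one i := by
    obtain ⟨n, hn⟩ := hx.one i
    refine ⟨n, ?_⟩
    rw [fam, ← h1, hn]; ring
  clamp t := by funext i; simp [fam, hx.clamp, hx'.clamp]

theorem fam_zero (x x' : ℝ → ι → ℝ) : fam x x' 0 = x := by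
  funext t i; simp [fam, cl_of_mem (show (0 : ℝ) ∈ Icc (0 : ℝ) 1 by simp)]

theorem fam_one (x x' : ℝ → ι → ℝ) : fam x x' 1 = x' := by
  funext t i; simp [fam, cl_one]

theorem continuous_fam {x x' : ℝ → ι → ℝ} (hx : Base x) (hx' : Base x') (i : ι) :
    Continuous fun p : ℝ × ℝ => fam x x' p.1 p.2 i := by
  have h1 := (hx.cont i).comp (continuous_snd (X := ℝ) (Y := ℝ))
  have h2 := (hx'.cont i).comp (continuous_snd (X := ℝ) (Y := ℝ))
  have h3 := continuous_cl.comp (continuous_fst (X := ℝ) (Y := ℝ))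
  exact ((continuous_const.sub h3).mul h1).add (h3.mul h2)

theorem continuous_Fw {x x' : ℝ → ι → ℝ} (hx : Base x) (hx' : Base x') (l : List ι) :
    (∀ j, Continuous fun p : ℝ × ℝ => (Fw A l (bs (fam x x' p.1)) p.2).2 j) ∧
    ∀ i, Continuous fun p : ℝ × ℝ => ht A i (Fw A l (bs (fam x x' p.1)) p.2) := by
  induction l with
  | nil =>
    refine ⟨fun j => by simp only [Fw, bs, mkV_snd]; exact continuous_const, fun i => ?_⟩
    simp only [Fw, ht_bs]
    exact continuous_fam hx hx' i
  | cons k l ih =>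
    have h1 := continuous_amt_family
      (f := fun s t => ht A k (Fw A l (bs (fam x x' s)) t)) (ih.2 k)
    refine ⟨fun j => ?_, fun i => ?_⟩
    · simp only [Fw, F, VV.sub_snd, VV.smul_snd]
      exact (ih.1 j).sub (h1.mul continuous_const)
    · simp only [Fw, F, map_sub, map_smul, smul_eq_mul]
      exact (ih.2 i).sub (h1.mul continuous_const)

theorem eq_of_continuous_int {f : ℝ → ℝ} (hf : Continuous f) (h : ∀ s, ∃ n : ℤ, f s = n)
    (a b : ℝ) : f a = f b := by
  choose g hg using h
  have h1 : Continuous g := by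
    rw [Int.isClosedEmbedding_coe_real.isInducing.continuous_iff]
    have h2 : (Int.cast ∘ g : ℝ → ℝ) = f := funext fun s => (hg s).symm
    rw [h2]; exact hf
  rw [hg, hg, PreconnectedSpace.constant inferInstance h1]

section Deform

variable {x x' : ℝ → ι → ℝ} (hx : Base x) (hx' : Base x') (h1 : x 1 = x' 1)

include hx hx' h1

theorem fam_lo {l : List ι} (hl : ∀ s, Dw A l (bs (fam x x' s))) (i : ι) (s s' : ℝ) :
    lo (fun t => ht A i (Fw A l (bs (fam x x' s)) t)) 0 =
      lo (fun t => ht A i (Fw A l (bs (fam x x' s')) t)) 0 := by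
  refine eq_of_continuous_int (f := fun s => lo (fun t => ht A i (Fw A l (bs (fam x x' s)) t)) 0)
    (continuous_lo_zero ((continuous_Fw hx hx' l).2 i)) (fun s => ?_) s s'
  obtain ⟨wl, wr, h⟩ := Fw_LSd (fam_base hx hx' h1 s) (hl s)
  obtain ⟨m, hm, -⟩ := h.exists_min (fam_base hx hx' h1 s) i
  exact ⟨m, hm⟩

theorem fam_Dw {l : List ι} {s : ℝ} (hl : Dw A l (bs (fam x x' s))) (s' : ℝ) :
    Dw A l (bs (fam x x' s')) := by
  induction l generalizing s' with
  | nil => trivial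
  | cons i l ih =>
    have ih' := ih hl.1
    refine ⟨ih' s', ?_⟩
    have h2 := hl.2
    rw [Dn] at h2 ⊢
    rw [fam_lo hx hx' h1 ih' i s' s]
    refine h2.trans_eq ?_
    refine eq_of_continuous_int (f := fun s => ht A i (Fw A l (bs (fam x x' s)) 1))
      ?_ (fun s => ?_) s s'
    · exact ((continuous_Fw hx hx' l).2 i).comp
        (Continuous.prodMk continuous_id (continuous_const (y := (1:ℝ))))
    · obtain ⟨wl, wr, h⟩ := Fw_LSd (fam_base hx hx' h1 s) (ih' s)
      exact h.isI_one (fam_base hx hx' h1 s) i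

theorem isClosed_fam_eq {l l' : List ι} (hl : ∀ s, Dw A l (bs (fam x x' s)))
    (hl' : ∀ s, Dw A l' (bs (fam x x' s))) :
    IsClosed {s | Fw A l (bs (fam x x' s)) = Fw A l' (bs (fam x x' s))} := by
  have : {s | Fw A l (bs (fam x x' s)) = Fw A l' (bs (fam x x' s))} =
      ⋂ t : ℝ, ⋂ j : ι, {s | (Fw A l (bs (fam x x' s)) t).2 j =
        (Fw A l' (bs (fam x x' s)) t).2 j} := by
    ext s
    simp only [mem_ofPred_eq, mem_iInter]
    refine ⟨fun h t j => by rw [h], fun h => funext fun t => VV.ext (fun i => ?_) (h t)⟩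
    have hb := fam_base hx hx' h1 s
    obtain ⟨_, _, h2⟩ := Fw_LSd hb (hl s)
    obtain ⟨_, _, h3⟩ := Fw_LSd hb (hl' s)
    rw [h2.fst hb, h3.fst hb]
  rw [this]
  refine isClosed_iInter fun t => isClosed_iInter fun j => isClosed_eq ?_ ?_
  · exact ((continuous_Fw hx hx' l).1 j).comp
        (Continuous.prodMk continuous_id (continuous_const (y := t)))
  · exact ((continuous_Fw hx hx' l').1 j).comp
        (Continuous.prodMk continuous_id (continuous_const (y := t)))

theorem length_eq_of_Fw_eq {π : ℝ → VV ι} {l l' : List ι} (hl : Dw A l π) (hl' : Dw A l' π)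
    (h : Fw A l π = Fw A l' π) : l.length = l'.length := by
  rw [← sum_count, ← sum_count]
  refine Finset.sum_congr rfl fun j _ => ?_
  have h2 := Fw_one hl j
  rw [h, Fw_one hl' j] at h2
  have : (l'.count j : ℝ) = l.count j := by linarith
  exact_mod_cast this.symm

theorem fam_eq {n : ℕ} {l l' : List ι} (hn : l'.length = n) {s : ℝ}
    (hl : Dw A l (bs (fam x x' s))) (hl' : Dw A l' (bs (fam x x' s)))
    (h : Fw A l (bs (fam x x' s)) = Fw A l' (bs (fam x x' s))) (s' : ℝ) :
    Fw A l (bs (fam x x' s')) = Fw A l' (bs (fam x x' s')) := by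
  induction n generalizing l l' s s' with
  | zero =>
    have := length_eq_of_Fw_eq hx hx' h1 hl hl' h
    rw [List.length_eq_zero_iff.1 hn, List.length_eq_zero_iff.1 (this.trans hn)]
  | succ n ih =>
    obtain ⟨i, m, rfl⟩ : ∃ i m, l' = i :: m := by
      cases l' with
      | nil => simp at hn
      | cons i m => exact ⟨i, m, rfl⟩
    have hlen : l.length = n + 1 := (length_eq_of_Fw_eq hx hx' h1 hl hl' h).trans hn
    have hl0 := fam_Dw hx hx' h1 hl
    have hl0' := fam_Dw hx hx' h1 hl'
    have hlt : ∀ u, lo (fun t => ht A i (Fw A l (bs (fam x x' u)) t)) 0 < 0 := fun u => by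
      rw [fam_lo hx hx' h1 hl0 i u s, h]
      obtain ⟨_, _, h3⟩ := Fw_LSd (fam_base hx hx' h1 s) hl'.1
      exact h3.lo_F (fam_base hx hx' h1 s) hl'.2
    let E : List ι → Set ℝ := fun m =>
      {u | Fw A l (bs (fam x x' u)) = Fw A (i :: m) (bs (fam x x' u))}
    let T : Set (List ι) := {m' | m'.length = n ∧ (∀ u, Dw A (i :: m') (bs (fam x x' u))) ∧
      Disjoint (E m) (E m')}
    have hT : T.Finite := (List.finite_length_eq ι n).subset fun m' hm' => hm'.1
    have hcompl : (E m)ᶜ = ⋃ m' ∈ T, E m' := by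
      ext u
      simp only [mem_compl_iff, mem_iUnion, exists_prop]
      constructor
      · intro hu
        have hb := fam_base hx hx' h1 u
        obtain ⟨_, _, h3⟩ := Fw_LSd hb (hl0 u)
        obtain ⟨η', _, _, h4, h5, h6, -⟩ := h3.lift hb (hlt u)
        obtain ⟨m', hm', rfl⟩ := h4.exists_word hb
        have hD : Dw A (i :: m') (bs (fam x x' u)) := ⟨hm', h5⟩
        have hD0 := fam_Dw hx hx' h1 hD
        have hm'n : m'.length = n := by
          have := length_eq_of_Fw_eq hx hx' h1 (hl0 u) hD h6.symm
          simp only [List.length_cons] at this; omega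
        refine ⟨m', ⟨hm'n, hD0, Set.disjoint_left.2 fun v hv hv' => hu ?_⟩, h6.symm⟩
        have hb' := fam_base hx hx' h1 v
        obtain ⟨_, _, h7⟩ := Fw_LSd hb' (hl0' v).1
        obtain ⟨_, _, h8⟩ := Fw_LSd hb' (hD0 v).1
        have h9 := h7.F_injective hb' hb' h8 (hl0' v).2 (hD0 v).2
          (hv.symm.trans hv')
        have h10 := ih hm'n (hl0' v).1 (hD0 v).1 h9 u
        show _ = _
        rw [Fw, h10]; exact h6.symm
      · rintro ⟨m', hm', hu⟩ hu'
        exact Set.disjoint_left.1 hm'.2.2 hu' hu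
    have hclopen : IsClopen (E m) := by
      refine ⟨isClosed_fam_eq hx hx' h1 hl0 hl0', ?_⟩
      rw [← isClosed_compl_iff, hcompl]
      exact hT.isClosed_biUnion fun m' hm' => isClosed_fam_eq hx hx' h1 hl0 hm'.2.1
    have := hclopen.eq_univ ⟨s, h⟩
    have h2 : s' ∈ E m := by rw [this]; trivial
    exact h2

theorem Dw_transfer {l : List ι} (hl : Dw A l (bs x)) : Dw A l (bs x') := by
  have := fam_Dw (A := A) hx hx' h1 (l := l) (s := 0) (by rwa [fam_zero]) 1
  rwa [fam_one] at this

theorem Fw_transfer {l l' : List ι} (hl : Dw A l (bs x)) (hl' : Dw A l' (bs x))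
    (h : Fw A l (bs x) = Fw A l' (bs x)) : Fw A l (bs x') = Fw A l' (bs x') := by
  have := fam_eq (A := A) hx hx' h1 rfl (l := l) (l' := l') (s := 0) (by rwa [fam_zero])
    (by rwa [fam_zero]) (by rwa [fam_zero]) 1
  rwa [fam_one] at this

end Deform

/-- A word with positive depth along `i` can be rewritten to start with `i`. -/
theorem exists_cons {x : ℝ → ι → ℝ} (hx : Base x) {l : List ι} (hl : Dw A l (bs x)) {i : ι}
    (h : lo (fun s => ht A i (Fw A l (bs x) s)) 0 < 0) :
    ∃ m, Dw A (i :: m) (bs x) ∧ Fw A l (bs x) = Fw A (i :: m) (bs x) := by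
  obtain ⟨_, _, h3⟩ := Fw_LSd hx hl
  obtain ⟨η', _, _, h4, h5, h6, -⟩ := h3.lift hx h
  obtain ⟨m', hm', rfl⟩ := h4.exists_word hx
  exact ⟨m', ⟨hm', h5⟩, h6.symm⟩

end LS

section LS

variable {ι : Type*} [Fintype ι] [DecidableEq ι] {A : ι → ι → ℤ} [hA : IsGCM A]

theorem IEdge.snd_sub {p : VV ι} {u v : W A} (h : IEdge p u v) :
    ∃ (i : ι) (y : W A) (c : ι → ℝ), Pl i y ∧ (∀ q, 0 ≤ c q) ∧
      ∀ (d : VV ι) (q : ι), (v • d).2 q - (u • d).2 q = ht A i (y • d) * c q := by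
  obtain ⟨x, i, y, rfl, rfl, hlen, hy, -⟩ := h
  refine ⟨i, y, (x • (rt i : VV ι)).2, hy, fun q => ?_, fun d q => ?_⟩
  · by_contra hq
    have := len_mul_refl_lt (x * y) y i hy ⟨q, by simpa using hq⟩
    rw [show x * y * (y⁻¹ * sg A i * y) = x * sg A i * y by group] at this
    omega
  · rw [← VV.sub_snd]
    have : (x * y) • d - (x * sg A i * y) • d = ht A i (y • d) • x • rt i := by
      rw [mul_smul, mul_smul, mul_smul, sg_smul, smul_sub, smul_comm x (ht A i (y • d)),
        sub_sub_cancel]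
    rw [this, VV.smul_snd]

theorem IEdge.snd_le {p : VV ι} {u v : W A} (h : IEdge p u v) {d : VV ι} (hd : ∀ j, 0 ≤ ht A j d)
    (q : ι) : (u • d).2 q ≤ (v • d).2 q := by
  obtain ⟨i, y, c, hy, hc, h⟩ := h.snd_sub
  have := mul_nonneg (ht_smul_nonneg hy hd) (hc q)
  rw [← h] at this
  linarith

theorem IChain.snd_le {p : VV ι} {u v : W A} (h : IChain p u v) {d : VV ι}
    (hd : ∀ j, 0 ≤ ht A j d) (q : ι) : (u • d).2 q ≤ (v • d).2 q := by
  induction h with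
  | refl => exact le_rfl
  | tail _ h ih => exact ih.trans (h.snd_le hd q)

/-- A chain without effect on a dominant point has no effect on dominant points with smaller
support. -/
theorem IChain.snd_eq {p : VV ι} {u v : W A} (h : IChain p u v) {d e : VV ι}
    (hd : ∀ j, 0 ≤ ht A j d) (hde : ∀ j, ht A j d = 0 → ht A j e = 0) {q : ι}
    (hq : (u • d).2 q = (v • d).2 q) : (u • e).2 q = (v • e).2 q := by
  induction h with
  | refl => rfl
  | @tail b c h' h ih =>
    have h1 := IChain.snd_le h' hd q
    have h2 := h.snd_le hd q
    refine (ih (by linarith)).trans ?_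
    obtain ⟨i, y, co, hy, hc, hs⟩ := h.snd_sub
    have h3 : ht A i (y • d) * co q = 0 := by rw [← hs]; linarith
    have h4 : ht A i (y • e) * co q = 0 := by
      rcases mul_eq_zero.1 h3 with h5 | h5
      · obtain ⟨n, hn⟩ := ht_NN hy
        rw [hn] at h5
        rw [Finset.sum_eq_zero_iff_of_nonneg fun j _ => mul_nonneg (by positivity) (hd j)] at h5
        rw [hn, Finset.sum_eq_zero, zero_mul]
        intro j hj
        rcases mul_eq_zero.1 (h5 j hj) with h6 | h6
        · rw [h6, zero_mul]
        · rw [hde j h6, mul_zero]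
      · rw [h5, mul_zero]
    rw [← hs] at h4
    linarith

theorem continuous_smul_bs {x : ℝ → ι → ℝ} (hx : Base x) (w : W A) (q : ι) :
    Continuous fun s => (w • bs x s).2 q := by
  induction w using W_induction generalizing q with
  | h1 => simp only [one_smul, bs, mkV_snd]; exact continuous_const
  | hs i w ih =>
    have : Continuous fun s => ht A i (w • bs x s) := by
      simp only [ht_apply, smul_fst]
      exact (hx.cont i).add (continuous_finsetSum _ fun j _ => continuous_const.mul (ih j))
    simp only [mul_smul, sg_smul, VV.sub_snd, VV.smul_snd]
    exact (ih q).sub (this.mul continuous_const)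

namespace LSd

variable {x : ℝ → ι → ℝ} {η : ℝ → VV ι} {wl wr : ℝ → W A} (h : LSd x η wl wr) (hx : Base x)

include h hx

variable {τ : ℝ}

theorem snd_le_wl (hτ : τ ∈ Ioc (0 : ℝ) 1) (q : ι) :
    (η τ).2 q ≤ (wl τ • bs x τ).2 q := by
  set Q : W A → Prop := fun u => ∀ v : VV ι, (∀ j, 0 ≤ ht A j v) → (u • v).2 q ≤ (wl τ • v).2 q
    with hQ
  obtain ⟨a, ha, hra, hin, hend⟩ := h.run_left (Q := Q) hτ fun v _ => le_rfl
  have ha0 : a = 0 := by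
    by_contra h0
    exact hend.resolve_left h0 fun v hv => ((h.chain a
      ⟨lt_of_le_of_ne ha.1 (Ne.symm h0), ha.2.trans_le hτ.2⟩).snd_le hv q).trans (hra v hv)
  subst ha0
  have hcont : Continuous fun s => (wl τ • bs x s).2 q - (η s).2 q :=
    (continuous_smul_bs hx (wl τ) q).sub (h.cont q)
  have := le_of_local_le hcont hτ.1.le fun s hs => by
    filter_upwards [h.right s ⟨hs.1, hs.2.trans_le hτ.2⟩, self_mem_nhdsWithin] with s' hs' hlt
    have hlt : s < s' := hlt
    have hQs : Q (wr s) := by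
      rcases hs.1.eq_or_lt with h0 | h0
      · rw [← h0]; exact hra
      · exact (hin s ⟨h0, hs.2⟩).2
    have h1 := hQs _ (ht_bs_sub hx hlt.le)
    rw [← hs'.2.2, smul_sub, VV.sub_snd, VV.sub_snd] at h1
    linarith
  simp only [h.zero, bs_zero hx, smul_zero, sub_self] at this
  linarith

theorem jump_le (hτ : τ ∈ Ioc (0 : ℝ) 1) (q : ι) :
    (wr τ • bs x τ).2 q - (wl τ • bs x τ).2 q ≤ - (η τ).2 q := by
  have h1 := h.snd_le_wl hx hτ q
  have h2 := smul_snd_nonpos (wr τ) (v := bs x τ)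
    (fun j => by rw [ht_bs]; have := hx.mono j hτ.1.le; simpa [hx.zero] using this) q
  simp only [bs, mkV_snd, Pi.zero_apply] at h1 h2 ⊢
  linarith

omit hx in
theorem snd_eq_int (hxτ : ∀ j, ∃ n : ℤ, x τ j = n) (hτ : τ ∈ Ioc (0 : ℝ) 1) (q : ι) :
    ∃ n : ℤ, (η τ).2 q = n := by
  have h1 := (Lat ι).add_mem (h.lat τ hτ)
    (smul_sub_mem_Lat (A := A) (v := bs x τ) (fun j => by rw [ht_bs]; exact hxτ j) (wl τ))
  obtain ⟨n, hn⟩ := h1.2 q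
  exact ⟨n, by simpa [bs] using hn⟩

/-- Behaviour at a time where the base curve is linear. -/
theorem second_difference (hτ : τ ∈ Ioo (0 : ℝ) 1) {d : ι → ℝ}
    (hd : ∀ᶠ s in 𝓝 τ, ∀ j, x s j = x τ j + (s - τ) * d j) (q : ι) :
    ∀ᶠ ε in 𝓝[>] (0 : ℝ), 0 ≤ (η (τ - ε)).2 q + (η (τ + ε)).2 q - 2 * (η τ).2 q ∧
      ((∀ j, x τ j = 0 → d j = 0) → -(η τ).2 q < 1 →
        (η (τ - ε)).2 q + (η (τ + ε)).2 q - 2 * (η τ).2 q = 0) := by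
  have hl : Tendsto (fun ε : ℝ => τ - ε) (𝓝[>] 0) (𝓝[<] τ) := by
    refine tendsto_nhdsWithin_iff.2 ⟨?_, ?_⟩
    · have : Tendsto (fun ε : ℝ => τ - ε) (𝓝 0) (𝓝 (τ - 0)) := by
        exact (continuous_const.sub continuous_id).tendsto 0
      rw [sub_zero] at this
      exact this.mono_left nhdsWithin_le_nhds
    · filter_upwards [self_mem_nhdsWithin] with ε hε
      have : 0 < ε := hε
      show τ - ε < τ
      linarith
  have hr : Tendsto (fun ε : ℝ => τ + ε) (𝓝[>] 0) (𝓝[>] τ) := by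
    refine tendsto_nhdsWithin_iff.2 ⟨?_, ?_⟩
    · have : Tendsto (fun ε : ℝ => τ + ε) (𝓝 0) (𝓝 (τ + 0)) := by
        exact (continuous_const.add continuous_id).tendsto 0
      rw [add_zero] at this
      exact this.mono_left nhdsWithin_le_nhds
    · filter_upwards [self_mem_nhdsWithin] with ε hε
      have : 0 < ε := hε
      show τ < τ + ε
      linarith
  filter_upwards [hl.eventually (h.left τ ⟨hτ.1, hτ.2.le⟩), hr.eventually (h.right τ ⟨hτ.1.le, hτ.2⟩),
    hl.eventually (hd.filter_mono nhdsWithin_le_nhds),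
    hr.eventually (hd.filter_mono nhdsWithin_le_nhds), self_mem_nhdsWithin] with ε h1 h2 h3 h4 hε
  have hε : 0 < ε := hε
  set D : VV ι := mkV (fun j => ε * d j) 0 with hD
  have e1 : bs x τ - bs x (τ - ε) = D := VV.ext (fun j => by simp [bs, hD, h3 j]) (by simp [bs, hD])
  have e2 : bs x (τ + ε) - bs x τ = D := VV.ext (fun j => by simp [bs, hD, h4 j]) (by simp [bs, hD])
  have hDd : ∀ j, 0 ≤ ht A j D := fun j => by rw [← e2]; exact ht_bs_sub hx (by linarith) j
  have e3 : (η (τ - ε)).2 q + (η (τ + ε)).2 q - 2 * (η τ).2 q = (wr τ • D).2 q - (wl τ • D).2 q := by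
    nth_rewrite 1 [← e2]
    rw [← e1, ← h1.2.2, ← h2.2.2, VV.sub_snd, VV.sub_snd]; ring
  have hch := h.chain τ hτ
  refine ⟨by rw [e3]; linarith [hch.snd_le hDd q], fun hsupp hlt => ?_⟩
  have hb : ∀ j, 0 ≤ ht A j (bs x τ) := fun j => by
    rw [ht_bs]; have := hx.mono j hτ.1.le; simpa [hx.zero] using this
  have h5 := hch.snd_le hb q
  have h6 := h.jump_le hx ⟨hτ.1, hτ.2.le⟩ q
  obtain ⟨n, hn⟩ := hch.sub_mem.2 q
  rw [VV.sub_snd] at hn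
  have h7 : (wl τ • bs x τ).2 q = (wr τ • bs x τ).2 q := by
    rw [← sub_nonneg, hn] at h5
    rw [hn] at h6
    have h8 : (n : ℝ) < 1 := h6.trans_lt hlt
    have h9 : 0 ≤ n := by exact_mod_cast h5
    have h10 : n < 1 := by exact_mod_cast h8
    have h11 : n = 0 := by omega
    rw [h11, Int.cast_zero] at hn
    linarith
  rw [e3, hch.snd_eq hb (fun j hj => ?_) h7, sub_self]
  rw [ht_bs] at hj
  simp [hD, ht_apply, hsupp j hj]

end LSd

end LS

theorem lo_of_monotoneOn {f : ℝ → ℝ} (hf : MonotoneOn f (Icc 0 1)) {t : ℝ} (h : t ∈ Icc (0 : ℝ) 1) :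
    lo f t = f t :=
  lo_eq ⟨le_rfl, h.2⟩ rfl fun _ hs => hf h ⟨h.1.trans hs.1, hs.2⟩ hs.1

theorem amt_of_monotoneOn {f : ℝ → ℝ} (hf : MonotoneOn f (Icc 0 1)) (h0 : f 0 = 0) {t : ℝ}
    (h : t ∈ Icc (0 : ℝ) 1) : amt f t = min 1 (f t) := by
  rw [amt, cl_of_mem h, lo_of_monotoneOn hf h, lo_of_monotoneOn hf (by simp), h0, sub_zero]

theorem amt_ext {f g : ℝ → ℝ} (h : ∀ t ∈ Icc (0 : ℝ) 1, amt f t = amt g t) : amt f = amt g := by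
  funext t
  rw [← amt_cl, ← amt_cl g]
  exact h _ (cl_mem t)

theorem lo_shift {f z : ℝ → ℝ} (hf : Continuous f) {c τ : ℝ} (hc : 0 ≤ c) (hτ : τ ∈ Icc (0 : ℝ) 1)
    (hz : ∀ t ∈ Icc (0 : ℝ) 1, z t ≤ 1) (hz1 : ∀ t ∈ Icc τ 1, z t = 1) (h0 : amt f τ = 0) {t : ℝ}
    (htm : t ∈ Icc (0 : ℝ) 1) : lo (fun s => f s - c * z s) t = lo f t - c := by
  have h1 : lo f τ = lo f 0 := by
    rw [amt, cl_of_mem hτ] at h0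
    rcases min_choice 1 (lo f τ - lo f 0) with h | h <;> rw [h] at h0 <;> linarith
  obtain ⟨u, hu, hfu, -⟩ := exists_lo hf (t := max t τ) (max_le htm.2 hτ.2)
  have h2 : f u = lo f t := by
    rw [hfu]
    rcases le_total t τ with h | h
    · rw [max_eq_right h]
      have h3 := lo_mono hf htm.1 htm.2
      have h4 := lo_mono hf h hτ.2
      linarith
    · rw [max_eq_left h]
  refine lo_eq (u := u) ⟨(le_max_left _ _).trans hu.1, hu.2⟩ ?_ fun s hs => ?_
  · rw [hz1 u ⟨(le_max_right _ _).trans hu.1, hu.2⟩, h2, mul_one]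
  · have h3 := lo_le hf hs
    have h4 := mul_le_mul_of_nonneg_left (hz s ⟨htm.1.trans hs.1, hs.2⟩) hc
    linarith

section LS

variable {ι : Type*} [Fintype ι] [DecidableEq ι]

theorem Fw_append (A : ι → ι → ℤ) (l m : List ι) (π : ℝ → VV ι) :
    Fw A (l ++ m) π = Fw A l (Fw A m π) := by
  induction l with
  | nil => rfl
  | cons i l ih => rw [List.cons_append, Fw, ih, Fw]

theorem Dw_append {A : ι → ι → ℤ} {l m : List ι} {π : ℝ → VV ι} :
    Dw A (l ++ m) π ↔ Dw A m π ∧ Dw A l (Fw A m π) := by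
  induction l with
  | nil => simp [Dw]
  | cons i l ih => rw [List.cons_append, Dw, ih, Dw, Fw_append, and_assoc]

theorem Fw_snd_of_not_mem {A : ι → ι → ℤ} {l : List ι} {p : ι} (hp : p ∉ l) (π : ℝ → VV ι) (t : ℝ) :
    (Fw A l π t).2 p = (π t).2 p := by
  induction l with
  | nil => rfl
  | cons i l ih =>
    rw [List.mem_cons, not_or] at hp
    rw [Fw, F, VV.sub_snd, VV.smul_snd, rt_snd, if_neg hp.1, ih hp.2]; ring

variable {A : ι → ι → ℤ} [hA : IsGCM A]

namespace LSd

variable {x : ℝ → ι → ℝ} {η : ℝ → VV ι} {wl wr : ℝ → W A}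

theorem F_snd_le (h : LSd x η wl wr) (hx : Base x) (i j : ι) (t : ℝ) :
    (F A i η t).2 j ≤ (η t).2 j := by
  rw [F, VV.sub_snd, VV.smul_snd, rt_snd]
  have := amt_nonneg (h.continuous_ht hx i) t
  split_ifs <;> linarith

theorem monotoneOn_ht_of_fresh (h : LSd x η wl wr) (hx : Base x) {p : ι}
    (hp : ∀ t, (η t).2 p = 0) : MonotoneOn (fun t => ht A p (η t)) (Icc 0 1) := by
  intro s hs t htm hst
  simp only [ht_apply, h.fst hx]
  refine add_le_add (hx.mono p hst) (Finset.sum_le_sum fun j _ => ?_)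
  by_cases hj : j = p
  · rw [hj, hp, hp]
  · exact mul_le_mul_of_nonpos_left (h.antitoneOn_snd hx j hs htm hst)
      (by exact_mod_cast hA.off p j (Ne.symm hj))

theorem amt_fresh (h : LSd x η wl wr) (hx : Base x) {p : ι} (hp : ∀ t, (η t).2 p = 0) {t : ℝ}
    (htm : t ∈ Icc (0 : ℝ) 1) : amt (fun s => ht A p (η s)) t = min 1 (ht A p (η t)) :=
  amt_of_monotoneOn (h.monotoneOn_ht_of_fresh hx hp) (by simp [h.zero]) htm

theorem Dn_fresh (h : LSd x η wl wr) (hx : Base x) {p : ι} (hp : ∀ t, (η t).2 p = 0) :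
    Dn A p η ↔ 1 ≤ ht A p (η 1) := by
  rw [Dn, lo_of_monotoneOn (h.monotoneOn_ht_of_fresh hx hp) (by simp), h.zero, map_zero, zero_add]

end LSd

theorem Fw_append_snd_le {x : ℝ → ι → ℝ} (hx : Base x) {l m : List ι}
    (hD : Dw A (l ++ m) (bs x)) (j : ι) (t : ℝ) :
    (Fw A (l ++ m) (bs x) t).2 j ≤ (Fw A m (bs x) t).2 j := by
  induction l with
  | nil => exact le_rfl
  | cons i l ih =>
    obtain ⟨wl, wr, h⟩ := Fw_LSd hx hD.1
    exact (h.F_snd_le hx i j t).trans (ih hD.1)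

/-- A fresh letter commutes to the top of a word provided that it is exhausted before any letter
adjacent to it acts. -/
theorem move_to_top {x : ℝ → ι → ℝ} (hx : Base x) {p : ι} {τ : ℝ} (hτ : τ ∈ Icc (0 : ℝ) 1)
    {C : List ι} (hz : 1 ≤ ht A p (Fw A C (bs x) τ)) {B : List ι} (hp : p ∉ B ++ C)
    (hD : Dw A (B ++ p :: C) (bs x))
    (heq : ∀ j, A p j ≠ 0 → j ≠ p →
      (Fw A (B ++ p :: C) (bs x) τ).2 j = (Fw A (p :: C) (bs x) τ).2 j) :
    Dw A (p :: (B ++ C)) (bs x) ∧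
      Fw A (B ++ p :: C) (bs x) = Fw A (p :: (B ++ C)) (bs x) ∧
      1 ≤ ht A p (Fw A (B ++ C) (bs x) τ) := by
  induction B with
  | nil => exact ⟨hD, rfl, hz⟩
  | cons q B ih =>
    rw [List.cons_append, List.mem_cons, not_or] at hp
    obtain ⟨hpq, hp⟩ := hp
    rw [List.cons_append] at hD
    obtain ⟨hD1, hDq⟩ : Dw A (B ++ p :: C) (bs x) ∧ Dn A q (Fw A (B ++ p :: C) (bs x)) := hD
    obtain ⟨wl, wr, hS⟩ := Fw_LSd hx hD1
    have hsq : ∀ j, A p j ≠ 0 → j ≠ p →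
        (Fw A (q :: (B ++ p :: C)) (bs x) τ).2 j = (Fw A (B ++ p :: C) (bs x) τ).2 j ∧
        (Fw A (B ++ p :: C) (bs x) τ).2 j = (Fw A (p :: C) (bs x) τ).2 j := fun j hj hjp => by
      have h1 := heq j hj hjp
      have h2 := hS.F_snd_le hx q j τ
      have h3 := Fw_append_snd_le hx hD1 j τ
      rw [List.cons_append] at h1
      change (Fw A (q :: (B ++ p :: C)) (bs x) τ).2 j ≤ _ at h2
      constructor <;> linarith
    obtain ⟨⟨hD2, hDp⟩, hFS, hz'⟩ := ih hp hD1 fun j hj hjp => (hsq j hj hjp).2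
    obtain ⟨wl', wr', hζ⟩ := Fw_LSd hx hD2
    set ζ := Fw A (B ++ C) (bs x) with hζdef
    set S := Fw A (B ++ p :: C) (bs x) with hSdef
    have hfr : ∀ t, (ζ t).2 p = 0 := fun t => by rw [hζdef, Fw_snd_of_not_mem hp]; rfl
    set z := amt (fun s => ht A p (ζ s)) with hzdef
    have hz1 : ∀ t ∈ Icc τ 1, z t = 1 := fun t h => by
      rw [hzdef, hζ.amt_fresh hx hfr ⟨hτ.1.trans h.1, h.2⟩, min_eq_left]
      exact hz'.trans (hζ.monotoneOn_ht_of_fresh hx hfr hτ ⟨hτ.1.trans h.1, h.2⟩ h.1)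
    have hSt : ∀ t, S t = ζ t - z t • rt p := fun t => by rw [hFS]; rfl
    have hg : ∀ t, ht A q (ζ t) = ht A q (S t) - -(A q p : ℝ) * z t := fun t => by
      rw [hSt, map_sub, map_smul, ht_rt, smul_eq_mul]; ring
    have hzero : A p q ≠ 0 → amt (fun s => ht A q (S s)) τ = 0 := fun hq => by
      have h1 := (hsq q hq (Ne.symm hpq)).1
      rw [Fw, F, ← hSdef, VV.sub_snd, VV.smul_snd, rt_snd, if_pos rfl, mul_one] at h1
      linarith
    have hlo : ∀ t ∈ Icc (0 : ℝ) 1, lo (fun s => ht A q (ζ s)) t =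
        lo (fun s => ht A q (S s)) t - -(A q p : ℝ) := fun t h => by
      by_cases hq : A p q = 0
      · have h2 : A q p = 0 := hA.zero p q hq
        simp [hg, h2]
      · simp only [hg]
        exact lo_shift (hS.continuous_ht hx q)
          (by rw [Left.nonneg_neg_iff]; exact_mod_cast hA.off q p (Ne.symm hpq)) hτ
          (fun t _ => amt_le_one _ t) hz1 (hzero hq) h
    have hamt : amt (fun s => ht A q (ζ s)) = amt (fun s => ht A q (S s)) := amt_ext fun t h => by
      rw [amt, amt, hlo _ (cl_mem t), hlo 0 (by simp)]
      congr 1; ring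
    have hDq' : Dn A q ζ := by
      rw [Dn, hlo 0 (by simp), hg, hz1 1 ⟨hτ.2, le_rfl⟩]
      rw [Dn] at hDq; linarith
    obtain ⟨wl'', wr'', hζ'⟩ := Fw_LSd hx (l := q :: (B ++ C)) ⟨hD2, hDq'⟩
    have hfr' : ∀ t, (Fw A (q :: (B ++ C)) (bs x) t).2 p = 0 := fun t => by
      rw [Fw_snd_of_not_mem (by simp only [List.mem_cons, not_or]; exact ⟨hpq, hp⟩)]; rfl
    have hht : ∀ t, ht A p (Fw A (q :: (B ++ C)) (bs x) t) =
        ht A p (ζ t) + -(A p q : ℝ) * amt (fun s => ht A q (S s)) t := fun t => by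
      rw [Fw, F, map_sub, map_smul, ht_rt, ← hζdef, hamt, smul_eq_mul]; ring
    have hcq : 0 ≤ -(A p q : ℝ) := by
      rw [Left.nonneg_neg_iff]; exact_mod_cast hA.off p q hpq
    have hge : ∀ t, ht A p (ζ t) ≤ ht A p (Fw A (q :: (B ++ C)) (bs x) t) := fun t => by
      rw [hht]
      linarith [mul_nonneg hcq (amt_nonneg (hS.continuous_ht hx q) t)]
    have hz2 : amt (fun s => ht A p (Fw A (q :: (B ++ C)) (bs x) s)) = z := amt_ext fun t h => by
      rw [hζ'.amt_fresh hx hfr' h, hζ.amt_fresh hx hfr h]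
      rcases le_total t τ with h1 | h1
      · rw [hht]
        by_cases hq : A p q = 0
        · rw [hq]; simp
        · have h2 := amt_mono (hS.continuous_ht hx q) h1
          rw [hzero hq] at h2
          rw [le_antisymm h2 (amt_nonneg (hS.continuous_ht hx q) t)]; simp
      · have h2 : 1 ≤ ht A p (ζ t) := hz'.trans (hζ.monotoneOn_ht_of_fresh hx hfr hτ h h1)
        rw [min_eq_left h2, min_eq_left (h2.trans (hge t))]
    refine ⟨⟨⟨hD2, hDq'⟩, ?_⟩, ?_, hz'.trans (hge τ)⟩
    · change Dn A p (Fw A (q :: (B ++ C)) (bs x))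
      rw [hζ'.Dn_fresh hx hfr']
      exact ((hζ.Dn_fresh hx hfr).1 hDp).trans (hge 1)
    · funext t
      rw [List.cons_append, List.cons_append, Fw, F, ← hSdef, hSt, Fw, F, hz2, Fw, F, ← hζdef, hamt]
      module

end LS

/-- A Borcherds–Cartan matrix. -/
class IsBCM {κ : Type*} (B : κ → κ → ℤ) : Prop where
  diag : ∀ k, B k k = 2 ∨ B k k ≤ 0
  off : ∀ k j, k ≠ j → B k j ≤ 0
  zero : ∀ k j, B k j = 0 → B j k = 0

section Labels

variable {κ : Type*} [Fintype κ] [DecidableEq κ] {N : ℕ}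

/-- The generalized Cartan matrix with a supply of copies of every index of `B`. -/
def labM (N : ℕ) (B : κ → κ → ℤ) (p q : κ × Fin (N + 1)) : ℤ :=
  if p = q then 2 else min (B p.1 q.1) 0

instance {B : κ → κ → ℤ} [hB : IsBCM B] : IsGCM (labM N B) where
  diag p := if_pos rfl
  off p q h := by rw [labM, if_neg h]; exact min_le_right _ _
  zero p q h := by
    rw [labM] at h ⊢
    by_cases hpq : p = q
    · rw [if_pos hpq] at h; norm_num at h
    rw [if_neg hpq] at h
    rw [if_neg (Ne.symm hpq)]
    by_cases hk : p.1 = q.1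
    · rwa [hk] at h ⊢
    · rw [min_eq_left (hB.off _ _ hk)] at h
      rw [hB.zero _ _ h, min_self]

/-- The base curve for the copies. -/
def labB (x : ℝ → κ → ℝ) (t : ℝ) (p : κ × Fin (N + 1)) : ℝ := x t p.1

theorem Base.labB {x : ℝ → κ → ℝ} (hx : Base x) :
    Base (labB x : ℝ → κ × Fin (N + 1) → ℝ) where
  cont p := hx.cont p.1
  mono p := hx.mono p.1
  zero := by funext p; exact congrFun hx.zero p.1
  one p := hx.one p.1
  clamp t := by funext p; exact congrFun (hx.clamp t) p.1

/-- Identification of the copies of every index. -/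
noncomputable def un : VV (κ × Fin (N + 1)) →ₗ[ℝ] VV κ where
  toFun v := mkV (fun k => v.1 (k, 0)) fun k => ∑ r, v.2 (k, r)
  map_add' u v := VV.ext (fun k => rfl) fun k => by simp [Finset.sum_add_distrib]
  map_smul' c v := VV.ext (fun k => rfl) fun k => by simp [Finset.mul_sum]

theorem un_fst (v : VV (κ × Fin (N + 1))) (k : κ) : (un v).1 k = v.1 (k, 0) := rfl

theorem un_snd (v : VV (κ × Fin (N + 1))) (k : κ) : (un v).2 k = ∑ r, v.2 (k, r) := rfl

theorem un_rt (p : κ × Fin (N + 1)) : un (rt p) = rt p.1 := by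
  refine VV.ext (fun k => rfl) fun k => ?_
  rw [un_snd, rt_snd]
  obtain ⟨j, s⟩ := p
  simp only [rt_snd, Prod.mk.injEq]
  by_cases h : k = j <;> simp [h]

theorem un_bs (x : ℝ → κ → ℝ) (t : ℝ) :
    un (bs (labB x) t : VV (κ × Fin (N + 1))) = bs x t :=
  VV.ext (fun k => rfl) fun k => by simp [un_snd, bs]

theorem ht_un (B : κ → κ → ℤ) (k : κ) (v : VV (κ × Fin (N + 1))) :
    ht B k (un v) = v.1 (k, 0) + ∑ q, (B k q.1 : ℝ) * v.2 q := by
  rw [ht_apply, un_fst, Fintype.sum_prod_type]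
  simp only [un_snd, Finset.mul_sum]

variable (B : κ → κ → ℤ)

/-- Words in the copies where real letters use a single copy and imaginary letters never repeat a
copy. -/
def Good (l : List (κ × Fin (N + 1))) : Prop :=
  ∀ p, (B p.1 p.1 = 2 → p.2 ≠ 0 → l.count p = 0) ∧ (B p.1 p.1 ≠ 2 → l.count p ≤ 1)

variable {B}

theorem Good.of_sublist {l l' : List (κ × Fin (N + 1))} (h : Good B l) (hs : l'.Sublist l) :
    Good B l' := fun p =>
  ⟨fun h1 h2 => Nat.le_zero.1 ((hs.count_le p).trans ((h p).1 h1 h2).le),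
    fun h1 => (hs.count_le p).trans ((h p).2 h1)⟩

theorem Good.of_cons {l : List (κ × Fin (N + 1))} {p : κ × Fin (N + 1)} (h : Good B (p :: l)) :
    Good B l := h.of_sublist (List.sublist_cons_self p l)

theorem Good.not_mem {l : List (κ × Fin (N + 1))} {p : κ × Fin (N + 1)} (h : Good B (p :: l))
    (hp : B p.1 p.1 ≠ 2) : p ∉ l := fun hm => by
  have := (h p).2 hp
  rw [List.count_cons_self] at this
  have := List.count_pos_iff.2 hm
  omega

theorem Good.label_eq {l : List (κ × Fin (N + 1))} (h : Good B l) {q : κ × Fin (N + 1)}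
    (hq : q ∈ l) (hr : B q.1 q.1 = 2) : q.2 = 0 := by
  by_contra h0
  have := (h q).1 hr h0
  have := List.count_pos_iff.2 hq
  omega

theorem count_beq (p : κ × Fin (N + 1)) (l : List (κ × Fin (N + 1))) :
    @List.count _ instBEqOfDecidableEq p l = l.count p := by
  rw [lawful_beq_subsingleton (instBEqOfDecidableEq : BEq (κ × Fin (N + 1))) instBEqProd]

theorem Good.of_Fw_eq [IsBCM B] {π : ℝ → VV (κ × Fin (N + 1))} {l l' : List (κ × Fin (N + 1))}
    (h : Good B l) (hl : Dw (labM N B) l π) (hl' : Dw (labM N B) l' π)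
    (he : Fw (labM N B) l π = Fw (labM N B) l' π) : Good B l' := by
  have hc : ∀ p, l'.count p = l.count p := fun p => by
    have h2 := Fw_one hl p
    rw [he, Fw_one hl' p, count_beq, count_beq] at h2
    have : (l'.count p : ℝ) = l.count p := by linarith
    exact_mod_cast this
  intro p
  rw [hc p]
  exact h p

theorem labM_eq_min {p q : κ × Fin (N + 1)} (h : p ≠ q) : labM N B p q = min (B p.1 q.1) 0 :=
  if_neg h

/-- The coroot of a copy agrees with the coroot of the index when irrelevant copies do not occur. -/
theorem ht_labM {p : κ × Fin (N + 1)} {v : VV (κ × Fin (N + 1))} [hB : IsBCM B]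
    (hv : v.1 p = v.1 (p.1, 0))
    (h1 : B p.1 p.1 = 2 → ∀ q : κ × Fin (N + 1), q.1 = p.1 → q ≠ p → v.2 q = 0)
    (h2 : B p.1 p.1 ≠ 2 → v.2 p = 0) : ht (labM N B) p v = ht B p.1 (un v) := by
  rw [ht_un, ht_apply, hv]
  congr 1
  refine Finset.sum_congr rfl fun q _ => ?_
  by_cases hq : p = q
  · subst hq
    by_cases hr : B p.1 p.1 = 2
    · rw [hr, labM, if_pos rfl]
    · rw [h2 hr, mul_zero, mul_zero]
  rw [labM_eq_min hq]
  by_cases hk : q.1 = p.1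
  · rcases hB.diag p.1 with hr | hr
    · rw [h1 hr q hk (Ne.symm hq), mul_zero, mul_zero]
    · rw [hk, min_eq_left hr]
  · rw [min_eq_left (hB.off _ _ (Ne.symm hk))]

variable [hB : IsBCM B] {x : ℝ → κ → ℝ}

theorem Fw_fst {ι : Type*} [Fintype ι] [DecidableEq ι] (A : ι → ι → ℤ) (l : List ι) (y : ℝ → ι → ℝ)
    (t : ℝ) : (Fw A l (bs y) t).1 = y t := by
  induction l with
  | nil => rfl
  | cons i l ih =>
    funext j
    rw [Fw, F, VV.sub_fst, VV.smul_fst, rt_fst, ih, mul_zero, sub_zero]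

theorem ht_Fw_lab {p : κ × Fin (N + 1)} {l : List (κ × Fin (N + 1))}
    (h1 : B p.1 p.1 = 2 → p.2 = 0 ∧ Good B l) (h2 : B p.1 p.1 ≠ 2 → p ∉ l) (t : ℝ) :
    ht (labM N B) p (Fw (labM N B) l (bs (labB x)) t) =
      ht B p.1 (un (Fw (labM N B) l (bs (labB x)) t)) := by
  refine ht_labM (by rw [Fw_fst]; rfl) (fun hr q hq hqp => ?_) fun hr => ?_
  · rw [Fw_snd_of_not_mem fun hm => hqp ?_]
    · rfl
    · exact Prod.ext hq (((h1 hr).2.label_eq hm (hq ▸ hr)).trans (h1 hr).1.symm)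
  · rw [Fw_snd_of_not_mem (h2 hr)]; rfl

theorem Good.ht_Fw {p : κ × Fin (N + 1)} {l : List (κ × Fin (N + 1))} (h : Good B (p :: l)) (t : ℝ) :
    ht (labM N B) p (Fw (labM N B) l (bs (labB x)) t) =
      ht B p.1 (un (Fw (labM N B) l (bs (labB x)) t)) :=
  ht_Fw_lab (fun hr => ⟨h.label_eq List.mem_cons_self hr, h.of_cons⟩) (fun hr => h.not_mem hr) t

theorem un_F (A : κ × Fin (N + 1) → κ × Fin (N + 1) → ℤ) (p : κ × Fin (N + 1))
    (η : ℝ → VV (κ × Fin (N + 1))) (t : ℝ) :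
    un (F A p η t) = un (η t) - amt (fun s => ht A p (η s)) t • rt p.1 := by
  rw [F, map_sub, map_smul, un_rt]

theorem un_Fw {l : List (κ × Fin (N + 1))} (h : Good B l) (t : ℝ) :
    un (Fw (labM N B) l (bs (labB x)) t) = Fw B (l.map Prod.fst) (bs x) t := by
  induction l generalizing t with
  | nil => exact un_bs x t
  | cons p l ih =>
    rw [Fw, un_F, List.map_cons, Fw, F, ih h.of_cons]
    simp only [h.ht_Fw, ih h.of_cons]

theorem Dw_lab {l : List (κ × Fin (N + 1))} (h : Good B l) :
    Dw (labM N B) l (bs (labB x)) ↔ Dw B (l.map Prod.fst) (bs x) := by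
  induction l with
  | nil => exact Iff.rfl
  | cons p l ih =>
    rw [Dw, List.map_cons, Dw, ih h.of_cons]
    simp only [Dn, h.ht_Fw, un_Fw h.of_cons]

variable (B) in
/-- The labelling of a word where imaginary letters are labelled by their position. -/
def lab (N : ℕ) : List κ → List (κ × Fin (N + 1))
  | [] => []
  | k :: l => (k, if B k k = 2 then 0 else Fin.ofNat (N + 1) l.length) :: lab N l

theorem lab_map (l : List κ) : (lab B N l).map Prod.fst = l := by
  induction l with
  | nil => rfl
  | cons k l ih => rw [lab, List.map_cons, ih]

theorem lab_val_lt {l : List κ} (hl : l.length ≤ N + 1) {p : κ × Fin (N + 1)} (hp : p ∈ lab B N l)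
    (hr : B p.1 p.1 ≠ 2) : p.2.val < l.length := by
  induction l with
  | nil => simp [lab] at hp
  | cons k l ih =>
    rw [List.length_cons] at hl ⊢
    rcases List.mem_cons.1 hp with rfl | hp
    · simp only at hr
      simp only [if_neg hr, Fin.ofNat]
      exact (Nat.mod_le _ _).trans_lt (Nat.lt_succ_self _)
    · exact (ih (by omega) hp).trans (Nat.lt_succ_self _)

theorem good_lab {l : List κ} (hl : l.length ≤ N + 1) : Good B (lab B N l) := by
  induction l with
  | nil => intro p; simp [lab]
  | cons k l ih =>
    rw [List.length_cons] at hl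
    have ih := ih (by omega)
    intro p
    rw [lab, List.count_cons]
    refine ⟨fun hr h0 => ?_, fun hr => ?_⟩
    · rw [(ih p).1 hr h0, if_neg]
      rintro h
      have h := beq_iff_eq.1 h
      subst h
      simp only at hr h0
      exact h0 (if_pos hr)
    · by_cases h : (k, if B k k = 2 then 0 else Fin.ofNat (N + 1) l.length) = p
      · subst h
        simp only at hr
        rw [List.count_eq_zero_of_not_mem fun hm => ?_, zero_add]
        · split_ifs <;> simp
        have := lab_val_lt (by omega) hm hr
        simp only [if_neg hr, Fin.ofNat] at this
        rw [Nat.mod_eq_of_lt (by omega)] at this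
        exact lt_irrefl _ this
      · rw [if_neg (by simpa using h)]
        exact (ih p).2 hr

end Labels

section Identified

variable {κ : Type*} [Fintype κ] [DecidableEq κ] {N : ℕ} {B : κ → κ → ℤ} [hB : IsBCM B]

/-- At every interior time the curve is either locally linear, without leaving a wall, or integral. -/
def Tame (x : ℝ → κ → ℝ) : Prop :=
  ∀ τ ∈ Ioo (0 : ℝ) 1, (∃ d : κ → ℝ, (∀ᶠ s in 𝓝 τ, ∀ j, x s j = x τ j + (s - τ) * d j) ∧
    ∀ j, x τ j = 0 → d j = 0) ∨ ∀ j, ∃ n : ℤ, x τ j = n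

theorem exists_first_of_fst {l : List (κ × Fin (N + 1))} {k : κ} (h : ∃ q ∈ l, q.1 = k) :
    ∃ C D p, l = C ++ p :: D ∧ p.1 = k ∧ ∀ q ∈ C, q.1 ≠ k := by
  induction l with
  | nil => simp at h
  | cons a l ih =>
    by_cases ha : a.1 = k
    · exact ⟨[], l, a, rfl, ha, by simp⟩
    · obtain ⟨C, D, p, h1, h2, h3⟩ := ih (by
        obtain ⟨q, hq, hk⟩ := h
        rcases List.mem_cons.1 hq with rfl | hq
        · exact absurd hk ha
        · exact ⟨q, hq, hk⟩)
      refine ⟨a :: C, D, p, by rw [h1]; rfl, h2, fun q hq => ?_⟩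
      rcases List.mem_cons.1 hq with rfl | hq
      · exact ha
      · exact h3 q hq

variable {x : ℝ → κ → ℝ}

theorem ht_un_F (k : κ) (p : κ × Fin (N + 1)) (η : ℝ → VV (κ × Fin (N + 1))) (t : ℝ) :
    ht B k (un (F (labM N B) p η t)) =
      ht B k (un (η t)) - amt (fun s => ht (labM N B) p (η s)) t * B k p.1 := by
  rw [un_F, map_sub, map_smul, ht_rt, smul_eq_mul]

theorem imag_nonpos {k : κ} (hk : B k k ≠ 2) (j : κ) : (B k j : ℝ) ≤ 0 := by
  by_cases h : k = j
  · subst h; exact_mod_cast (hB.diag k).resolve_left hk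
  · exact_mod_cast hB.off k j h

theorem ht_un_append_le (hx : Base x) {k : κ} (hk : B k k ≠ 2) {C D : List (κ × Fin (N + 1))}
    (hD : Dw (labM N B) (C ++ D) (bs (labB x))) (t : ℝ) :
    ht B k (un (Fw (labM N B) D (bs (labB x)) t)) ≤
      ht B k (un (Fw (labM N B) (C ++ D) (bs (labB x)) t)) := by
  induction C with
  | nil => exact le_rfl
  | cons p C ih =>
    have hD' : Dw (labM N B) (C ++ D) (bs (labB x)) := hD.1
    refine (ih hD').trans ?_
    obtain ⟨_, _, h⟩ := Fw_LSd hx.labB hD'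
    rw [List.cons_append, Fw, ht_un_F]
    have := mul_nonpos_of_nonneg_of_nonpos (amt_nonneg (h.continuous_ht hx.labB p) t)
      (imag_nonpos hk p.1)
    linarith

theorem Fw_cons_fresh (hx : Base x) {D : List (κ × Fin (N + 1))} {p : κ × Fin (N + 1)}
    (hp : p ∉ D) (hD : Dw (labM N B) D (bs (labB x))) {t : ℝ} (htm : t ∈ Icc (0 : ℝ) 1) :
    amt (fun s => ht (labM N B) p (Fw (labM N B) D (bs (labB x)) s)) t =
      min 1 (ht (labM N B) p (Fw (labM N B) D (bs (labB x)) t)) := by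
  obtain ⟨_, _, h⟩ := Fw_LSd hx.labB hD
  exact h.amt_fresh hx.labB (fun t => by rw [Fw_snd_of_not_mem hp]; rfl) htm

theorem neg_snd_eq (hx : Base x) {C E : List (κ × Fin (N + 1))} {q : κ × Fin (N + 1)}
    (hq : B q.1 q.1 ≠ 2) (hg : Good B (C ++ q :: E))
    (hD : Dw (labM N B) (C ++ q :: E) (bs (labB x))) {t : ℝ} (htm : t ∈ Icc (0 : ℝ) 1) :
    -(Fw (labM N B) (C ++ q :: E) (bs (labB x)) t).2 q =
      min 1 (ht B q.1 (un (Fw (labM N B) E (bs (labB x)) t))) := by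
  have h1 : Good B (q :: E) := hg.of_sublist (List.sublist_append_right _ _)
  have h2 := (Dw_append.1 hD).1
  have h3 : q ∉ C := fun hc => by
    have := (hg q).2 hq
    rw [List.count_append, List.count_cons_self] at this
    have := List.count_pos_iff.2 hc
    omega
  rw [Fw_append, Fw_snd_of_not_mem h3, Fw, F, VV.sub_snd, VV.smul_snd, rt_snd, if_pos rfl,
    Fw_snd_of_not_mem (h1.not_mem hq), Fw_cons_fresh hx (h1.not_mem hq) h2.1 htm, h1.ht_Fw]
  simp [bs]

theorem un_count {l l' : List (κ × Fin (N + 1))} {π : ℝ → VV (κ × Fin (N + 1))}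
    (hD : Dw (labM N B) l π) (hD' : Dw (labM N B) l' π)
    (he : un (Fw (labM N B) l π 1) = un (Fw (labM N B) l' π 1)) (k : κ) :
    ∑ r, l.count (k, r) = ∑ r, l'.count (k, r) := by
  have h : (un (Fw (labM N B) l π 1)).2 k = (un (Fw (labM N B) l' π 1)).2 k := by rw [he]
  rw [un_snd, un_snd] at h
  simp only [Fw_one hD, Fw_one hD', count_beq, Finset.sum_sub_distrib, sub_right_inj] at h
  exact_mod_cast h

theorem mem_of_un_eq {l l' : List (κ × Fin (N + 1))} {π : ℝ → VV (κ × Fin (N + 1))}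
    (hD : Dw (labM N B) l π) (hD' : Dw (labM N B) l' π)
    (he : un (Fw (labM N B) l π 1) = un (Fw (labM N B) l' π 1)) {q : κ × Fin (N + 1)}
    (hq : q ∈ l') : ∃ p ∈ l, p.1 = q.1 := by
  by_contra! hc
  have h := un_count hD hD' he q.1
  have h0 : ∑ r, l.count (q.1, r) = 0 :=
    Finset.sum_eq_zero fun r _ => List.count_eq_zero.2 fun hm => hc _ hm rfl
  rw [h0] at h
  have := (Finset.sum_eq_zero_iff.1 h.symm) q.2 (Finset.mem_univ _)
  exact List.count_eq_zero.1 this hq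

variable {C D E : List (κ × Fin (N + 1))} {p p' : κ × Fin (N + 1)}

/-- A time where the amount of `p'` is saturated forces saturation of the outermost copy `p`. -/
theorem saturated (hx : Base x) (htame : Tame x) (hpp : p.1 = p'.1) (hp : B p.1 p.1 ≠ 2)
    (hC : ∀ q ∈ C, q.1 ≠ p.1) (hg : Good B (C ++ p :: D)) (hg' : Good B (p' :: E))
    (hD : Dw (labM N B) (C ++ p :: D) (bs (labB x))) (hD' : Dw (labM N B) (p' :: E) (bs (labB x)))
    (he : ∀ t, un (Fw (labM N B) (C ++ p :: D) (bs (labB x)) t) =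
      un (Fw (labM N B) (p' :: E) (bs (labB x)) t)) {τ : ℝ} (hτ : τ ∈ Ioc (0 : ℝ) 1)
    (h1 : ht (labM N B) p' (Fw (labM N B) E (bs (labB x)) τ) = 1)
    (hlt : ∀ t ∈ Ico (0 : ℝ) τ, ht (labM N B) p' (Fw (labM N B) E (bs (labB x)) t) < 1) :
    1 ≤ ht (labM N B) p (Fw (labM N B) D (bs (labB x)) τ) := by
  by_contra! hc
  have hτ' : τ ∈ Icc (0 : ℝ) 1 := Ioc_subset_Icc_self hτ
  have hgp : Good B (p :: D) := hg.of_sublist (List.sublist_append_right _ _)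
  have hDp := (Dw_append.1 hD).1
  obtain ⟨_, _, hζ⟩ := Fw_LSd hx.labB hDp.1
  obtain ⟨_, _, hη⟩ := Fw_LSd hx.labB hD
  obtain ⟨_, _, hX⟩ := Fw_LSd hx.labB hD'.1
  obtain ⟨_, _, hη'⟩ := Fw_LSd hx.labB hD'
  have hp' : B p'.1 p'.1 ≠ 2 := hpp ▸ hp
  have hfr := hg'.not_mem hp'
  have hτ1 : τ < 1 := lt_of_le_of_ne hτ.2 fun h => by
    have := (hζ.Dn_fresh hx.labB fun t => by
      rw [Fw_snd_of_not_mem (hgp.not_mem hp)]; rfl).1 hDp.2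
    rw [h] at hc
    exact absurd this hc.not_ge
  have hsmall : ∀ q : κ × Fin (N + 1), q.1 = p.1 →
      -(Fw (labM N B) (C ++ p :: D) (bs (labB x)) τ).2 q < 1 := fun q hq => by
    by_cases hm : q ∈ C ++ p :: D
    · rw [hgp.ht_Fw] at hc
      rcases List.mem_append.1 hm with h | h
      · exact absurd hq (hC q h)
      rcases List.mem_cons.1 h with rfl | h
      · rw [neg_snd_eq hx hp hg hD hτ']
        exact (min_le_right _ _).trans_lt hc
      · obtain ⟨G, K, rfl⟩ := List.append_of_mem h
        have hre : C ++ p :: (G ++ q :: K) = (C ++ p :: G) ++ q :: K := by simp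
        rw [hre] at hD hg ⊢
        rw [neg_snd_eq hx (hq ▸ hp) hg hD hτ', hq]
        refine (min_le_right _ _).trans_lt (lt_of_le_of_lt ?_ hc)
        have h2 := hDp.1
        rw [List.append_cons] at h2 ⊢
        exact ht_un_append_le hx hp h2 τ
    · rw [Fw_snd_of_not_mem hm]; simp [bs]
  have hsum : ∀ t, ∑ r, (Fw (labM N B) (C ++ p :: D) (bs (labB x)) t).2 (p.1, r) =
      ∑ r, (Fw (labM N B) (p' :: E) (bs (labB x)) t).2 (p.1, r) := fun t => by
    rw [← un_snd, ← un_snd, he]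
  have hF : ∀ t ∈ Icc (0 : ℝ) 1, ∀ q, (Fw (labM N B) (p' :: E) (bs (labB x)) t).2 q =
      (Fw (labM N B) E (bs (labB x)) t).2 q -
        if q = p' then min 1 (ht (labM N B) p' (Fw (labM N B) E (bs (labB x)) t)) else 0 := by
    intro t htm q
    rw [Fw, F, VV.sub_snd, VV.smul_snd, rt_snd, Fw_cons_fresh hx hfr hD'.1 htm]
    split_ifs <;> ring
  have hsumF : ∀ t ∈ Icc (0 : ℝ) 1,
      ∑ r, (Fw (labM N B) (C ++ p :: D) (bs (labB x)) t).2 (p.1, r) =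
      ∑ r, (Fw (labM N B) E (bs (labB x)) t).2 (p.1, r) -
        min 1 (ht (labM N B) p' (Fw (labM N B) E (bs (labB x)) t)) := by
    intro t htm
    rw [hsum]
    simp only [hF t htm, Finset.sum_sub_distrib]
    congr 1
    rw [Finset.sum_eq_single p'.2]
    · rw [if_pos (show ((p.1, p'.2) : κ × Fin (N+1)) = p' from Prod.ext hpp rfl)]
    · intro r _ hr
      rw [if_neg fun h => hr (congrArg Prod.snd h)]
    · simp
  rcases htame τ ⟨hτ.1, hτ1⟩ with ⟨d, hd, hd0⟩ | h_int
  · have e1 := eventually_all.2 fun r => hη.second_difference hx.labB ⟨hτ.1, hτ1⟩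
      (d := fun q => d q.1) (hd.mono fun s hs j => hs j.1) (p.1, r)
    have e2 := eventually_all.2 fun r => hX.second_difference hx.labB ⟨hτ.1, hτ1⟩
      (d := fun q => d q.1) (hd.mono fun s hs j => hs j.1) (p.1, r)
    have e3 : ∀ᶠ ε : ℝ in 𝓝[>] 0, ε < min τ (1 - τ) :=
      mem_nhdsWithin_of_mem_nhds (Iio_mem_nhds (lt_min hτ.1 (by linarith)))
    obtain ⟨ε, h2, h3, h4, h5⟩ := (e1.and (e2.and (e3.and self_mem_nhdsWithin))).exists
    have h5 : 0 < ε := h5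
    have h6 := h4.trans_le (min_le_left _ _)
    have h7 := h4.trans_le (min_le_right _ _)
    have s1 : ∑ r, ((Fw (labM N B) (C ++ p :: D) (bs (labB x)) (τ - ε)).2 (p.1, r) +
        (Fw (labM N B) (C ++ p :: D) (bs (labB x)) (τ + ε)).2 (p.1, r) -
        2 * (Fw (labM N B) (C ++ p :: D) (bs (labB x)) τ).2 (p.1, r)) = 0 :=
      Finset.sum_eq_zero fun r _ => (h2 r).2 (fun j => hd0 j.1) (hsmall _ rfl)
    have s2 := Finset.sum_nonneg fun r (_ : r ∈ Finset.univ) => (h3 r).1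
    rw [Finset.sum_sub_distrib, Finset.sum_add_distrib, ← Finset.mul_sum] at s1 s2
    rw [hsumF _ ⟨by linarith, by linarith⟩, hsumF _ ⟨by linarith, by linarith⟩, hsumF _ hτ',
      h1, min_self] at s1
    have h8 := min_le_right 1 (ht (labM N B) p' (Fw (labM N B) E (bs (labB x)) (τ - ε)))
    have h9 := min_le_left 1 (ht (labM N B) p' (Fw (labM N B) E (bs (labB x)) (τ + ε)))
    have := hlt (τ - ε) ⟨by linarith, by linarith⟩
    linarith
  · have h2 : ∑ r, (Fw (labM N B) (C ++ p :: D) (bs (labB x)) τ).2 (p.1, r) = 0 :=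
      Finset.sum_eq_zero fun r _ => by
        obtain ⟨n, hn⟩ := hη.snd_eq_int (fun j => h_int j.1) hτ (p.1, r)
        have h3 := hsmall (p.1, r) rfl
        have h4 := hη.snd_nonpos hx.labB (p.1, r) hτ'
        rw [hn] at h3 h4 ⊢
        have h5 : -1 < n := by exact_mod_cast (by linarith : (-1 : ℝ) < n)
        have h6 : n ≤ 0 := by exact_mod_cast h4
        have : n = 0 := by omega
        rw [this, Int.cast_zero]
    rw [hsumF _ hτ', h1, min_self] at h2
    have := Finset.sum_nonpos fun r (_ : r ∈ Finset.univ) => hX.snd_nonpos hx.labB (p.1, r) hτ'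
    linarith

end Identified

section Identified

variable {κ : Type*} [Fintype κ] [DecidableEq κ] {N : ℕ} {B : κ → κ → ℤ} [hB : IsBCM B]
  {x x' : ℝ → κ → ℝ}

/-- The outermost letter of an imaginary index can be moved to the top of the word. -/
theorem exists_cons_imag (hx : Base x) (htame : Tame x) {l E : List (κ × Fin (N + 1))}
    {p' : κ × Fin (N + 1)} (hp' : B p'.1 p'.1 ≠ 2) (hg : Good B l) (hg' : Good B (p' :: E))
    (hD : Dw (labM N B) l (bs (labB x))) (hD' : Dw (labM N B) (p' :: E) (bs (labB x)))
    (he : ∀ t, un (Fw (labM N B) l (bs (labB x)) t) =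
      un (Fw (labM N B) (p' :: E) (bs (labB x)) t)) :
    ∃ p m, p.1 = p'.1 ∧ Dw (labM N B) (p :: m) (bs (labB x)) ∧
      Fw (labM N B) l (bs (labB x)) = Fw (labM N B) (p :: m) (bs (labB x)) := by
  obtain ⟨C, D, p, rfl, hpp, hC⟩ :=
    exists_first_of_fst (mem_of_un_eq hD hD' (he 1) List.mem_cons_self)
  have hp : B p.1 p.1 ≠ 2 := hpp ▸ hp'
  rw [← hpp] at hC
  obtain ⟨_, _, hX⟩ := Fw_LSd hx.labB hD'.1
  have hfr : ∀ t, (Fw (labM N B) E (bs (labB x)) t).2 p' = 0 := fun t => by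
    rw [Fw_snd_of_not_mem (hg'.not_mem hp')]; rfl
  have hone := (hX.Dn_fresh hx.labB hfr).1 hD'.2
  have hcont := hX.continuous_ht hx.labB p'
  have h0 : ht (labM N B) p' (Fw (labM N B) E (bs (labB x)) 0) = 0 := by rw [hX.zero, map_zero]
  obtain ⟨τ₀, hτ₀, hv₀⟩ := intermediate_value_Icc (zero_le_one' ℝ) hcont.continuousOn
    (show (1 : ℝ) ∈ _ from ⟨by rw [h0]; exact zero_le_one, hone⟩)
  obtain ⟨τ, hτ, hv, hmin⟩ := LSd.exists_first hcont hτ₀ hv₀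
  have hτ0 : 0 < τ := lt_of_le_of_ne hτ.1 fun h => by
    rw [← h, h0] at hv; exact zero_ne_one hv
  have hsat := saturated hx htame hpp hp hC hg hg' hD hD' he ⟨hτ0, hτ.2⟩ hv fun t htm => by
    have hle := hX.monotoneOn_ht_of_fresh hx.labB hfr ⟨htm.1, htm.2.le.trans hτ.2⟩ hτ htm.2.le
    refine lt_of_le_of_ne (hle.trans_eq hv) fun h => ?_
    exact (hmin t ⟨htm.1, htm.2.le.trans hτ.2⟩ h).not_gt htm.2
  have hgp : Good B (p :: D) := hg.of_sublist (List.sublist_append_right _ _)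
  have hDp := (Dw_append.1 hD).1
  have e1 : ht B p.1 (un (Fw (labM N B) (C ++ p :: D) (bs (labB x)) τ)) = 1 - B p.1 p.1 := by
    have h : amt (fun s => ht (labM N B) p' (Fw (labM N B) E (bs (labB x)) s)) τ = 1 := by
      rw [Fw_cons_fresh hx (hg'.not_mem hp') hD'.1 hτ, hv, min_self]
    rw [hg'.ht_Fw] at hv
    rw [he, Fw, ht_un_F, h, hpp, hv, one_mul]
  have e2 : 1 - (B p.1 p.1 : ℝ) ≤ ht B p.1 (un (Fw (labM N B) (p :: D) (bs (labB x)) τ)) := by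
    rw [Fw, ht_un_F, Fw_cons_fresh hx (hgp.not_mem hp) hDp.1 hτ, min_eq_left hsat, one_mul]
    rw [hgp.ht_Fw] at hsat
    linarith
  rw [← e1, ht_un, ht_un, Fw_fst, Fw_fst, add_le_add_iff_left, ← sub_nonpos,
    ← Finset.sum_sub_distrib] at e2
  have hnn : ∀ q : κ × Fin (N + 1), 0 ≤ (B p.1 q.1 : ℝ) *
      (Fw (labM N B) (C ++ p :: D) (bs (labB x)) τ).2 q -
      (B p.1 q.1 : ℝ) * (Fw (labM N B) (p :: D) (bs (labB x)) τ).2 q := fun q => by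
    rw [← mul_sub]
    exact mul_nonneg_of_nonpos_of_nonpos (imag_nonpos hp q.1)
      (sub_nonpos.2 (Fw_append_snd_le hx.labB hD q τ))
  have hz := (Finset.sum_eq_zero_iff_of_nonneg fun q _ => hnn q).1
    (le_antisymm e2 (Finset.sum_nonneg fun q _ => hnn q))
  have hnm : p ∉ C ++ D := fun hm => by
    rcases List.mem_append.1 hm with h | h
    · exact hC p h rfl
    · exact hgp.not_mem hp h
  obtain ⟨h1, h2, -⟩ := move_to_top hx.labB hτ hsat hnm hD fun j hj hjp => by
    have h := hz j (Finset.mem_univ j)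
    rw [← mul_sub] at h
    refine sub_eq_zero.1 ((mul_eq_zero.1 h).resolve_left fun hc => hj ?_)
    rw [labM_eq_min (Ne.symm hjp), Int.cast_eq_zero.1 hc, min_self]
  exact ⟨p, C ++ D, hpp, h1, h2⟩

theorem un_Fw_ext (hx : Base x) {l l' : List (κ × Fin (N + 1))}
    (hD : Dw (labM N B) l (bs (labB x))) (hD' : Dw (labM N B) l' (bs (labB x)))
    (he : ∀ t ∈ Icc (0 : ℝ) 1, un (Fw (labM N B) l (bs (labB x)) t) =
      un (Fw (labM N B) l' (bs (labB x)) t)) (t : ℝ) :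
    un (Fw (labM N B) l (bs (labB x)) t) = un (Fw (labM N B) l' (bs (labB x)) t) := by
  obtain ⟨_, _, h⟩ := Fw_LSd hx.labB hD
  obtain ⟨_, _, h'⟩ := Fw_LSd hx.labB hD'
  rw [← h.clamp, ← h'.clamp]
  exact he _ (cl_mem t)

theorem eq_of_sub_min_mul_eq {u v b : ℝ} (hb : b ≤ 0) (h : u - min 1 u * b = v - min 1 v * b) :
    u = v := by
  rcases lt_trichotomy u v with h1 | h1 | h1
  · nlinarith [min_le_min_left 1 h1.le]
  · exact h1
  · nlinarith [min_le_min_left 1 h1.le]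

/-- Peeling the top letter of a word inside an identified equality. -/
theorem exists_peel (hx : Base x) (htame : Tame x) {l E : List (κ × Fin (N + 1))}
    {p' : κ × Fin (N + 1)} (hg : Good B l) (hg' : Good B (p' :: E))
    (hD : Dw (labM N B) l (bs (labB x))) (hD' : Dw (labM N B) (p' :: E) (bs (labB x)))
    (he : ∀ t, un (Fw (labM N B) l (bs (labB x)) t) =
      un (Fw (labM N B) (p' :: E) (bs (labB x)) t)) :
    ∃ p m, p.1 = p'.1 ∧ Dw (labM N B) (p :: m) (bs (labB x)) ∧
      Fw (labM N B) l (bs (labB x)) = Fw (labM N B) (p :: m) (bs (labB x)) ∧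
      ∀ t, un (Fw (labM N B) m (bs (labB x)) t) = un (Fw (labM N B) E (bs (labB x)) t) := by
  by_cases hr : B p'.1 p'.1 = 2
  · have h0 := hg'.label_eq List.mem_cons_self hr
    obtain ⟨_, _, hX⟩ := Fw_LSd hx.labB hD'.1
    have hl : ∀ t, ht (labM N B) p' (Fw (labM N B) l (bs (labB x)) t) =
        ht (labM N B) p' (Fw (labM N B) (p' :: E) (bs (labB x)) t) := fun t => by
      rw [ht_Fw_lab (fun _ => ⟨h0, hg⟩) (fun h => absurd hr h),
        ht_Fw_lab (fun _ => ⟨h0, hg'⟩) (fun h => absurd hr h), he]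
    obtain ⟨m, hm, hme⟩ := exists_cons hx.labB hD (i := p') (by
      simp only [hl]
      exact LSd.lo_F hx.labB hX hD'.2)
    refine ⟨p', m, rfl, hm, hme, fun t => ?_⟩
    obtain ⟨_, _, hM⟩ := Fw_LSd hx.labB hm.1
    obtain ⟨_, _, a, b, c, f1, -⟩ := hM.lower hx.labB hm.2
    obtain ⟨_, _, a', b', c', f2, -⟩ := hX.lower hx.labB hD'.2
    have e1 := f1.amt_eq_pre t
    have e2 := f2.amt_eq_pre t
    have hh : ∀ s, ht (labM N B) p' (Fw (labM N B) m (bs (labB x)) s) -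
        2 * amt (fun s => ht (labM N B) p' (Fw (labM N B) m (bs (labB x)) s)) s =
        ht (labM N B) p' (Fw (labM N B) E (bs (labB x)) s) -
        2 * amt (fun s => ht (labM N B) p' (Fw (labM N B) E (bs (labB x)) s)) s := fun s => by
      rw [← ht_F, ← ht_F]
      have := hl s
      rwa [hme] at this
    simp only [hh] at e1
    rw [← e2] at e1
    have h2 := he t
    rw [hme, Fw, Fw, un_F, un_F, e1] at h2
    exact sub_left_injective h2
  · obtain ⟨p, m, hpp, hm, hme⟩ := exists_cons_imag hx htame hr hg hg' hD hD' he
    have hgm := hg.of_Fw_eq hD hm hme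
    have hp : B p.1 p.1 ≠ 2 := hpp ▸ hr
    refine ⟨p, m, hpp, hm, hme, un_Fw_ext hx hm.1 hD'.1 fun t htm => ?_⟩
    have h2 := he t
    rw [hme, Fw, Fw, un_F, un_F, Fw_cons_fresh hx (hgm.not_mem hp) hm.1 htm,
      Fw_cons_fresh hx (hg'.not_mem hr) hD'.1 htm, hgm.ht_Fw, hg'.ht_Fw, hpp] at h2
    have h3 := congrArg (ht B p'.1) h2
    rw [map_sub, map_sub, map_smul, map_smul, ht_rt, smul_eq_mul, smul_eq_mul] at h3
    have h4 := eq_of_sub_min_mul_eq (imag_nonpos hr _) h3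
    rw [h4] at h2
    exact sub_left_injective h2

/-- Identified equalities of words do not depend on the base curve. -/
theorem un_transfer (hx : Base x) (hx' : Base x') (h1 : x 1 = x' 1) (htame : Tame x)
    {l l' : List (κ × Fin (N + 1))} (hg : Good B l) (hg' : Good B l')
    (hD : Dw (labM N B) l (bs (labB x))) (hD' : Dw (labM N B) l' (bs (labB x)))
    (he : ∀ t, un (Fw (labM N B) l (bs (labB x)) t) = un (Fw (labM N B) l' (bs (labB x)) t))
    (t : ℝ) :
    un (Fw (labM N B) l (bs (labB x')) t) = un (Fw (labM N B) l' (bs (labB x')) t) := by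
  have h1' : (labB x 1 : κ × Fin (N + 1) → ℝ) = labB x' 1 :=
    funext fun p => congrFun h1 p.1
  induction l' generalizing l t with
  | nil =>
    have hl : l = [] := List.eq_nil_iff_forall_not_mem.2 fun q hq => by
      obtain ⟨p, hp, -⟩ := mem_of_un_eq hD' hD (he 1).symm hq
      simp at hp
    rw [hl]
  | cons p' E ih =>
    obtain ⟨p, m, hpp, hm, hme, hun⟩ := exists_peel hx htame hg hg' hD hD' he
    have hgm := hg.of_Fw_eq hD hm hme
    have ih := ih hgm.of_cons hg'.of_cons hm.1 hD'.1 hun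
    rw [Fw_transfer hx.labB hx'.labB h1' hD hm hme, Fw, Fw, un_F, un_F, ih]
    simp only [hgm.ht_Fw, hg'.ht_Fw, ih, hpp]

/-- Vanishing of a word does not depend on the base curve. -/
theorem Dw_congr (hx : Base x) (hx' : Base x') (h1 : x 1 = x' 1) {l : List κ}
    (hD : Dw B l (bs x)) : Dw B l (bs x') := by
  have hg : Good B (lab B l.length l) := good_lab (Nat.le_succ _)
  have h1' : (labB x 1 : κ × Fin (l.length + 1) → ℝ) = labB x' 1 :=
    funext fun p => congrFun h1 p.1
  have := Dw_transfer hx.labB hx'.labB h1' ((Dw_lab hg).2 (by rwa [lab_map]))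
  rwa [Dw_lab hg, lab_map] at this

/-- Equality of two words does not depend on the base curve. -/
theorem Fw_congr (hx : Base x) (hx' : Base x') (h1 : x 1 = x' 1) (htame : Tame x)
    {l l' : List κ} (hD : Dw B l (bs x)) (hD' : Dw B l' (bs x))
    (he : ∀ t ∈ Icc (0 : ℝ) 1, Fw B l (bs x) t = Fw B l' (bs x) t) (t : ℝ) :
    Fw B l (bs x') t = Fw B l' (bs x') t := by
  have hg : Good B (lab B (l.length + l'.length) l) := good_lab (by omega)
  have hg' : Good B (lab B (l.length + l'.length) l') := good_lab (by omega)
  have hDl := (Dw_lab (x := x) hg).2 (by rwa [lab_map])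
  have hDl' := (Dw_lab (x := x) hg').2 (by rwa [lab_map])
  have := un_transfer hx hx' h1 htame hg hg' hDl hDl' (un_Fw_ext hx hDl hDl' fun s hs => by
    rw [un_Fw hg, un_Fw hg', lab_map, lab_map, he s hs]) t
  rwa [un_Fw hg, un_Fw hg', lab_map, lab_map] at this

end Identified

/-- A height function with integral minimum `m` and rational cutting points. -/
structure RatC (f : ℝ → ℝ) (m : ℤ) : Prop where
  cont : Continuous f
  lo_eq : lo f 0 = m
  att : ∃ t ∈ Icc (0 : ℝ) 1, f t = m
  low : ∀ t ∈ Icc (0 : ℝ) 1, m ≤ f t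
  one : ∃ n : ℤ, f 1 = n
  last : ∀ p ∈ Icc (0 : ℝ) 1, f p = m → (∀ s ∈ Icc (0 : ℝ) 1, f s = m → s ≤ p) →
    ∃ r : ℚ, (r : ℝ) = p
  first : ∀ p ∈ Icc (0 : ℝ) 1, ∀ q ∈ Icc p 1, f p = m → f q = m + 1 →
    (∀ s ∈ Icc p 1, f s = m + 1 → q ≤ s) → ∃ r : ℚ, (r : ℝ) = q
  form : m + 1 ≤ f 1 → ∃ p q, Form f m p q

/-- Piecewise linear curves with rational data. -/
def RatPL {ι : Type*} (x : ℝ → ι → ℝ) : Prop :=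
  ∀ τ ∈ Ioo (0 : ℝ) 1, (∃ r : ℚ, (r : ℝ) = τ) ∨
    ∃ a d : ι → ℚ, ∀ᶠ s in 𝓝 τ, ∀ j, x s j = a j + s * d j

section GCM

variable {ι : Type*} [Fintype ι] [DecidableEq ι] {A : ι → ι → ℤ} [hA : IsGCM A]

/-- Vectors with rational coordinates. -/
def RatV (v : VV ι) : Prop :=
  (∀ j, ∃ r : ℚ, v.1 j = r) ∧ ∀ j, ∃ r : ℚ, v.2 j = r

theorem RatV.ht {v : VV ι} (hv : RatV v) (i : ι) : ∃ r : ℚ, ht A i v = r := by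
  obtain ⟨h1, h2⟩ := hv
  choose r hr using h2
  obtain ⟨s, hs⟩ := h1 i
  exact ⟨s + ∑ j, A i j * r j, by simp [ht_apply, hs, hr]⟩

theorem RatV.smul {v : VV ι} (hv : RatV v) (w : W A) : RatV (w • v) := by
  induction w using W_induction with
  | h1 => simpa
  | hs i w ih =>
    rw [mul_smul, sg_smul]
    obtain ⟨r, hr⟩ := ih.ht (A := A) i
    refine ⟨fun j => ?_, fun j => ?_⟩
    · obtain ⟨s, hs⟩ := ih.1 j
      exact ⟨s, by rw [VV.sub_fst, VV.smul_fst, rt_fst, hs]; simp⟩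
    · obtain ⟨s, hs⟩ := ih.2 j
      exact ⟨s - r * if j = i then 1 else 0, by
        rw [VV.sub_snd, VV.smul_snd, rt_snd, hs, hr]; split_ifs <;> simp⟩

variable {x : ℝ → ι → ℝ} {η : ℝ → VV ι} {wl wr : ℝ → W A}

/-- Crossing of an integral level at a point of linearity happens at a rational time. -/
theorem rational_of_crossing (hpl : RatPL x) {τ : ℝ} (hτ : τ ∈ Ioo (0 : ℝ) 1) {w : W A}
    (hw : η τ - w • bs x τ ∈ Lat ι) {l : Filter ℝ} (hl : l ≤ 𝓝 τ)
    (hs : ∀ᶠ s in l, η s - η τ = w • (bs x s - bs x τ)) {i : ι} {n : ℤ}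
    (hn : ht A i (η τ) = n) (hf : ∃ᶠ s in l, ht A i (η s) ≠ n) : ∃ r : ℚ, (r : ℝ) = τ := by
  rcases hpl τ hτ with h | ⟨a, d, had⟩
  · exact h
  have hτ' := had.self_of_nhds
  obtain ⟨s, hsn, hs, hd⟩ := (hf.and_eventually (hs.and (hl had))).exists
  obtain ⟨k, hk⟩ := ht_Lat (A := A) hw i
  have ha : RatV (mkV (fun j => (a j : ℝ)) 0 : VV ι) := ⟨fun j => ⟨a j, rfl⟩, fun j => ⟨0, by simp⟩⟩
  have hdd : RatV (mkV (fun j => (d j : ℝ)) 0 : VV ι) :=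
    ⟨fun j => ⟨d j, rfl⟩, fun j => ⟨0, by simp⟩⟩
  obtain ⟨ra, hra⟩ := (ha.smul w).ht (A := A) i
  obtain ⟨c, hc⟩ := (hdd.smul w).ht (A := A) i
  have e1 : (bs x s - bs x τ : VV ι) = (s - τ) • mkV (fun j => (d j : ℝ)) 0 :=
    VV.ext (fun j => by simp [bs, hd, hτ']; ring) fun j => by simp [bs]
  have e2 : (bs x τ : VV ι) = mkV (fun j => (a j : ℝ)) 0 + τ • mkV (fun j => (d j : ℝ)) 0 :=
    VV.ext (fun j => by simp [bs, hτ']) fun j => by simp [bs]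
  have h1 := congrArg (ht A i) hs
  rw [e1, smul_comm, map_sub, map_smul, hc, hn, smul_eq_mul] at h1
  rw [e2, smul_add, smul_comm w τ, map_sub, map_add, hn, hra, map_smul, hc, smul_eq_mul] at hk
  have hc0 : (c : ℝ) ≠ 0 := fun h => hsn (by rw [h, mul_zero] at h1; linarith)
  refine ⟨(n - k - ra) / c, ?_⟩
  push_cast
  rw [div_eq_iff hc0]
  linarith

theorem LSd.ratC (h : LSd x η wl wr) (hx : Base x) (hpl : RatPL x) (i : ι) :
    ∃ m, RatC (fun s => ht A i (η s)) m := by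
  obtain ⟨m, h1, -, h3, h4⟩ := h.exists_min hx i
  refine ⟨m, h.continuous_ht hx i, h1, h3, h4, h.isI_one hx i, fun p hp hv hl => ?_,
    fun p hp q hq hvp hv hl => ?_, fun hD => ?_⟩
  · rcases hp.2.eq_or_lt with rfl | hp1
    · exact ⟨1, by simp⟩
    rcases hp.1.eq_or_lt with rfl | hp0
    · exact ⟨0, by simp⟩
    have hp' : p ∈ Ioo (0 : ℝ) 1 := ⟨hp0, hp1⟩
    refine rational_of_crossing (l := 𝓝[>] p) hpl hp' (w := wr p) ?_ nhdsWithin_le_nhds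
      ((h.right p ⟨hp.1, hp1⟩).mono fun s hs => hs.2.2) hv ?_
    · have := (Lat ι).sub_mem (h.lat p ⟨hp0, hp.2⟩) (h.chain p hp').sub_mem
      simpa using this
    · refine Eventually.frequently ?_
      filter_upwards [Ioo_mem_nhdsGT hp1] with s hs hc
      exact (hl s ⟨hp.1.trans hs.1.le, hs.2.le⟩ hc).not_gt hs.1
  · have hq0 : p < q := lt_of_le_of_ne hq.1 fun hc => by
      subst hc
      exact absurd (hvp.symm.trans hv) (by simp)
    rcases hq.2.eq_or_lt with rfl | hq1
    · exact ⟨1, by simp⟩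
    refine rational_of_crossing (l := 𝓝[<] q) (n := m + 1) hpl ⟨hp.1.trans_lt hq0, hq1⟩
      (h.lat q ⟨hp.1.trans_lt hq0, hq.2⟩) nhdsWithin_le_nhds
      ((h.left q ⟨hp.1.trans_lt hq0, hq.2⟩).mono fun s hs => ?_) (by simpa using hv) ?_
    · rw [← neg_sub, hs.2.2, ← smul_neg, neg_sub]
    · refine Eventually.frequently ?_
      filter_upwards [Ioo_mem_nhdsLT hq0] with s hs hc
      exact (hl s ⟨hs.1.le, hs.2.le.trans hq.2⟩ (by simpa using hc)).not_gt hs.2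
  · obtain ⟨_, _, m', p, q, hf, -⟩ := h.lower hx (i := i) (by rw [Dn, h1]; exact hD)
    have : m' = (m : ℝ) := by rw [← h1, hf.lo_before le_rfl hf.p_nonneg]
    exact ⟨p, q, this ▸ hf⟩

end GCM

section Step

open GKM

variable {I V : Type*} [AddCommGroup V] [Module ℚ V] {α : I → V} {coroot : I → (V →ₗ[ℚ] ℚ)}
  {i : I} {π : ℚ → V} {f : ℝ → ℝ} {m : ℤ}

theorem Form.refine {m p q p' q' : ℝ} (h : Form f m p q) (hp : p' ∈ Icc (0 : ℝ) 1) (hv : f p' = m)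
    (hl : ∀ s ∈ Icc (0 : ℝ) 1, f s = m → s ≤ p') (hq : q' ∈ Icc p' 1) (hv' : f q' = m + 1)
    (hl' : ∀ s ∈ Icc p' 1, f s = m + 1 → q' ≤ s) : Form f m p' q' := by
  have h1 : p ≤ p' := hl p ⟨h.p_nonneg, h.lt.le.trans h.q_le⟩ h.at_p
  have h2 : p' < q := by
    by_contra! hc
    have := h.after p' ⟨hc, hp.2⟩
    linarith
  have h3 : q' ≤ q := hl' q ⟨h2.le, h.q_le⟩ h.at_q
  refine ⟨hp.1, lt_of_le_of_ne hq.1 fun hc => ?_, hq.2, fun t htm => h.ge ⟨htm.1, htm.2.trans hp.2⟩,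
    hv, h.mono.mono (Icc_subset_Icc h1 h3), hv', fun t htm => ?_⟩
  · rw [← hc] at hv'; linarith
  · rcases le_total t q with h4 | h4
    · rw [← hv']
      exact h.mono ⟨h1.trans hq.1, h3⟩ ⟨h1.trans (hq.1.trans htm.1), h4⟩ htm.1
    · exact h.after t ⟨h4, htm.2⟩

theorem RatC.mOf_eq (h : RatC f m)
    (hπ : ∀ t : ℚ, 0 ≤ t → t ≤ 1 → ((coroot i (π t) : ℚ) : ℝ) = f t) :
    mOf coroot i π = m ∧ ∃ tp, IsFPlus coroot i π tp := by
  obtain ⟨t, htm, hv⟩ := h.att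
  obtain ⟨p, hp, hv, hl⟩ := LSd.exists_last h.cont htm hv
  obtain ⟨r, rfl⟩ := h.last p hp hv hl
  have hr0 : 0 ≤ r := by exact_mod_cast hp.1
  have hr1 : r ≤ 1 := by exact_mod_cast hp.2
  have hm : mOf coroot i π = m := by
    refine IsLeast.csInf_eq ⟨⟨r, hr0, hr1, ?_⟩, ?_⟩
    · rw [← hπ r hr0 hr1] at hv
      exact_mod_cast hv
    · rintro n ⟨t, h0, h1, hn⟩
      have h2 := h.low t ⟨by exact_mod_cast h0, by exact_mod_cast h1⟩
      rw [← hπ t h0 h1, show coroot i (π t) = n from hn] at h2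
      exact_mod_cast h2
  refine ⟨hm, r, hr0, hr1, ?_, fun t h0 h1 hn => ?_⟩
  · rw [← hπ r hr0 hr1] at hv
    rw [hm]
    exact_mod_cast hv
  · rw [hm] at hn
    have := hl t ⟨by exact_mod_cast h0, by exact_mod_cast h1⟩ (by
      rw [← hπ t h0 h1, show coroot i (π t) = m from hn]; simp)
    exact_mod_cast this

variable (h : RatC f m) (hπ : ∀ t : ℚ, 0 ≤ t → t ≤ 1 → ((coroot i (π t) : ℚ) : ℝ) = f t)

include h hπ

theorem RatC.le_of_IsFPlus {tp : ℚ} (htp : IsFPlus coroot i π tp) (hlt : tp < 1) : m + 1 ≤ f 1 := by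
  obtain ⟨n, hn⟩ := h.one
  have h1 := h.low 1 (by simp)
  rw [hn] at h1 ⊢
  have h1 : m ≤ n := by exact_mod_cast h1
  have : m ≠ n := fun hc => by
    have h2 := hπ 1 zero_le_one le_rfl
    rw [Rat.cast_one, hn, ← hc] at h2
    refine (htp.2.2.2 1 zero_le_one le_rfl ?_).not_gt hlt
    rw [(h.mOf_eq hπ).1]
    exact_mod_cast h2
  exact_mod_cast (by omega : m + 1 ≤ n)

theorem RatC.last_of_IsFPlus {tp : ℚ} (htp : IsFPlus coroot i π tp) :
    (tp : ℝ) ∈ Icc (0 : ℝ) 1 ∧ f tp = m ∧ ∀ s ∈ Icc (0 : ℝ) 1, f s = m → s ≤ tp := by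
  obtain ⟨h0, h1, h2, h3⟩ := htp
  have hm := (h.mOf_eq hπ).1
  rw [hm] at h2 h3
  have h0' : (0 : ℝ) ≤ tp := by exact_mod_cast h0
  have h1' : (tp : ℝ) ≤ 1 := by exact_mod_cast h1
  have hv : f tp = m := by
    rw [← hπ tp h0 h1, show coroot i (π tp) = m from h2]; simp
  obtain ⟨p, hp, hvp, hl⟩ := LSd.exists_last h.cont ⟨h0', h1'⟩ hv
  obtain ⟨r, rfl⟩ := h.last p hp hvp hl
  have hr0 : 0 ≤ r := by exact_mod_cast hp.1
  have hr1 : r ≤ 1 := by exact_mod_cast hp.2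
  have h4 : r ≤ tp := h3 r hr0 hr1 (by
    rw [← hπ r hr0 hr1] at hvp
    exact_mod_cast hvp)
  exact ⟨⟨h0', h1'⟩, hv, fun s hs hsv => (hl s hs hsv).trans (by exact_mod_cast h4)⟩

theorem RatC.first_of_IsFMinus {tp tm : ℚ} (htp : IsFPlus coroot i π tp)
    (hms : IsFMinus coroot i π tp tm) :
    (tm : ℝ) ∈ Icc (tp : ℝ) 1 ∧ f tm = m + 1 ∧ ∀ s ∈ Icc (tp : ℝ) 1, f s = m + 1 → tm ≤ s := by
  obtain ⟨h0, h1, h2, h3⟩ := hms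
  obtain ⟨g1, g2, -⟩ := h.last_of_IsFPlus hπ htp
  rw [(h.mOf_eq hπ).1] at h2 h3
  have h0' : (tp : ℝ) ≤ tm := by exact_mod_cast h0
  have h1' : (tm : ℝ) ≤ 1 := by exact_mod_cast h1
  have hv : f tm = m + 1 := by
    rw [← hπ tm (htp.1.trans h0) h1, show coroot i (π tm) = m + 1 from h2]; simp
  obtain ⟨q, hq, hvq, hl⟩ := LSd.exists_first h.cont ⟨h0', h1'⟩ hv
  obtain ⟨r, rfl⟩ := h.first tp g1 q hq g2 hvq hl
  have hr0 : tp ≤ r := by exact_mod_cast hq.1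
  have hr1 : r ≤ 1 := by exact_mod_cast hq.2
  have h4 : tm ≤ r := h3 r hr0 hr1 (by
    rw [← hπ r (htp.1.trans hr0) hr1] at hvq
    exact_mod_cast hvq)
  exact ⟨⟨h0', h1'⟩, hv, fun s hs hsv => le_trans (by exact_mod_cast h4) (hl s hs hsv)⟩

theorem RatC.FRel_imp {π' : ℚ → V} (hF : FRel α coroot i π π') :
    m + 1 ≤ f 1 ∧ ∀ t : ℚ, 0 ≤ t → t ≤ 1 → ∃ a : ℚ, (a : ℝ) = amt f t ∧ π' t = π t - a • α i := by
  obtain ⟨tp, tm, htp, hlt, hms, he⟩ := hF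
  have hD := h.le_of_IsFPlus hπ htp hlt
  refine ⟨hD, fun t h0 h1 => ?_⟩
  obtain ⟨p, q, hf⟩ := h.form hD
  obtain ⟨a1, a2, a3⟩ := h.last_of_IsFPlus hπ htp
  obtain ⟨b1, b2, b3⟩ := h.first_of_IsFMinus hπ htp hms
  have hf := hf.refine a1 a2 a3 b1 b2 b3
  have h0' : (0 : ℝ) ≤ t := by exact_mod_cast h0
  have h1' : (t : ℝ) ≤ 1 := by exact_mod_cast h1
  rw [he t h0 h1, fPath]
  split_ifs with c1 c2
  · exact ⟨0, by rw [hf.amt_before h0' (by exact_mod_cast c1)]; simp, by simp⟩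
  · have c1' : (tp : ℝ) ≤ t := by exact_mod_cast (not_le.1 c1).le
    have c2' : (t : ℝ) ≤ tm := by exact_mod_cast c2
    refine ⟨coroot i (π t - π tp), ?_, ?_⟩
    · rw [hf.amt_mid ⟨c1', c2'⟩, map_sub, Rat.cast_sub, hπ t h0 h1, hπ tp htp.1 htp.2.1, a2]
    · simp [srefl]
      abel
  · have c2' : (tm : ℝ) ≤ t := by exact_mod_cast (not_le.1 c2).le
    exact ⟨1, by rw [hf.amt_after ⟨c2', h1'⟩]; simp, by simp⟩

theorem RatC.exists_FRel (hD : m + 1 ≤ f 1) : ∃ π', FRel α coroot i π π' := by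
  obtain ⟨hm, tp, htp⟩ := h.mOf_eq hπ
  obtain ⟨p, q, hf⟩ := h.form hD
  obtain ⟨a1, a2, a3⟩ := h.last_of_IsFPlus hπ htp
  have h2 : (tp : ℝ) < q := by
    by_contra! hc
    have := hf.after tp ⟨hc, a1.2⟩
    linarith
  obtain ⟨u, hu, hvu, hl⟩ := LSd.exists_first h.cont ⟨h2.le, hf.q_le⟩ hf.at_q
  obtain ⟨r, rfl⟩ := h.first tp a1 u hu a2 hvu hl
  have hr0 : tp ≤ r := by exact_mod_cast hu.1
  have hr1 : r ≤ 1 := by exact_mod_cast hu.2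
  refine ⟨_, tp, r, htp, ?_, ⟨hr0, hr1, ?_, fun t h0 h1 hv => ?_⟩, fun t _ _ => rfl⟩
  · exact_mod_cast h2.trans_le hf.q_le
  · rw [← hπ r (htp.1.trans hr0) hr1] at hvu
    rw [hm]
    exact_mod_cast hvu
  · rw [hm] at hv
    have := hl t ⟨by exact_mod_cast h0, by exact_mod_cast h1⟩ (by
      rw [← hπ t (htp.1.trans h0) h1, show coroot i (π t) = m + 1 from hv]; simp)
    exact_mod_cast this

end Step

open GKM

section Link

variable {κ V : Type*} [Fintype κ] [DecidableEq κ] [AddCommGroup V] [Module ℚ V]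
  {B : κ → κ → ℤ} [hB : IsBCM B] {α : κ → V} {coroot : κ → (V →ₗ[ℚ] ℚ)}

/-- The path `b` has dominant piecewise linear heights, described by the curve `x`. -/
structure Models (coroot : κ → (V →ₗ[ℚ] ℚ)) (b : ℚ → V) (x : ℝ → κ → ℝ) : Prop where
  base : Base x
  pl : RatPL x
  tame : Tame x
  agree : ∀ t : ℚ, 0 ≤ t → t ≤ 1 → ∀ k, ((coroot k (b t) : ℚ) : ℝ) = x t k

/-- The path `p` differs from `b` by the root part of the curve `η`. -/
def Rep (α : κ → V) (b p : ℚ → V) (η : ℝ → VV κ) : Prop :=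
  ∀ t : ℚ, 0 ≤ t → t ≤ 1 →
    ∃ c : κ → ℚ, (∀ k, (c k : ℝ) = (η t).2 k) ∧ p t = b t + ∑ k, c k • α k

variable {b b' p p' : ℚ → V} {x x' : ℝ → κ → ℝ}

theorem exists_ratC (hx : Base x) (hpl : RatPL x) {l : List κ} (hD : Dw B l (bs x)) (k : κ) :
    ∃ m, RatC (fun s => ht B k (Fw B l (bs x) s)) m := by
  have hg : Good B (lab B l.length (k :: l)) := good_lab (by simp)
  rw [lab] at hg
  obtain ⟨_, _, h⟩ := Fw_LSd hx.labB ((Dw_lab (x := x) hg.of_cons).2 (by rwa [lab_map]))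
  have hpl' : RatPL (labB x : ℝ → κ × Fin (l.length + 1) → ℝ) := fun τ hτ => by
    rcases hpl τ hτ with h | ⟨a, d, h⟩
    · exact Or.inl h
    · exact Or.inr ⟨fun q => a q.1, fun q => d q.1, h.mono fun s hs q => hs q.1⟩
  obtain ⟨m, hm⟩ := h.ratC hx.labB hpl' (k, if B k k = 2 then 0 else Fin.ofNat _ l.length)
  refine ⟨m, ?_⟩
  simpa only [hg.ht_Fw, un_Fw hg.of_cons, lab_map] using hm

theorem Rep.agree (hM : Models coroot b x) (hpair : ∀ i j, coroot i (α j) = (B i j : ℚ))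
    {l : List κ} (h : Rep α b p (Fw B l (bs x))) (k : κ) (t : ℚ) (h0 : 0 ≤ t) (h1 : t ≤ 1) :
    ((coroot k (p t) : ℚ) : ℝ) = ht B k (Fw B l (bs x) t) := by
  obtain ⟨c, hc, hp⟩ := h t h0 h1
  rw [hp, ht_apply, Fw_fst, map_add, Rat.cast_add, hM.agree t h0 h1, map_sum, Rat.cast_sum]
  congr 1
  refine Finset.sum_congr rfl fun j _ => ?_
  rw [map_smul, hpair, smul_eq_mul, Rat.cast_mul, hc, mul_comm]
  simp

theorem rep_of_FMonRel (hM : Models coroot b x) (hpair : ∀ i j, coroot i (α j) = (B i j : ℚ))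
    {l : List κ} (h : FMonRel α coroot l b p) : Dw B l (bs x) ∧ Rep α b p (Fw B l (bs x)) := by
  induction l generalizing p with
  | nil => exact ⟨trivial, fun t h0 h1 => ⟨0, fun k => by simp [Fw, bs], by simp [h t h0 h1]⟩⟩
  | cons i l ih =>
    obtain ⟨p₀, hp₀, hF⟩ := h
    obtain ⟨hD, hR⟩ := ih hp₀
    obtain ⟨m, hm⟩ := exists_ratC hM.base hM.pl hD i
    obtain ⟨h1, h2⟩ := hm.FRel_imp (hR.agree hM hpair i) hF
    refine ⟨⟨hD, by rw [Dn, hm.lo_eq]; exact h1⟩, fun t ht0 ht1 => ?_⟩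
    obtain ⟨c, hc, hp⟩ := hR t ht0 ht1
    obtain ⟨a, ha, hpa⟩ := h2 t ht0 ht1
    refine ⟨fun k => c k - if k = i then a else 0, fun k => ?_, ?_⟩
    · rw [Fw, F, VV.sub_snd, VV.smul_snd, rt_snd, ← hc, ← ha]
      by_cases hk : k = i <;> simp [hk]
    · rw [hpa, hp]
      simp [sub_smul, Finset.sum_sub_distrib, ite_smul, add_sub_assoc]

theorem exists_FMonRel (hM : Models coroot b x) (hpair : ∀ i j, coroot i (α j) = (B i j : ℚ))
    {l : List κ} (h : Dw B l (bs x)) : ∃ p, FMonRel α coroot l b p := by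
  induction l with
  | nil => exact ⟨b, fun t _ _ => rfl⟩
  | cons i l ih =>
    obtain ⟨p₀, hp₀⟩ := ih h.1
    obtain ⟨m, hm⟩ := exists_ratC hM.base hM.pl h.1 i
    have hD := h.2
    rw [Dn, hm.lo_eq] at hD
    obtain ⟨p, hp⟩ := hm.exists_FRel ((rep_of_FMonRel hM hpair hp₀).2.agree hM hpair i) (α := α) hD
    exact ⟨p, p₀, hp₀, hp⟩

theorem FMonRel_transfer (hM : Models coroot b x) (hM' : Models coroot b' x') (h1 : x 1 = x' 1)
    (hpair : ∀ i j, coroot i (α j) = (B i j : ℚ)) {l : List κ} (h : FMonRel α coroot l b p) :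
    ∃ p', FMonRel α coroot l b' p' :=
  exists_FMonRel hM' hpair (Dw_congr hM.base hM'.base h1 (rep_of_FMonRel hM hpair h).1)

theorem Fw_one_eq {l : List κ} (hD : Dw B l (bs x)) (hD' : Dw B l (bs x')) (k : κ) :
    (Fw B l (bs x) 1).2 k = (Fw B l (bs x') 1).2 k := by
  have hg : Good B (lab B l.length l) := good_lab (Nat.le_succ _)
  have e := un_Fw (x := x) hg 1
  have e' := un_Fw (x := x') hg 1
  rw [lab_map] at e e'
  rw [← e, ← e', un_snd, un_snd]
  refine Finset.sum_congr rfl fun r _ => ?_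
  rw [Fw_one ((Dw_lab hg).2 (by rwa [lab_map])), Fw_one ((Dw_lab hg).2 (by rwa [lab_map]))]
  rfl

theorem endpoint_eq (hM : Models coroot b x) (hM' : Models coroot b' x') (hb : b 1 = b' 1)
    (hpair : ∀ i j, coroot i (α j) = (B i j : ℚ)) {l : List κ} (h : FMonRel α coroot l b p)
    (h' : FMonRel α coroot l b' p') : p 1 = p' 1 := by
  obtain ⟨hD, hR⟩ := rep_of_FMonRel hM hpair h
  obtain ⟨hD', hR'⟩ := rep_of_FMonRel hM' hpair h'
  obtain ⟨c, hc, hp⟩ := hR 1 zero_le_one le_rfl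
  obtain ⟨c', hc', hp'⟩ := hR' 1 zero_le_one le_rfl
  have : c = c' := funext fun k => by
    have := Fw_one_eq hD hD' k
    rw [Rat.cast_one] at hc hc'
    rw [← hc, ← hc'] at this
    exact_mod_cast this
  rw [hp, hp', hb, this]

theorem continuous_Fw_snd (hx : Base x) {l : List κ} (hD : Dw B l (bs x)) (k : κ) :
    (Continuous fun t => (Fw B l (bs x) t).2 k) ∧ ∀ t, Fw B l (bs x) (cl t) = Fw B l (bs x) t := by
  have hg : Good B (lab B l.length l) := good_lab (Nat.le_succ _)
  obtain ⟨_, _, h⟩ := Fw_LSd hx.labB ((Dw_lab (x := x) hg).2 (by rwa [lab_map]))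
  have e := fun t => un_Fw (x := x) hg t
  simp only [lab_map] at e
  simp only [← e, h.clamp, un_snd, implies_true, and_true]
  exact continuous_finsetSum _ fun r _ => h.cont _

theorem pathEq_iff (hM : Models coroot b x) (hind : LinearIndependent ℚ α)
    (hpair : ∀ i j, coroot i (α j) = (B i j : ℚ)) {l l' : List κ} (h : FMonRel α coroot l b p)
    (h' : FMonRel α coroot l' b p') :
    pathEq p p' ↔ ∀ t ∈ Icc (0 : ℝ) 1, Fw B l (bs x) t = Fw B l' (bs x) t := by
  obtain ⟨hD, hR⟩ := rep_of_FMonRel hM hpair h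
  obtain ⟨hD', hR'⟩ := rep_of_FMonRel hM hpair h'
  constructor
  · intro he t _
    refine VV.ext (fun k => by rw [Fw_fst, Fw_fst]) fun k => ?_
    obtain ⟨c1, c2⟩ := continuous_Fw_snd hM.base hD k
    obtain ⟨d1, d2⟩ := continuous_Fw_snd hM.base hD' k
    refine congrFun (Rat.isDenseEmbedding_coe_real.dense.equalizer c1 d1 (funext fun r => ?_)) t
    have hcl : ∃ s : ℚ, 0 ≤ s ∧ s ≤ 1 ∧ cl r = s := by
      refine ⟨max 0 (min r 1), le_max_left _ _, max_le zero_le_one (min_le_right _ _), ?_⟩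
      rw [cl]; push_cast; rfl
    obtain ⟨s, hs0, hs1, hs⟩ := hcl
    obtain ⟨c, hc, hp⟩ := hR s hs0 hs1
    obtain ⟨c', hc', hp'⟩ := hR' s hs0 hs1
    have hz : ∑ k, c k • α k = ∑ k, c' k • α k := by
      have := he s hs0 hs1
      rwa [hp, hp', add_right_inj] at this
    have hcc : c k = c' k := by
      rw [← sub_eq_zero, ← Finset.sum_sub_distrib] at hz
      simp only [← sub_smul] at hz
      exact sub_eq_zero.1 (Fintype.linearIndependent_iff.1 hind _ hz k)
    show (Fw B l (bs x) r).2 k = (Fw B l' (bs x) r).2 k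
    rw [← c2, ← d2, hs, ← hc, ← hc', hcc]
  · intro he t h0 h1
    obtain ⟨c, hc, hp⟩ := hR t h0 h1
    obtain ⟨c', hc', hp'⟩ := hR' t h0 h1
    have : c = c' := funext fun k => by
      have h2 := he t ⟨by exact_mod_cast h0, by exact_mod_cast h1⟩
      have h3 := hc k
      rw [h2, ← hc'] at h3
      exact_mod_cast h3
    rw [hp, hp', this]

theorem pathEq_transfer (hM : Models coroot b x) (hM' : Models coroot b' x') (h1 : x 1 = x' 1)
    (hind : LinearIndependent ℚ α) (hpair : ∀ i j, coroot i (α j) = (B i j : ℚ)) {l l' : List κ}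
    {q q' : ℚ → V} (h : FMonRel α coroot l b p) (h' : FMonRel α coroot l' b p')
    (k : FMonRel α coroot l b' q) (k' : FMonRel α coroot l' b' q') (he : pathEq p p') :
    pathEq q q' :=
  (pathEq_iff hM' hind hpair k k').2 fun t _ =>
    Fw_congr hM.base hM'.base h1 hM.tame (rep_of_FMonRel hM hpair h).1
      (rep_of_FMonRel hM hpair h').1 ((pathEq_iff hM hind hpair h h').1 he) t

theorem cl_monotone : Monotone cl := fun s t h => by
  unfold cl
  gcongr

theorem cl_idem (t : ℝ) : cl (cl t) = cl t := cl_of_mem (cl_mem t)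

theorem eventually_cl {τ : ℝ} (hτ : τ ∈ Ioo (0 : ℝ) 1) : ∀ᶠ s in 𝓝 τ, cl s = s :=
  Filter.mem_of_superset (isOpen_Ioo.mem_nhds hτ) fun _ hs => cl_of_mem (Ioo_subset_Icc_self hs)

/-- The heights of a straight line. -/
noncomputable def lineCurve (n : κ → ℚ) (t : ℝ) (k : κ) : ℝ := cl t * n k

/-- The heights of a concatenation of two straight lines. -/
noncomputable def concatCurve (m n : κ → ℚ) (t : ℝ) (k : κ) : ℝ :=
  min (2 * cl t) 1 * m k + max (2 * cl t - 1) 0 * n k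

theorem models_line {v : V} (hv : v ∈ Pplus coroot) :
    Models coroot (fun t => t • v) (lineCurve fun k => coroot k v) where
  base :=
    { cont := fun k => continuous_cl.mul continuous_const
      mono := fun k s t h => mul_le_mul_of_nonneg_right (cl_monotone h)
        (by exact_mod_cast hv.2 k)
      zero := by funext k; simp [lineCurve, cl]
      one := fun k => by
        obtain ⟨n, hn⟩ := hv.1 k
        exact ⟨n, by simp [lineCurve, cl, hn]⟩
      clamp := fun t => by funext k; rw [lineCurve, cl_idem]; rfl }
  pl τ hτ := Or.inr ⟨0, fun k => coroot k v, (eventually_cl hτ).mono fun s hs k => by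
    simp [lineCurve, hs]⟩
  tame τ hτ := Or.inl ⟨fun k => coroot k v, (eventually_cl hτ).mono fun s hs k => by
      rw [lineCurve, lineCurve, hs, cl_of_mem (Ioo_subset_Icc_self hτ)]; ring,
    fun k hk => by
      rw [lineCurve, cl_of_mem (Ioo_subset_Icc_self hτ)] at hk
      exact (mul_eq_zero.1 hk).resolve_left hτ.1.ne'⟩
  agree t h0 h1 k := by
    rw [lineCurve, cl_of_mem ⟨by exact_mod_cast h0, by exact_mod_cast h1⟩]
    simp

theorem models_concat {v w : V} (hv : v ∈ Pplus coroot) (hw : w ∈ Pplus coroot) :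
    Models coroot (fun t => if t ≤ 1/2 then (2*t) • v else v + (2*t - 1) • w)
      (concatCurve (fun k => coroot k v) fun k => coroot k w) := by
  have hv0 : ∀ k, (0 : ℝ) ≤ coroot k v := fun k => by exact_mod_cast hv.2 k
  have hw0 : ∀ k, (0 : ℝ) ≤ coroot k w := fun k => by exact_mod_cast hw.2 k
  have hleft : ∀ s, cl s = s → s ≤ 1 / 2 → ∀ k,
      concatCurve (fun k => coroot k v) (fun k => coroot k w) s k = 2 * s * (coroot k v : ℚ) :=
    fun s hs h k => by
      rw [concatCurve, hs, min_eq_left (by linarith), max_eq_right (by linarith)]; ring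
  have hright : ∀ s, cl s = s → 1 / 2 ≤ s → ∀ k,
      concatCurve (fun k => coroot k v) (fun k => coroot k w) s k =
        (coroot k v : ℚ) + (2 * s - 1) * (coroot k w : ℚ) :=
    fun s hs h k => by
      rw [concatCurve, hs, min_eq_right (by linarith), max_eq_left (by linarith)]; ring
  have hl : ∀ τ ∈ Ioo (0 : ℝ) 1, τ < 1 / 2 → ∀ᶠ s in 𝓝 τ, ∀ k,
      concatCurve (fun k => coroot k v) (fun k => coroot k w) s k = 2 * s * (coroot k v : ℚ) :=
    fun τ hτ h => ((eventually_cl hτ).and (Iio_mem_nhds h)).mono fun s hs =>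
      hleft s hs.1 (le_of_lt hs.2)
  have hr : ∀ τ ∈ Ioo (0 : ℝ) 1, 1 / 2 < τ → ∀ᶠ s in 𝓝 τ, ∀ k,
      concatCurve (fun k => coroot k v) (fun k => coroot k w) s k =
        (coroot k v : ℚ) + (2 * s - 1) * (coroot k w : ℚ) :=
    fun τ hτ h => ((eventually_cl hτ).and (Ioi_mem_nhds h)).mono fun s hs =>
      hright s hs.1 (le_of_lt hs.2)
  refine ⟨⟨fun k => ?_, fun k s t h => ?_, ?_, fun k => ?_, fun t => ?_⟩, fun τ hτ => ?_,
    fun τ hτ => ?_, fun t h0 h1 k => ?_⟩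
  · have := continuous_cl
    unfold concatCurve
    fun_prop
  · have hc := cl_monotone h
    have h1 := hv0 k
    have h2 := hw0 k
    simp only [concatCurve]
    gcongr
  · funext k; simp [concatCurve, cl]
  · obtain ⟨m, hm⟩ := hv.1 k
    obtain ⟨n, hn⟩ := hw.1 k
    exact ⟨m + n, by rw [hright 1 (cl_of_mem (by simp)) (by norm_num), hm, hn]; push_cast; ring⟩
  · funext k; rw [concatCurve, cl_idem]; rfl
  · rcases lt_trichotomy τ (1 / 2) with h | h | h
    · exact Or.inr ⟨0, fun k => 2 * coroot k v, (hl τ hτ h).mono fun s hs k => by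
        rw [hs k]; simp; ring⟩
    · exact Or.inl ⟨1 / 2, by rw [h]; norm_num⟩
    · exact Or.inr ⟨fun k => coroot k v - coroot k w, fun k => 2 * coroot k w,
        (hr τ hτ h).mono fun s hs k => by rw [hs k]; push_cast; ring⟩
  · rcases lt_trichotomy τ (1 / 2) with h | h | h
    · refine Or.inl ⟨fun k => 2 * (coroot k v : ℚ), (hl τ hτ h).mono fun s hs k => ?_,
        fun k hk => ?_⟩
      · rw [hs k, (hl τ hτ h).self_of_nhds k]; ring
      · rw [(hl τ hτ h).self_of_nhds k, mul_right_comm] at hk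
        exact (mul_eq_zero.1 hk).resolve_right hτ.1.ne'
    · refine Or.inr fun k => ?_
      obtain ⟨m, hm⟩ := hv.1 k
      exact ⟨m, by rw [hleft τ (cl_of_mem (Ioo_subset_Icc_self hτ)) h.le, h, hm]; simp⟩
    · refine Or.inl ⟨fun k => 2 * (coroot k w : ℚ), (hr τ hτ h).mono fun s hs k => ?_,
        fun k hk => ?_⟩
      · rw [hs k, (hr τ hτ h).self_of_nhds k]; ring
      · rw [(hr τ hτ h).self_of_nhds k] at hk
        nlinarith [hv0 k, hw0 k, mul_nonneg (by linarith : 0 ≤ 2 * τ - 1) (hw0 k)]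
  · have h0' : (0 : ℝ) ≤ t := by exact_mod_cast h0
    have h1' : (t : ℝ) ≤ 1 := by exact_mod_cast h1
    split_ifs with h
    · have h2 : (t : ℝ) ≤ 1 / 2 := by
        have := Rat.cast_le (K := ℝ).2 h
        norm_num at this ⊢
        exact this
      rw [hleft t (cl_of_mem ⟨h0', h1'⟩) h2]; simp
    · have h2 : 1 / 2 < (t : ℝ) := by
        have := Rat.cast_lt (K := ℝ).2 (not_le.1 h)
        norm_num at this ⊢
        exact this
      rw [hright t (cl_of_mem ⟨h0', h1'⟩) h2.le]; simp

theorem concatCurve_one (v w : V) :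
    concatCurve (fun k => coroot k v) (fun k => coroot k w) 1 =
      lineCurve (fun k => coroot k (v + w)) 1 := by
  funext k
  rw [concatCurve, lineCurve, cl_of_mem (by simp)]
  norm_num

end Link

section Restrict

variable {I κ V : Type*} [AddCommGroup V] [Module ℚ V] {α : I → V} {coroot : I → (V →ₗ[ℚ] ℚ)}

theorem FMonRel_map (e : κ → I) {l : List κ} {π π' : ℚ → V} :
    FMonRel α coroot (l.map e) π π' ↔ FMonRel (α ∘ e) (coroot ∘ e) l π π' := by
  induction l generalizing π' with
  | nil => exact Iff.rfl
  | cons i l ih => exact exists_congr fun πm => and_congr ih Iff.rfl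

/-- Any two words involve only finitely many letters. -/
theorem exists_finite_letters (l l' : List I) :
    ∃ (s : Set I) (_ : Finite s) (m m' : List s),
      l = m.map Subtype.val ∧ l' = m'.map Subtype.val :=
  ⟨{i | i ∈ l ++ l'}, List.finite_toSet _, l.attachWith _ fun _ h => List.mem_append_left _ h,
    l'.attachWith _ fun _ h => List.mem_append_right _ h, (List.attachWith_map_subtype_val _).symm,
    (List.attachWith_map_subtype_val _).symm⟩

end Restrict

end LSPath

open GKM in
/-- Isomorphism theorem: the crystal generated by the concatenation
`π_λ ⊗ π_μ` is isomorphic to `ℙ_ν = 𝓕 π_ν`, `ν = λ + μ`: a monomial in the `f_i`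
kills `π_λ ⊗ π_μ` iff it kills `π_ν`, the surviving values have equal weights
(endpoints), and two monomials agree on `π_λ ⊗ π_μ` iff they agree on `π_ν`; hence
`f π_ν ↦ f (π_λ ⊗ π_μ)` is a well-defined weight-preserving crystal isomorphism. -/
theorem stmt18 {I V : Type*} [Countable I] [AddCommGroup V] [Module ℚ V]
    (A : I → I → ℤ) (α : I → V) (coroot : I → (V →ₗ[ℚ] ℚ))
    (hind : LinearIndependent ℚ α)
    (hpair : ∀ i j, coroot i (α j) = (A i j : ℚ))
    (hdiag : ∀ i, A i i = 2 ∨ A i i ≤ 0)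
    (hoff : ∀ i j, i ≠ j → A i j ≤ 0)
    (hzero : ∀ i j, A i j = 0 ↔ A j i = 0)
    (lam mu : V) (hlam : lam ∈ Pplus coroot) (hmu : mu ∈ Pplus coroot) :
    (∀ l : List I,
      (∃ π' : ℚ → V, FMonRel α coroot l
          (fun t => if t ≤ 1/2 then (2*t) • lam else lam + (2*t - 1) • mu) π') ↔
      (∃ π' : ℚ → V, FMonRel α coroot l (fun t => t • (lam + mu)) π')) ∧
    (∀ (l : List I) (π' π'' : ℚ → V),
      FMonRel α coroot l
        (fun t => if t ≤ 1/2 then (2*t) • lam else lam + (2*t - 1) • mu) π' →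
      FMonRel α coroot l (fun t => t • (lam + mu)) π'' →
      π' 1 = π'' 1) ∧
    (∀ (l l' : List I) (p p' q q' : ℚ → V),
      FMonRel α coroot l (fun t => t • (lam + mu)) q →
      FMonRel α coroot l' (fun t => t • (lam + mu)) q' →
      FMonRel α coroot l
        (fun t => if t ≤ 1/2 then (2*t) • lam else lam + (2*t - 1) • mu) p →
      FMonRel α coroot l'
        (fun t => if t ≤ 1/2 then (2*t) • lam else lam + (2*t - 1) • mu) p' →
      (pathEq q q' ↔ pathEq p p')) := by
  classical
  have hBCM : ∀ s : Set I, LSPath.IsBCM fun i j : s => A i j := fun s =>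
    ⟨fun k => hdiag k, fun k j h => hoff k j fun hc => h (Subtype.ext hc),
      fun k j h => (hzero k j).1 h⟩
  have hP : ∀ {v : V} (s : Set I), v ∈ Pplus coroot →
      v ∈ Pplus (coroot ∘ (Subtype.val : s → I)) := fun s h => ⟨fun k => h.1 k, fun k => h.2 k⟩
  have hsum : lam + mu ∈ Pplus coroot := by
    refine ⟨fun i => ?_, fun i => by rw [map_add]; exact add_nonneg (hlam.2 i) (hmu.2 i)⟩
    obtain ⟨m, hm⟩ := hlam.1 i
    obtain ⟨n, hn⟩ := hmu.1 i
    exact ⟨m + n, by rw [map_add, hm, hn, Int.cast_add]⟩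
  have hend : (fun t : ℚ => if t ≤ 1/2 then (2*t) • lam else lam + (2*t - 1) • mu) 1 =
      (fun t : ℚ => t • (lam + mu)) 1 := by norm_num
  have hp : ∀ (s : Set I) (i j : s), (coroot ∘ Subtype.val) i ((α ∘ Subtype.val) j) =
      ((fun i j : s => A i j) i j : ℚ) := fun s i j => hpair i j
  refine ⟨fun l => ?_, fun l π' π'' h h' => ?_, fun l l' p p' q q' hq hq' hp₁ hp₂ => ?_⟩
  · obtain ⟨s, _, m, -, rfl, -⟩ := LSPath.exists_finite_letters l []
    have := Fintype.ofFinite s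
    have := hBCM s
    simp only [LSPath.FMonRel_map]
    have h1 := LSPath.models_concat (hP s hlam) (hP s hmu)
    have h2 := LSPath.models_line (hP s hsum)
    exact ⟨fun ⟨_, h⟩ => LSPath.FMonRel_transfer h1 h2 (LSPath.concatCurve_one lam mu) (hp s) h,
      fun ⟨_, h⟩ => LSPath.FMonRel_transfer h2 h1 (LSPath.concatCurve_one lam mu).symm (hp s) h⟩
  · obtain ⟨s, _, m, -, rfl, -⟩ := LSPath.exists_finite_letters l []
    have := Fintype.ofFinite s
    have := hBCM s
    rw [LSPath.FMonRel_map] at h h'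
    exact LSPath.endpoint_eq (LSPath.models_concat (hP s hlam) (hP s hmu)) (LSPath.models_line (hP s hsum)) hend
      (hp s) h h'
  · obtain ⟨s, _, m, m', rfl, rfl⟩ := LSPath.exists_finite_letters l l'
    have := Fintype.ofFinite s
    have := hBCM s
    rw [LSPath.FMonRel_map] at hq hq' hp₁ hp₂
    have h1 := LSPath.models_concat (hP s hlam) (hP s hmu)
    have h2 := LSPath.models_line (hP s hsum)
    have hi := hind.comp (Subtype.val : s → I) Subtype.val_injective
    exact ⟨LSPath.pathEq_transfer h2 h1 (LSPath.concatCurve_one lam mu).symm hi (hp s) hq hq' hp₁ hp₂,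
      LSPath.pathEq_transfer h1 h2 (LSPath.concatCurve_one lam mu) hi (hp s) hp₁ hp₂ hq hq'⟩
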